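/- There exists an absolute constant c ≥ 1 (independent of the dimension and of the bodies) such that for every dimension d ≥ 2, every pair of convex bodies G, K ⊆ ℝ^d with 0 ∈ int(G) and G ⊆ int(K), and every α with 0 < α ≤ 1, one has c^{−d} · N_{G°}(∂K°, α) ≤ N_K(∂G, α) ≤ c^{d} · N_{G°}(∂K°, α), where ∂ denotes the topological frontier, N_K(·,·) denotes the Hilbert covering number with respect to K, and N_{G°}(·,·) the Hilbert covering number with respect to G°. -/

import Mathlib

open Set MeasureTheory Metric
open scoped Pointwise RealInnerProductSpace ENNReal

noncomputable section

abbrev Euc (d : ℕ) := EuclideanSpace ℝ (Fin d)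

/-- A convex body: a compact convex set with nonempty interior. -/
def IsConvexBody {d : ℕ} (K : Set (Euc d)) : Prop :=
  IsCompact K ∧ Convex ℝ K ∧ (interior K).Nonempty

/-- The polar of a set. -/
def polarSet {d : ℕ} (S : Set (Euc d)) : Set (Euc d) :=
  {y | ∀ x ∈ S, ⟪x, y⟫ ≤ 1}

/-- The Hilbert distance with respect to the body `K`. -/
def hilbertDist {d : ℕ} (K : Set (Euc d)) (x y : Euc d) : ℝ :=
  -(1 / 2) * Real.log ((1 - gauge ((fun k => k - x) '' K) (y - x)) *
    (1 - gauge ((fun k => k - y) '' K) (x - y)))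

/-- The Hilbert ball of radius `r` centered at `x`. -/
def hilbertBall {d : ℕ} (K : Set (Euc d)) (x : Euc d) (r : ℝ) : Set (Euc d) :=
  {y ∈ interior K | hilbertDist K x y ≤ r}

/-- The Hilbert covering number of `U` at scale `α` in the geometry induced by `K`. -/
def hilbertCov {d : ℕ} (K U : Set (Euc d)) (α : ℝ) : ℕ :=
  sInf {m : ℕ | ∃ x : Fin m → Euc d, (∀ i, x i ∈ interior K) ∧
    U ⊆ ⋃ i, hilbertBall K (x i) α}

/-- The translative covering number of `U` by translates of `α • D`. -/
def transCov {d : ℕ} (D U : Set (Euc d)) (α : ℝ) : ℕ :=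
  sInf {m : ℕ | ∃ x : Fin m → Euc d, U ⊆ ⋃ i, x i +ᵥ α • D}

/-- The Hilbert `α`-expansion of `G` in `K`. -/
def hilbertExpand {d : ℕ} (K G : Set (Euc d)) (α : ℝ) : Set (Euc d) :=
  {x ∈ interior K | sInf (hilbertDist K x '' G) ≤ α}

/-- The Lebesgue volume of the Euclidean unit ball in `ℝ^d`. -/
def ωd (d : ℕ) : ℝ := (volume (ball (0 : Euc d) 1)).toReal

/-- The Hilbert Finsler unit ball at `y` in the geometry induced by `K`. -/
def finslerBall {d : ℕ} (K : Set (Euc d)) (y : Euc d) : Set (Euc d) :=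
  {v | gauge ((fun k => k - y) '' K) v + gauge ((fun k => k - y) '' K) (-v) ≤ 2}

/-- The Hilbert Holmes–Thompson volume of `U` in the geometry induced by `K`. -/
def volH {d : ℕ} (K U : Set (Euc d)) : ℝ :=
  (1 / ωd d) * ∫ y in U, (volume (polarSet (finslerBall K y))).toReal

/-- The recentered Macbeath region `A(x) := (K ∩ (2x − K)) − x`. -/
def macbeathA {d : ℕ} (K : Set (Euc d)) (x : Euc d) : Set (Euc d) :=
  (fun k => k - x) '' (K ∩ ((fun k => (2 : ℝ) • x - k) '' K))

noncomputable section

/-- Positive sublinear functions. -/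
structure Subl {d : ℕ} (p : Euc d → ℝ) : Prop where
  add : ∀ x y, p (x + y) ≤ p x + p y
  smul : ∀ c : ℝ, 0 ≤ c → ∀ x, p (c • x) = c * p x
  pos : ∀ x, x ≠ 0 → 0 < p x

/-- The unit set. -/
def uset {d : ℕ} (p : Euc d → ℝ) : Set (Euc d) := {x | p x ≤ 1}

namespace Subl
variable {d : ℕ} {p : Euc d → ℝ}

lemma zero (hp : Subl p) : p 0 = 0 := by simpa using hp.smul 0 le_rfl 0

lemma nonneg (hp : Subl p) (x : Euc d) : 0 ≤ p x := by
  by_cases h : x = 0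
  · rw [h, hp.zero]
  · exact (hp.pos x h).le

lemma eq_zero (hp : Subl p) {x : Euc d} : p x = 0 ↔ x = 0 := by
  constructor
  · intro h; by_contra h'; exact (hp.pos x h').ne' h
  · rintro rfl; exact hp.zero

lemma convexOn (hp : Subl p) : ConvexOn ℝ univ p := by
  refine ⟨convex_univ, ?_⟩
  intro x _ y _ a b ha hb _
  calc p (a • x + b • y) ≤ p (a • x) + p (b • y) := hp.add _ _
    _ = _ := by rw [hp.smul a ha, hp.smul b hb]; rfl

lemma continuous (hp : Subl p) : Continuous p := hp.convexOn.locallyLipschitz.continuous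

lemma exists_upper (hp : Subl p) : ∃ C : ℝ, 0 < C ∧ ∀ x, p x ≤ C * ‖x‖ := by
  obtain ⟨C, hC⟩ := (isCompact_closedBall (0 : Euc d) 1).bddAbove_image hp.continuous.continuousOn
  refine ⟨max C 1, by positivity, fun x => ?_⟩
  by_cases hx : x = 0
  · subst hx; simp [hp.zero]
  have hn : 0 < ‖x‖ := norm_pos_iff.2 hx
  have h1 : p (‖x‖⁻¹ • x) ≤ C := hC ⟨_, by simp [norm_smul, hn.ne'], rfl⟩
  have h2 : p x = ‖x‖ * p (‖x‖⁻¹ • x) := by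
    rw [← hp.smul _ hn.le, smul_smul, mul_inv_cancel₀ hn.ne', one_smul]
  rw [h2, mul_comm]
  gcongr
  exact h1.trans (le_max_left _ _)

lemma exists_lower (hp : Subl p) : ∃ c : ℝ, 0 < c ∧ ∀ x, c * ‖x‖ ≤ p x := by
  by_cases hne : (sphere (0 : Euc d) 1).Nonempty
  · obtain ⟨y, hy, hmin⟩ := (isCompact_sphere (0 : Euc d) 1).exists_isMinOn hne
      hp.continuous.continuousOn
    have hy0 : y ≠ 0 := by rintro rfl; simp at hy
    refine ⟨p y, hp.pos y hy0, fun x => ?_⟩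
    by_cases hx : x = 0
    · subst hx; simp [hp.zero]
    have hn : 0 < ‖x‖ := norm_pos_iff.2 hx
    have h1 : p y ≤ p (‖x‖⁻¹ • x) := hmin (by simp [norm_smul, hn.ne'])
    have h2 : p x = ‖x‖ * p (‖x‖⁻¹ • x) := by
      rw [← hp.smul _ hn.le, smul_smul, mul_inv_cancel₀ hn.ne', one_smul]
    rw [h2, mul_comm]
    gcongr
  · refine ⟨1, one_pos, fun x => ?_⟩
    have : x = 0 := by
      by_contra hx
      apply hne
      have hn : 0 < ‖x‖ := norm_pos_iff.2 hx
      exact ⟨‖x‖⁻¹ • x, by simp [norm_smul, hn.ne']⟩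
    subst this; simp [hp.zero]

lemma lipschitz (hp : Subl p) : ∃ C, LipschitzWith C p := by
  obtain ⟨C, hC, h⟩ := hp.exists_upper
  refine ⟨⟨C, hC.le⟩, LipschitzWith.of_le_add_mul _ fun x y => ?_⟩
  have := hp.add y (x - y)
  rw [add_sub_cancel] at this
  rw [dist_eq_norm]
  exact this.trans (by gcongr; exact h _)

lemma ae_diff (hp : Subl p) : ∀ᵐ x, DifferentiableAt ℝ p x := by
  obtain ⟨C, hC⟩ := hp.lipschitz
  exact hC.ae_differentiableAt

lemma fderiv_le (hp : Subl p) (x v : Euc d) : fderiv ℝ p x v ≤ p v := by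
  by_cases h : DifferentiableAt ℝ p x
  · have h1 : HasDerivAt (fun t : ℝ => p (x + t • v)) (fderiv ℝ p x v) 0 := by
      have := h.hasFDerivAt.hasLineDerivAt v
      exact this
    have h2 := h1.tendsto_slope_zero_right
    refine le_of_tendsto h2 ?_
    filter_upwards [self_mem_nhdsWithin] with t ht
    have ht : 0 < t := ht
    have := hp.add x (t • v)
    rw [hp.smul t ht.le] at this
    simp only [zero_add, zero_smul, add_zero, smul_eq_mul]
    rw [inv_mul_le_iff₀ ht]; linarith
  · rw [fderiv_zero_of_not_differentiableAt h]; exact hp.nonneg v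

lemma euler (hp : Subl p) {x : Euc d} (h : DifferentiableAt ℝ p x) : fderiv ℝ p x x = p x := by
  have h1 : HasDerivAt (fun t : ℝ => p (x + t • x)) (fderiv ℝ p x x) 0 :=
    h.hasFDerivAt.hasLineDerivAt x
  have h2 : HasDerivAt (fun t : ℝ => (1 + t) * p x) (p x) 0 := by
    simpa using ((hasDerivAt_id (0 : ℝ)).const_add 1).mul_const (p x)
  refine h1.unique (h2.congr_of_eventuallyEq ?_)
  filter_upwards [lt_mem_nhds (show (-1 : ℝ) < 0 by norm_num)] with t ht
  rw [← hp.smul _ (by linarith), add_smul, one_smul]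

lemma fderiv_smul (hp : Subl p) {c : ℝ} (hc : 0 < c) (x : Euc d) :
    fderiv ℝ p (c • x) = fderiv ℝ p x := by
  have h1 : fderiv ℝ (fun y => p (c • y)) x = c • fderiv ℝ p (c • x) := by
    simpa using fderiv_comp_smul (f := p) (c := c) (x := x)
  have h2 : (fun y => p (c • y)) = c • p := by
    ext y; simp [hp.smul c hc.le]
  rw [h2, fderiv_const_smul_field] at h1
  exact (smul_right_injective _ hc.ne' h1).symm

lemma isCompact (hp : Subl p) : IsCompact (uset p) := by
  obtain ⟨c, hc, h⟩ := hp.exists_lower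
  refine Metric.isCompact_of_isClosed_isBounded (isClosed_le hp.continuous continuous_const) ?_
  refine (isBounded_closedBall (x := (0 : Euc d)) (r := c⁻¹)).subset fun x hx => ?_
  have hx : p x ≤ 1 := hx
  rw [mem_closedBall_zero_iff, ← one_div, le_div_iff₀ hc, mul_comm]
  exact (h x).trans hx

lemma convex (hp : Subl p) : Convex ℝ (uset p) := by
  simpa [uset] using hp.convexOn.convex_le 1

lemma zero_mem (hp : Subl p) : (0 : Euc d) ∈ interior (uset p) := by
  refine mem_interior.2 ⟨{x | p x < 1}, fun x hx => show p x ≤ 1 from le_of_lt (show p x < 1 from hx),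
    isOpen_lt hp.continuous continuous_const, ?_⟩
  simp [hp.zero]

lemma interior_eq (hp : Subl p) : interior (uset p) = {x | p x < 1} := by
  apply subset_antisymm
  · intro x hx
    by_contra hlt
    have hx1 : p x = 1 := le_antisymm (show p x ≤ 1 from (interior_subset hx : x ∈ uset p)) (not_lt.1 hlt)
    have h1 : ContinuousAt (fun t : ℝ => t • x) 1 := by fun_prop
    have h2 : ∀ᶠ t : ℝ in nhds 1, t • x ∈ uset p :=
      h1.eventually_mem (by rw [one_smul]; exact mem_interior_iff_mem_nhds.1 hx)
    obtain ⟨e, he, hball⟩ := Metric.eventually_nhds_iff.1 h2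
    have := hball (y := 1 + e / 2) (by simp [Real.dist_eq, abs_of_pos he, he])
    have h3 : p ((1 + e / 2) • x) ≤ 1 := this
    rw [hp.smul _ (by linarith), hx1] at h3
    linarith
  · exact interior_maximal (fun x hx => show p x ≤ 1 from le_of_lt (show p x < 1 from hx)) (isOpen_lt hp.continuous continuous_const)

lemma frontier_eq (hp : Subl p) : frontier (uset p) = {x | p x = 1} := by
  rw [frontier, hp.interior_eq, hp.isCompact.isClosed.closure_eq]
  ext x; simp only [uset, mem_sdiff, mem_ofPred_eq, not_lt]
  exact le_antisymm_iff.symm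

lemma measurable (hp : Subl p) : Measurable p := hp.continuous.measurable

lemma measurableSet (hp : Subl p) : MeasurableSet (uset p) := hp.isCompact.measurableSet

lemma vol_pos (hp : Subl p) : 0 < volume (uset p) :=
  (isOpen_interior.measure_pos _ ⟨0, hp.zero_mem⟩).trans_le (measure_mono interior_subset)

lemma vol_lt_top (hp : Subl p) : volume (uset p) < ⊤ := hp.isCompact.measure_lt_top

end Subl

/-- Bodies with the origin in the interior. -/
structure Bod {d : ℕ} (K : Set (Euc d)) : Prop where
  compact : IsCompact K
  convex : Convex ℝ K
  zero : (0 : Euc d) ∈ interior K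

namespace Bod
variable {d : ℕ} {K : Set (Euc d)}

lemma nhds (hK : Bod K) : K ∈ nhds (0 : Euc d) := mem_interior_iff_mem_nhds.1 hK.zero
lemma zmem (hK : Bod K) : (0 : Euc d) ∈ K := interior_subset hK.zero

lemma sub (hK : Bod K) : Subl (gauge K) where
  add := gauge_add_le hK.convex (absorbent_nhds_zero hK.nhds)
  smul c hc x := by rw [gauge_smul_of_nonneg hc]; rfl
  pos x hx := by
    rw [gauge_pos (absorbent_nhds_zero hK.nhds) ?_]
    · exact hx
    · exact NormedSpace.isVonNBounded_of_isBounded ℝ hK.compact.isBounded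

lemma uset_gauge (hK : Bod K) : uset (gauge K) = K := by
  ext x
  rw [uset, mem_ofPred_eq, gauge_le_one_iff_mem_closure hK.convex hK.nhds,
    hK.compact.isClosed.closure_eq]

lemma gauge_le_one (hK : Bod K) {x : Euc d} : gauge K x ≤ 1 ↔ x ∈ K := by
  nth_rw 2 [← hK.uset_gauge]; rfl

end Bod

lemma Subl.bod {d : ℕ} {p : Euc d → ℝ} (hp : Subl p) : Bod (uset p) :=
  ⟨hp.isCompact, hp.convex, hp.zero_mem⟩

lemma Subl.gauge_uset {d : ℕ} {p : Euc d → ℝ} (hp : Subl p) (x : Euc d) : gauge (uset p) x = p x := by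
  have hs := hp.bod.sub
  by_cases hx : x = 0
  · subst hx; rw [hs.zero, hp.zero]
  have h1 := hp.pos x hx
  have h2 := hs.pos x hx
  apply le_antisymm
  · have : gauge (uset p) ((p x)⁻¹ • x) ≤ 1 := by
      rw [hp.bod.gauge_le_one]
      change p _ ≤ 1
      rw [hp.smul _ (by positivity), inv_mul_cancel₀ h1.ne']
    rw [hs.smul _ (by positivity), inv_mul_le_iff₀ h1] at this
    linarith
  · have : p ((gauge (uset p) x)⁻¹ • x) ≤ 1 := by
      change _ ∈ uset p
      rw [← hp.bod.gauge_le_one, hs.smul _ (by positivity), inv_mul_cancel₀ h2.ne']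
    rw [hp.smul _ (by positivity), inv_mul_le_iff₀ h2] at this
    linarith

namespace Bod
variable {d : ℕ} {K : Set (Euc d)}

lemma exists_ball (hK : Bod K) : ∃ r : ℝ, 0 < r ∧ closedBall (0 : Euc d) r ⊆ K :=
  Metric.nhds_basis_closedBall.mem_iff.1 hK.nhds

lemma exists_bound (hK : Bod K) : ∃ R : ℝ, 0 < R ∧ K ⊆ closedBall (0 : Euc d) R := by
  obtain ⟨R, hR⟩ := hK.compact.isBounded.subset_closedBall (0 : Euc d)
  exact ⟨max R 1, by positivity, hR.trans (closedBall_subset_closedBall (le_max_left _ _))⟩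

lemma polar_mem {y : Euc d} : y ∈ polarSet K ↔ ∀ x ∈ K, ⟪x, y⟫ ≤ 1 := Iff.rfl

lemma polar (hK : Bod K) : Bod (polarSet K) := by
  obtain ⟨r, hr, hrK⟩ := hK.exists_ball
  obtain ⟨R, hR, hKR⟩ := hK.exists_bound
  have hcl : IsClosed (polarSet K) := by
    have : polarSet K = ⋂ x ∈ K, {y | ⟪x, y⟫ ≤ 1} := by ext; simp [polarSet]
    rw [this]
    exact isClosed_biInter fun x _ => isClosed_le (by fun_prop) continuous_const
  refine ⟨Metric.isCompact_of_isClosed_isBounded hcl ?_, ?_, ?_⟩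
  · refine (isBounded_closedBall (x := (0 : Euc d)) (r := r⁻¹)).subset fun y hy => ?_
    rw [mem_closedBall_zero_iff]
    by_cases hy0 : y = 0
    · subst hy0; simp; positivity
    have hn : 0 < ‖y‖ := norm_pos_iff.2 hy0
    have := hy ((r / ‖y‖) • y) (hrK (by simp [norm_smul, hn.ne', abs_of_pos hr]))
    rw [real_inner_smul_left, real_inner_self_eq_norm_sq] at this
    have h2 : r * ‖y‖ ≤ 1 := by
      calc r * ‖y‖ = r / ‖y‖ * ‖y‖ ^ 2 := by field_simp
        _ ≤ 1 := this
    rw [← one_div, le_div_iff₀ hr]; linarith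
  · intro y hy z hz a b ha hb hab x hx
    rw [inner_add_right, real_inner_smul_right, real_inner_smul_right]
    nlinarith [hy x hx, hz x hx]
  · rw [mem_interior_iff_mem_nhds, Metric.nhds_basis_closedBall.mem_iff]
    refine ⟨R⁻¹, by positivity, fun y hy x hx => ?_⟩
    rw [mem_closedBall_zero_iff] at hy
    have hx' := hKR hx
    rw [mem_closedBall_zero_iff] at hx'
    calc ⟪x, y⟫ ≤ ‖x‖ * ‖y‖ := real_inner_le_norm _ _
      _ ≤ R * R⁻¹ := by gcongr
      _ = 1 := by field_simp

lemma polar_polar (hK : Bod K) : polarSet (polarSet K) = K := by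
  apply subset_antisymm
  · intro x hx
    by_contra hxK
    obtain ⟨f, u, hf1, hf2⟩ := geometric_hahn_banach_closed_point hK.convex hK.compact.isClosed hxK
    have hu : 0 < u := by simpa using hf1 0 hK.zmem
    set w : Euc d := (InnerProductSpace.toDual ℝ (Euc d)).symm f with hw
    have hfw : ∀ y, f y = ⟪w, y⟫ := fun y => by
      rw [hw, InnerProductSpace.toDual_symm_apply]
    have h1 : u⁻¹ • w ∈ polarSet K := by
      intro y hy
      rw [real_inner_smul_right, real_inner_comm, ← hfw, inv_mul_le_iff₀ hu, mul_one]
      exact (hf1 y hy).le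
    have h2 := hx _ h1
    rw [real_inner_smul_left, ← hfw, inv_mul_le_iff₀ hu] at h2
    linarith
  · intro x hx y hy
    rw [real_inner_comm]; exact hy x hx

lemma inner_le (hK : Bod K) (x y : Euc d) : ⟪x, y⟫ ≤ gauge K x * gauge (polarSet K) y := by
  have hs := hK.sub
  have ht := hK.polar.sub
  by_cases hx : x = 0
  · subst hx; simp [hs.zero]
  by_cases hy : y = 0
  · subst hy; simp [ht.zero]
  have h1 := hs.pos x hx
  have h2 := ht.pos y hy
  have hx1 : (gauge K x)⁻¹ • x ∈ K := by
    rw [← hK.gauge_le_one, hs.smul _ (by positivity), inv_mul_cancel₀ h1.ne']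
  have hy1 : (gauge (polarSet K) y)⁻¹ • y ∈ polarSet K := by
    rw [← hK.polar.gauge_le_one, ht.smul _ (by positivity), inv_mul_cancel₀ h2.ne']
  have := hy1 _ hx1
  rw [real_inner_smul_left, real_inner_smul_right, inv_mul_le_iff₀ h1, inv_mul_le_iff₀ h2] at this
  linarith

lemma gauge_polar_le (hK : Bod K) {y : Euc d} {c : ℝ} (hc : 0 ≤ c) (h : ∀ x ∈ K, ⟪x, y⟫ ≤ c) :
    gauge (polarSet K) y ≤ c := by
  refine le_of_forall_pos_le_add fun e he => ?_
  have hce : 0 < c + e := by positivity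
  have : (c + e)⁻¹ • y ∈ polarSet K := by
    intro x hx
    rw [real_inner_smul_right, inv_mul_le_iff₀ hce]; linarith [h x hx]
  rw [← hK.polar.gauge_le_one, hK.polar.sub.smul _ (by positivity), inv_mul_le_iff₀ hce] at this
  linarith

lemma exists_gauge_polar (hK : Bod K) (y : Euc d) : ∃ x ∈ K, ⟪x, y⟫ = gauge (polarSet K) y := by
  obtain ⟨x, hx, hmax⟩ := hK.compact.exists_isMaxOn ⟨0, hK.zmem⟩
    (f := fun x => ⟪x, y⟫) (by fun_prop)
  refine ⟨x, hx, le_antisymm ?_ ?_⟩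
  · refine (hK.inner_le x y).trans ?_
    exact mul_le_of_le_one_left (hK.polar.sub.nonneg y) (hK.gauge_le_one.2 hx)
  · refine hK.gauge_polar_le ?_ hmax
    simpa using hmax hK.zmem

lemma inner_le_of_mem (hK : Bod K) {x : Euc d} (hx : x ∈ K) (y : Euc d) :
    ⟪x, y⟫ ≤ gauge (polarSet K) y :=
  (hK.inner_le x y).trans
    (mul_le_of_le_one_left (hK.polar.sub.nonneg y) (hK.gauge_le_one.2 hx))

end Bod

lemma polar_anti {d : ℕ} {S T : Set (Euc d)} (h : S ⊆ T) : polarSet T ⊆ polarSet S :=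
  fun _ hy x hx => hy x (h hx)

lemma polar_smul {d : ℕ} {S : Set (Euc d)} {c : ℝ} (hc : 0 < c) :
    polarSet (c • S) = c⁻¹ • polarSet S := by
  ext y
  rw [mem_inv_smul_set_iff₀ hc.ne']
  constructor
  · intro h x hx
    have := h (c • x) (smul_mem_smul_set hx)
    rwa [real_inner_smul_left, ← real_inner_smul_right] at this
  · rintro h _ ⟨x, hx, rfl⟩
    have := h x hx
    rwa [real_inner_smul_right, ← real_inner_smul_left] at this

lemma vol_smul {d : ℕ} {c : ℝ} (hc : 0 ≤ c) (S : Set (Euc d)) :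
    volume (c • S) = ENNReal.ofReal c ^ d * volume S := by
  rw [Measure.addHaar_smul, finrank_euclideanSpace_fin, abs_of_nonneg (by positivity),
    ENNReal.ofReal_pow hc]

lemma Bod.smul {d : ℕ} {K : Set (Euc d)} (hK : Bod K) {c : ℝ} (hc : 0 < c) : Bod (c • K) := by
  refine ⟨hK.compact.smul c, hK.convex.smul c, ?_⟩
  rw [interior_smul₀ hc.ne']
  exact ⟨0, hK.zero, by simp⟩

lemma Bod.vol_pos {d : ℕ} {K : Set (Euc d)} (hK : Bod K) : 0 < volume K :=
  (isOpen_interior.measure_pos _ ⟨0, hK.zero⟩).trans_le (measure_mono interior_subset)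

lemma Bod.vol_lt_top {d : ℕ} {K : Set (Euc d)} (hK : Bod K) : volume K < ⊤ :=
  hK.compact.measure_lt_top

end

noncomputable section

section TV
variable {d : ℕ} {f : Euc d → ℝ}

lemma tv_tendsto {C : NNReal} (hf : LipschitzWith C f) (v : Euc d) {B : Set (Euc d)}
    (hB : volume B ≠ ⊤) :
    Filter.Tendsto (fun n : ℕ => ∫⁻ a in B, ENNReal.ofReal
      (((n : ℝ) + 1) * |f (a + (1 / ((n : ℝ) + 1)) • v) - f a|)) Filter.atTop
      (nhds (∫⁻ a in B, ENNReal.ofReal |fderiv ℝ f a v|)) := by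
  have hc := hf.continuous
  refine tendsto_lintegral_of_dominated_convergence (fun _ => ENNReal.ofReal (C * ‖v‖)) ?_ ?_ ?_ ?_
  · intro n
    have : Continuous fun a => ENNReal.ofReal
      (((n : ℝ) + 1) * |f (a + (1 / ((n : ℝ) + 1)) • v) - f a|) :=
      ENNReal.continuous_ofReal.comp (by fun_prop)
    exact this.measurable
  · intro n
    refine Filter.Eventually.of_forall fun a => ENNReal.ofReal_le_ofReal ?_
    have h := hf.dist_le_mul (a + (1 / ((n : ℝ) + 1)) • v) a
    have hn : (0 : ℝ) < n + 1 := by positivity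
    rw [Real.dist_eq, dist_eq_norm, add_sub_cancel_left, norm_smul, Real.norm_of_nonneg (by positivity)] at h
    calc _ ≤ ((n : ℝ) + 1) * (C * (1 / ((n : ℝ) + 1) * ‖v‖)) := by gcongr
      _ = _ := by field_simp
  · simp only [lintegral_const, Measure.restrict_apply MeasurableSet.univ, univ_inter]
    exact ENNReal.mul_ne_top ENNReal.ofReal_ne_top hB
  · have h := ae_restrict_of_ae (s := B) (hf.ae_differentiableAt (μ := volume))
    filter_upwards [h] with a ha
    have h1 : HasDerivAt (fun t : ℝ => f (a + t • v)) (fderiv ℝ f a v) 0 :=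
      ha.hasFDerivAt.hasLineDerivAt v
    have h2 := h1.tendsto_slope_zero
    have h3 : Filter.Tendsto (fun n : ℕ => (1 / ((n : ℝ) + 1))) Filter.atTop (nhdsWithin 0 {0}ᶜ) := by
      rw [tendsto_nhdsWithin_iff]
      refine ⟨tendsto_one_div_add_atTop_nhds_zero_nat, Filter.Eventually.of_forall fun n => ?_⟩
      have hn : (0 : ℝ) < n + 1 := by positivity
      simp [hn.ne']
    have h4 := (h2.comp h3).abs
    refine (ENNReal.continuous_ofReal.tendsto _).comp (h4.congr fun n => ?_)
    have hn : (0 : ℝ) < n + 1 := by positivity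
    simp only [Function.comp, zero_add, zero_smul, add_zero, smul_eq_mul, abs_mul, one_div, inv_inv,
      abs_of_pos hn]

lemma lint_shift_le {F : Euc d → ℝ≥0∞} (S B : Set (Euc d)) (hS : MeasurableSet S)
    (hB : MeasurableSet B) (w : Euc d) (h : ∀ a ∈ S, a + w ∈ B) :
    ∫⁻ a in S, F (a + w) ≤ ∫⁻ a in B, F a := by
  rw [← lintegral_indicator hS, ← lintegral_indicator hB,
    ← lintegral_add_right_eq_self (B.indicator F) w]
  refine lintegral_mono fun a => ?_
  by_cases ha : a ∈ S
  · rw [indicator_of_mem ha, indicator_of_mem (h a ha)]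
  · rw [indicator_of_notMem ha]; exact zero_le

lemma tv_lower {C : NNReal} (hf : LipschitzWith C f) (v : Euc d) {S B : Set (Euc d)}
    (hS : MeasurableSet S) (hBm : MeasurableSet B)
    (hB : volume B ≠ ⊤) (h : ∀ a ∈ S, ∀ t ∈ Icc (0 : ℝ) 1, a + t • v ∈ B) :
    ∫⁻ a in S, ENNReal.ofReal |f (a + v) - f a| ≤ ∫⁻ a in B, ENNReal.ofReal |fderiv ℝ f a v| := by
  have hc := hf.continuous
  refine ge_of_tendsto' (tv_tendsto hf v hB) fun n => ?_
  set N : ℝ := (n : ℝ) + 1 with hN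
  have hN0 : 0 < N := by positivity
  set F : Euc d → ℝ≥0∞ := fun a => ENNReal.ofReal |f (a + (1 / N) • v) - f a| with hF
  have hFc : Continuous F := ENNReal.continuous_ofReal.comp (by fun_prop)
  have key : ∀ a, ENNReal.ofReal |f (a + v) - f a| ≤
      ∑ k ∈ Finset.range (n + 1), F (a + ((k : ℝ) / N) • v) := by
    intro a
    rw [hF, ← ENNReal.ofReal_sum_of_nonneg (fun _ _ => abs_nonneg _)]
    refine ENNReal.ofReal_le_ofReal ?_
    have h1 : ∀ k : ℕ, f (a + ((k : ℝ) / N) • v + (1 / N) • v) = f (a + (((k + 1 : ℕ) : ℝ) / N) • v) := by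
      intro k; congr 1; rw [add_assoc, ← add_smul]; push_cast; congr 2; ring
    have h2 := Finset.sum_range_sub (fun k : ℕ => f (a + ((k : ℝ) / N) • v)) (n + 1)
    have h3 : ((n + 1 : ℕ) : ℝ) / N = 1 := by push_cast; rw [← hN]; exact div_self hN0.ne'
    simp only [h3, one_smul, Nat.cast_zero, zero_div, zero_smul, add_zero] at h2
    rw [← h2]
    refine (Finset.abs_sum_le_sum_abs _ _).trans (le_of_eq (Finset.sum_congr rfl fun k _ => ?_))
    rw [h1]
  calc _ ≤ ∫⁻ a in S, ∑ k ∈ Finset.range (n + 1), F (a + ((k : ℝ) / N) • v) := lintegral_mono key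
    _ = ∑ k ∈ Finset.range (n + 1), ∫⁻ a in S, F (a + ((k : ℝ) / N) • v) := by
        rw [lintegral_finsetSum]
        intro k _; exact (hFc.comp (by fun_prop)).measurable
    _ ≤ ∑ k ∈ Finset.range (n + 1), ∫⁻ a in B, F a := by
        refine Finset.sum_le_sum fun k hk => lint_shift_le S B hS hBm _ fun a ha => h a ha _ ⟨by positivity, ?_⟩
        rw [div_le_one hN0, hN]
        have := Finset.mem_range.1 hk
        exact_mod_cast this.le
    _ = _ := by
        rw [Finset.sum_const, Finset.card_range, nsmul_eq_mul, ← lintegral_const_mul _ hFc.measurable]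
        refine lintegral_congr fun a => ?_
        rw [hF, ENNReal.ofReal_mul hN0.le]
        congr 1
        rw [hN]
        have : ((n : ℝ) + 1) = ((n + 1 : ℕ) : ℝ) := by push_cast; rfl
        rw [this, ENNReal.ofReal_natCast]

lemma tv_upper {C : NNReal} (hf : LipschitzWith C f) (v : Euc d) {B B' : Set (Euc d)}
    (hBm : MeasurableSet B) (hBm' : MeasurableSet B')
    (hB : volume B ≠ ⊤) (h : ∀ a ∈ B, ∀ t ∈ Icc (0 : ℝ) 1, a - t • v ∈ B')
    (hvar : ∀ a w (n : ℕ), ∑ k ∈ Finset.range n, |f (a + ((k + 1 : ℕ) : ℝ) • w) - f (a + (k : ℝ) • w)| ≤ 2) :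
    ∫⁻ a in B, ENNReal.ofReal |fderiv ℝ f a v| ≤ 2 * volume B' := by
  have hc := hf.continuous
  refine le_of_tendsto' (tv_tendsto hf v hB) fun n => ?_
  set N : ℝ := (n : ℝ) + 1 with hN
  have hN0 : 0 < N := by positivity
  set F : Euc d → ℝ≥0∞ := fun a => ENNReal.ofReal |f (a + (1 / N) • v) - f a| with hF
  have hFc : Continuous F := ENNReal.continuous_ofReal.comp (by fun_prop)
  have key : ∀ a, ∑ k ∈ Finset.range (n + 1), F (a + ((k : ℝ) / N) • v) ≤ 2 := by
    intro a
    rw [hF, ← ENNReal.ofReal_sum_of_nonneg (fun _ _ => abs_nonneg _)]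
    have := hvar a ((1 / N) • v) (n + 1)
    have h2 : ENNReal.ofReal 2 = 2 := by simp
    refine le_trans ?_ h2.le
    refine ENNReal.ofReal_le_ofReal (le_trans (le_of_eq (Finset.sum_congr rfl fun k _ => ?_)) this)
    rw [smul_smul, smul_smul, add_assoc, ← add_smul]
    push_cast
    congr 4
    · congr 3; ring
    · congr 1; ring
  calc _ = ∑ k ∈ Finset.range (n + 1), ∫⁻ a in B, F a := by
        rw [Finset.sum_const, Finset.card_range, nsmul_eq_mul, ← lintegral_const_mul _ hFc.measurable]
        refine lintegral_congr fun a => ?_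
        rw [hF, ENNReal.ofReal_mul hN0.le]
        congr 1
        rw [hN]
        have : ((n : ℝ) + 1) = ((n + 1 : ℕ) : ℝ) := by push_cast; rfl
        rw [this, ENNReal.ofReal_natCast]
    _ ≤ ∑ k ∈ Finset.range (n + 1), ∫⁻ a in B', F (a + ((k : ℝ) / N) • v) := by
        refine Finset.sum_le_sum fun k hk => ?_
        have := lint_shift_le (F := fun a => F (a + ((k : ℝ) / N) • v)) B B' hBm hBm' (-(((k : ℝ) / N) • v)) ?_
        · simpa using this
        intro a ha
        rw [← sub_eq_add_neg]
        refine h a ha _ ⟨by positivity, ?_⟩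
        rw [div_le_one hN0, hN]
        have := Finset.mem_range.1 hk
        exact_mod_cast this.le
    _ = ∫⁻ a in B', ∑ k ∈ Finset.range (n + 1), F (a + ((k : ℝ) / N) • v) := by
        rw [lintegral_finsetSum]
        intro k _; exact (hFc.comp (by fun_prop)).measurable
    _ ≤ ∫⁻ a in B', 2 := lintegral_mono key
    _ = 2 * volume B' := by simp

lemma unimodal_var (u : ℕ → ℝ) (h0 : ∀ k, 0 ≤ u k) (h1 : ∀ k, u k ≤ 1)
    (hq : ∀ i j k, i ≤ j → j ≤ k → min (u i) (u k) ≤ u j) (n : ℕ) :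
    ∑ k ∈ Finset.range n, |u (k + 1) - u k| ≤ 2 := by
  have key : ∃ m ≤ n, (∀ k ≤ n, u k ≤ u m) ∧
      ∑ k ∈ Finset.range n, |u (k + 1) - u k| ≤ 2 * u m - u 0 - u n := by
    induction n with
    | zero => exact ⟨0, le_rfl, fun k hk => by rw [Nat.le_zero.1 hk], by simp; linarith⟩
    | succ n ih =>
      obtain ⟨m, hm, hmax, hs⟩ := ih
      rw [Finset.sum_range_succ]
      by_cases hle : u (n + 1) ≤ u n
      · refine ⟨m, hm.trans (Nat.le_succ n), fun k hk => ?_, ?_⟩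
        · rcases Nat.le_succ_iff.1 hk with hk | hk
          · exact hmax k hk
          · rw [hk]; exact hle.trans (hmax n le_rfl)
        · rw [abs_of_nonpos (by linarith)]; linarith
      · push Not at hle
        have h2 : u m ≤ u n := by
          have := hq m n (n + 1) hm (Nat.le_succ n)
          rcases min_le_iff.1 this with h | h
          · exact h
          · linarith
        refine ⟨n + 1, le_rfl, fun k hk => ?_, ?_⟩
        · rcases Nat.le_succ_iff.1 hk with hk | hk
          · exact ((hmax k hk).trans h2).trans hle.le
          · rw [hk]
        · rw [abs_of_pos (by linarith)]; linarith
  obtain ⟨m, _, _, hs⟩ := key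
  linarith [h0 0, h0 n, h1 m]

end TV

section shell
variable {d : ℕ} {g : Euc d → ℝ}

/-- The clamped profile. -/
def prof (g : Euc d → ℝ) (e : ℝ) (x : Euc d) : ℝ := max 0 (min 1 ((1 - g x) / e))

lemma prof_lip (hg : Subl g) {e : ℝ} (he : 0 < e) : ∃ C, LipschitzWith C (prof g e) := by
  obtain ⟨C, hC⟩ := hg.lipschitz
  refine ⟨⟨e⁻¹, by positivity⟩ * C, LipschitzWith.const_max (LipschitzWith.const_min ?_ 1) 0⟩
  refine LipschitzWith.of_dist_le_mul fun x y => ?_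
  have h1 := hC.dist_le_mul x y
  rw [Real.dist_eq] at *
  have : |(1 - g x) / e - (1 - g y) / e| = e⁻¹ * |g x - g y| := by
    rw [← abs_of_pos (inv_pos.2 he), ← abs_mul, ← abs_neg]
    congr 1; field_simp; ring
  rw [this]
  calc e⁻¹ * |g x - g y| ≤ e⁻¹ * (C * dist x y) := by gcongr
    _ = _ := by rw [← mul_assoc]; rfl

lemma prof_var (hg : Subl g) {e : ℝ} (he : 0 < e) (a w : Euc d) (n : ℕ) :
    ∑ k ∈ Finset.range n, |prof g e (a + ((k + 1 : ℕ) : ℝ) • w) - prof g e (a + (k : ℝ) • w)| ≤ 2 := by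
  have := unimodal_var (fun k : ℕ => prof g e (a + (k : ℝ) • w)) (fun k => le_max_left _ _)
    (fun k => max_le zero_le_one (min_le_left _ _)) ?_ n
  · exact this
  intro i j k hij hjk
  have hconv : g (a + (j : ℝ) • w) ≤ max (g (a + (i : ℝ) • w)) (g (a + (k : ℝ) • w)) := by
    refine hg.convexOn.le_max_of_mem_segment (mem_univ _) (mem_univ _) ?_
    by_cases hik : i = k
    · have : i = j := by omega
      subst this; exact left_mem_segment _ _ _
    have hik' : (0 : ℝ) < k - i := by
      have : i < k := by omega
      have : (i : ℝ) < k := by exact_mod_cast this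
      linarith
    have hij' : (i : ℝ) ≤ j := by exact_mod_cast hij
    have hjk' : (j : ℝ) ≤ k := by exact_mod_cast hjk
    refine ⟨(k - j) / (k - i), (j - i) / (k - i), div_nonneg (by linarith) hik'.le,
      div_nonneg (by linarith) hik'.le, by field_simp; ring, ?_⟩
    have e1 : ((k : ℝ) - j) / (k - i) = 1 - (j - i) / (k - i) := by field_simp; ring
    rw [e1]
    have e2 : (j : ℝ) = i + (j - i) / (k - i) * (k - i) := by field_simp; ring
    generalize ((j : ℝ) - i) / (k - i) = s at *
    rw [e2]
    module
  have hmono : ∀ x y, g x ≤ g y → prof g e y ≤ prof g e x := by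
    intro x y hxy
    unfold prof
    gcongr
  rcases le_max_iff.1 hconv with h | h
  · exact (min_le_left _ _).trans (hmono _ _ h)
  · exact (min_le_right _ _).trans (hmono _ _ h)

lemma prof_fderiv_in (hg : Subl g) {e : ℝ} (he : 0 < e) {x : Euc d} (h1 : 1 - e < g x) (h2 : g x < 1)
    (v : Euc d) : |fderiv ℝ (prof g e) x v| = |fderiv ℝ g x v| / e := by
  have : prof g e =ᶠ[nhds x] fun y => ((-e⁻¹) • g) y + e⁻¹ := by
    have o1 := (isOpen_lt continuous_const hg.continuous).mem_nhds (show 1 - e < g x from h1)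
    have o2 := (isOpen_lt hg.continuous continuous_const).mem_nhds (show g x < 1 from h2)
    filter_upwards [o1, o2] with y hy1 hy2
    have hy1 : 1 - e < g y := hy1
    have hy2 : g y < 1 := hy2
    have ha : (1 - g y) / e ≤ 1 := by rw [div_le_one he]; linarith
    have hb : 0 ≤ (1 - g y) / e := div_nonneg (by linarith) he.le
    rw [prof, min_eq_right ha, max_eq_right hb]
    simp only [Pi.smul_apply, smul_eq_mul]; field_simp; ring
  rw [this.fderiv_eq, fderiv_add_const, fderiv_const_smul_field]
  simp only [FunLike.coe_smul, Pi.smul_apply, smul_eq_mul, abs_mul, abs_neg, abs_inv,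
    abs_of_pos he]
  field_simp

lemma prof_fderiv_out1 (hg : Subl g) {e : ℝ} (he : 0 < e) {x : Euc d} (h1 : g x < 1 - e) :
    fderiv ℝ (prof g e) x = 0 := by
  have : prof g e =ᶠ[nhds x] fun _ => (1 : ℝ) := by
    have o2 := (isOpen_lt hg.continuous continuous_const).mem_nhds (show g x < 1 - e from h1)
    filter_upwards [o2] with y hy2
    have hy2 : g y < 1 - e := hy2
    have ha : 1 ≤ (1 - g y) / e := by rw [le_div_iff₀ he]; linarith
    rw [prof, min_eq_left ha]; simp
  rw [this.fderiv_eq]; simp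

lemma prof_fderiv_out2 (hg : Subl g) {e : ℝ} (he : 0 < e) {x : Euc d} (h1 : 1 < g x) :
    fderiv ℝ (prof g e) x = 0 := by
  have : prof g e =ᶠ[nhds x] fun _ => (0 : ℝ) := by
    have o2 := (isOpen_lt continuous_const hg.continuous).mem_nhds (show 1 < g x from h1)
    filter_upwards [o2] with y hy2
    have hy2 : 1 < g y := hy2
    have ha : (1 - g y) / e ≤ 0 := div_nonpos_of_nonpos_of_nonneg (by linarith) he.le
    rw [prof, max_eq_left ((min_le_right _ _).trans ha)]
  rw [this.fderiv_eq]; simp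

lemma level_null (hg : Subl g) {c : ℝ} (hc : 0 < c) : volume {x | g x = c} = 0 := by
  have h : {x | g x = c} = c • frontier (uset g) := by
    rw [hg.frontier_eq]; ext x
    rw [mem_smul_set_iff_inv_smul_mem₀ hc.ne']
    simp only [mem_ofPred_eq]
    rw [hg.smul _ (by positivity), inv_mul_eq_one₀ hc.ne']; exact eq_comm
  rw [h, Measure.addHaar_smul, hg.convex.addHaar_frontier volume, mul_zero]

end shell

end

noncomputable section

lemma conv_mass {d : ℕ} {L M : Set (Euc d)} (hL : MeasurableSet L) (hM : MeasurableSet M) :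
    ∫⁻ x : Euc d, volume {y | y ∈ L ∧ y - x ∈ M} = volume L * volume M := by
  have h1 : ∀ x : Euc d, volume {y | y ∈ L ∧ y - x ∈ M} =
      ∫⁻ y, L.indicator 1 y * M.indicator (1 : Euc d → ℝ≥0∞) (y - x) := by
    intro x
    have hm : MeasurableSet {y | y ∈ L ∧ y - x ∈ M} :=
      hL.inter ((measurable_id.sub_const x) hM)
    rw [← lintegral_indicator_one hm]
    refine lintegral_congr fun y => ?_
    by_cases h1 : y ∈ L <;> by_cases h2 : y - x ∈ M <;> simp [h1, h2, indicator]
  simp_rw [h1]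
  rw [lintegral_lintegral_swap]
  · have h2 : ∀ y : Euc d, ∫⁻ x, L.indicator 1 y * M.indicator (1 : Euc d → ℝ≥0∞) (y - x) =
        L.indicator 1 y * volume M := by
      intro y
      rw [lintegral_const_mul]
      · rw [lintegral_sub_left_eq_self (fun x => M.indicator (1 : Euc d → ℝ≥0∞) x) y,
          lintegral_indicator_one hM]
      · exact (measurable_one.indicator hM).comp (measurable_const.sub measurable_id)
    simp_rw [h2]
    rw [lintegral_mul_const _ (measurable_one.indicator hL), lintegral_indicator_one hL]
  · apply Measurable.aemeasurable
    exact ((measurable_one.indicator hL).comp measurable_snd).mul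
      ((measurable_one.indicator hM).comp (measurable_snd.sub measurable_fst))

lemma isCompact_sub' {d : ℕ} {L M : Set (Euc d)} (h : IsCompact L) (h' : IsCompact M) :
    IsCompact (L - M) := by rw [sub_eq_add_neg]; exact h.add h'.neg

lemma rogers_shephard {d : ℕ} {L : Set (Euc d)} (hc : IsCompact L) (hL : Convex ℝ L)
    (h0 : volume L ≠ 0) : volume (L - L) ≤ 4 ^ d * volume L := by
  have hm := hc.measurableSet
  have ht : volume L ≠ ⊤ := hc.measure_lt_top.ne
  have hD : IsCompact ((2⁻¹ : ℝ) • (L - L)) := (isCompact_sub' hc hc).smul _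
  have key : ∀ x ∈ (2⁻¹ : ℝ) • (L - L), ENNReal.ofReal 2⁻¹ ^ d * volume L ≤
      volume {y | y ∈ L ∧ y - x ∈ L} := by
    rintro _ ⟨_, ⟨a, ha, b, hb, rfl⟩, rfl⟩
    rw [← vol_smul (by norm_num), ← measure_preimage_add volume (-((2⁻¹ : ℝ) • a)) ((2⁻¹ : ℝ) • L)]
    refine measure_mono ?_
    rintro y ⟨l, hl, hy⟩
    have hy : (2⁻¹ : ℝ) • l = -((2⁻¹ : ℝ) • a) + y := hy
    have e1 : y = (2⁻¹ : ℝ) • l + (2⁻¹ : ℝ) • a := by rw [hy]; abel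
    refine ⟨?_, ?_⟩
    · rw [e1]; exact hL hl ha (by norm_num) (by norm_num) (by norm_num)
    · have : y - (2⁻¹ : ℝ) • (a - b) = (2⁻¹ : ℝ) • l + (2⁻¹ : ℝ) • b := by rw [e1]; module
      change y - (2⁻¹ : ℝ) • (a - b) ∈ L
      rw [this]
      exact hL hl hb (by norm_num) (by norm_num) (by norm_num)
  have h1 : (ENNReal.ofReal 2⁻¹ ^ d * volume L) * (ENNReal.ofReal 2⁻¹ ^ d * volume (L - L)) ≤
      volume L * volume L := by
    rw [← vol_smul (by norm_num) (L - L), ← conv_mass hm hm, ← setLIntegral_const]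
    refine (setLIntegral_mono' hD.measurableSet key).trans (setLIntegral_le_lintegral _ _)
  have e : ENNReal.ofReal 2⁻¹ = 2⁻¹ := by
    rw [ENNReal.ofReal_inv_of_pos (by norm_num)]; simp
  rw [e] at h1
  have h2 : volume L * (4⁻¹ ^ d * volume (L - L)) ≤ volume L * volume L := by
    refine le_trans (le_of_eq ?_) h1
    have : (4⁻¹ : ℝ≥0∞) = 2⁻¹ * 2⁻¹ := by
      rw [← ENNReal.mul_inv (by simp) (by simp)]; norm_num
    rw [this, mul_pow]; ring
  rw [ENNReal.mul_le_mul_iff_right h0 ht] at h2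
  calc volume (L - L) = 4 ^ d * (4⁻¹ ^ d * volume (L - L)) := by
        rw [← mul_assoc, ← mul_pow, ENNReal.mul_inv_cancel (by simp) (by simp), one_pow, one_mul]
    _ ≤ _ := by gcongr

/-- The Macbeath-type body of a sublinear function. -/
def macA {d : ℕ} (p : Euc d → ℝ) : Set (Euc d) := {v | ∀ θ, |⟪v, θ⟫| ≤ p θ}

namespace Subl
variable {d : ℕ} {p : Euc d → ℝ}

lemma macA_eq (hp : Subl p) : macA p = polarSet (uset p) ∩ -polarSet (uset p) := by
  have h : ∀ v : Euc d, v ∈ polarSet (uset p) ↔ ∀ θ, ⟪v, θ⟫ ≤ p θ := by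
    intro v
    constructor
    · intro hv θ
      have := hp.bod.inner_le θ v
      rw [hp.gauge_uset] at this
      rw [real_inner_comm]
      exact this.trans (mul_le_of_le_one_right (hp.nonneg _) (hp.bod.polar.gauge_le_one.2 hv))
    · intro hv θ hθ
      rw [real_inner_comm]; exact (hv θ).trans hθ
  ext v
  rw [mem_inter_iff, mem_neg, h, h]
  simp only [inner_neg_left]
  constructor
  · intro hv; exact ⟨fun θ => (abs_le.1 (hv θ)).2, fun θ => by linarith [(abs_le.1 (hv θ)).1]⟩
  · rintro ⟨h1, h2⟩ θ; exact abs_le.2 ⟨by linarith [h2 θ], h1 θ⟩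

lemma macA_bod (hp : Subl p) : Bod (macA p) := by
  rw [hp.macA_eq]
  have hb := hp.bod.polar
  refine ⟨hb.compact.inter hb.compact.neg, hb.convex.inter hb.convex.neg, ?_⟩
  rw [interior_inter]
  refine ⟨hb.zero, ?_⟩
  rw [mem_interior_iff_mem_nhds]
  have := neg_mem_nhds_zero (Euc d) hb.nhds
  simpa using this

lemma macA_symm {v : Euc d} (hv : v ∈ macA p) : -v ∈ macA p := fun θ => by
  rw [inner_neg_left, abs_neg]; exact hv θ

lemma polar_macA_subset (hp : Subl p) : polarSet (macA p) ⊆ uset p - uset p := by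
  have hb := hp.bod
  have hD : Bod (uset p - uset p) := by
    refine ⟨isCompact_sub' hb.compact hb.compact, hb.convex.sub hb.convex, ?_⟩
    rw [mem_interior_iff_mem_nhds]
    refine Filter.mem_of_superset hb.nhds fun x hx => ⟨x, hx, 0, hb.zmem, by simp⟩
  rw [← hD.polar_polar]
  refine polar_anti ?_
  intro v hv
  rw [hp.macA_eq]
  refine ⟨fun x hx => hv x ⟨x, hx, 0, hb.zmem, by simp⟩, fun x hx => ?_⟩
  rw [inner_neg_right, ← inner_neg_left]
  exact hv (-x) ⟨0, hb.zmem, x, hx, by simp⟩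

lemma uset_subset_polar_macA : uset p ⊆ polarSet (macA p) := by
  intro θ hθ v hv
  exact (le_abs_self _).trans ((hv θ).trans hθ)

lemma vol_polar_macA (hp : Subl p) : volume (polarSet (macA p)) ≤ 4 ^ d * volume (uset p) :=
  (measure_mono hp.polar_macA_subset).trans (rogers_shephard hp.isCompact hp.convex hp.vol_pos.ne')

/-- the support function of `macA p`. -/
def _root_.hA {d : ℕ} (p : Euc d → ℝ) (z : Euc d) : ℝ := gauge (polarSet (macA p)) z

/-- the weighted variation. -/
def _root_.NN {d : ℕ} (p : Euc d → ℝ) (z : Euc d) : ℝ≥0∞ :=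
  ∫⁻ a in uset p, ENNReal.ofReal |fderiv ℝ p a z|

lemma fderiv_zero (hp : Subl p) : fderiv ℝ p 0 = 0 :=
  IsLocalMin.fderiv_eq_zero (Filter.Eventually.of_forall fun x => by rw [hp.zero]; exact hp.nonneg x)

lemma fderiv_prof_zero (hp : Subl p) : fderiv ℝ (prof p 1) 0 = 0 := by
  refine IsLocalMax.fderiv_eq_zero (Filter.Eventually.of_forall fun x => ?_)
  have : prof p 1 0 = 1 := by simp [prof, hp.zero]
  rw [this]; exact max_le zero_le_one (min_le_left _ _)

lemma ae_prof (hp : Subl p) (v : Euc d) : ∀ᵐ a, ENNReal.ofReal |fderiv ℝ (prof p 1) a v| =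
    (uset p).indicator (fun a => ENNReal.ofReal |fderiv ℝ p a v|) a := by
  have h1 : ∀ᵐ a, p a ≠ 1 := measure_eq_zero_iff_ae_notMem.1 (level_null hp one_pos)
  filter_upwards [h1] with a ha
  rcases lt_or_gt_of_ne ha with h | h
  · rw [indicator_of_mem (show a ∈ uset p from h.le)]
    by_cases ha0 : a = 0
    · subst ha0; rw [hp.fderiv_zero, hp.fderiv_prof_zero]
    · rw [prof_fderiv_in hp one_pos (by simpa using hp.pos a ha0) h, div_one]
  · rw [indicator_of_notMem (fun h' : a ∈ uset p => absurd (show p a ≤ 1 from h') (not_le.2 h)),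
      prof_fderiv_out2 hp one_pos h]
    simp

lemma lint_prof (hp : Subl p) (v : Euc d) (B : Set (Euc d)) :
    ∫⁻ a in B, ENNReal.ofReal |fderiv ℝ (prof p 1) a v| ≤ NN p v := by
  refine (setLIntegral_le_lintegral _ _).trans (le_of_eq ?_)
  rw [lintegral_congr_ae (hp.ae_prof v), lintegral_indicator hp.measurableSet, NN]

lemma NN_le_aux (hp : Subl p) {l : Euc d} (hl : l ∈ uset p) : NN p l ≤ 2 * 4 ^ d * volume (uset p) := by
  obtain ⟨C, hC⟩ := prof_lip hp one_pos
  have hcont := (isCompact_sub' hp.isCompact hp.isCompact).measurableSet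
  have h := tv_upper hC l (B := uset p) (B' := uset p - uset p) hp.measurableSet hcont
    hp.vol_lt_top.ne ?_ (prof_var hp one_pos)
  · calc NN p l = ∫⁻ a in uset p, ENNReal.ofReal |fderiv ℝ (prof p 1) a l| := by
          rw [NN]
          refine (setLIntegral_congr_fun_ae hp.measurableSet ?_)
          filter_upwards [hp.ae_prof l] with a ha hm
          rw [ha, indicator_of_mem hm]
      _ ≤ _ := h
      _ ≤ 2 * (4 ^ d * volume (uset p)) := by
          gcongr; exact rogers_shephard hp.isCompact hp.convex hp.vol_pos.ne'
      _ = _ := by ring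
  · intro a ha t ht
    refine ⟨a, ha, t • l, ?_, rfl⟩
    change p (t • l) ≤ 1
    rw [hp.smul t ht.1]
    exact mul_le_one₀ ht.2 (hp.nonneg _) hl

lemma NN_meas (z : Euc d) : Measurable fun a => ENNReal.ofReal |fderiv ℝ p a z| :=
  ((measurable_fderiv_apply_const ℝ p z).abs).ennreal_ofReal

lemma NN_sub (z w : Euc d) : NN p (z - w) ≤ NN p z + NN p w := by
  rw [NN, NN, NN, ← lintegral_add_left (NN_meas z)]
  refine lintegral_mono fun a => ?_
  rw [← ENNReal.ofReal_add (abs_nonneg _) (abs_nonneg _), map_sub]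
  exact ENNReal.ofReal_le_ofReal (abs_sub _ _)

lemma NN_smul {c : ℝ} (hc : 0 ≤ c) (z : Euc d) : NN p (c • z) = ENNReal.ofReal c * NN p z := by
  rw [NN, NN, ← lintegral_const_mul _ (NN_meas z)]
  refine lintegral_congr fun a => ?_
  rw [← ENNReal.ofReal_mul hc, map_smul, smul_eq_mul, abs_mul, abs_of_nonneg hc]

lemma hA_subl (hp : Subl p) : Subl (hA p) := hp.macA_bod.polar.sub

lemma NN_upper (hp : Subl p) (z : Euc d) :
    NN p z ≤ ENNReal.ofReal (hA p z) * (4 * 4 ^ d * volume (uset p)) := by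
  by_cases hz : z = 0
  · subst hz; simp [NN]
  have h0 := hp.hA_subl.pos z hz
  have h1 : (hA p z)⁻¹ • z ∈ polarSet (macA p) := by
    rw [← hp.macA_bod.polar.gauge_le_one]
    change hA p _ ≤ 1
    rw [hp.hA_subl.smul _ (by positivity), inv_mul_cancel₀ h0.ne']
  obtain ⟨a, ha, b, hb, hab⟩ := hp.polar_macA_subset h1
  have h2 : z = hA p z • (a - b) := by
    have hab' : a - b = (hA p z)⁻¹ • z := hab
    rw [hab', smul_smul, mul_inv_cancel₀ h0.ne', one_smul]
  nth_rw 1 [h2]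
  rw [NN_smul h0.le]
  gcongr
  refine (NN_sub a b).trans ((add_le_add (hp.NN_le_aux ha) (hp.NN_le_aux hb)).trans (le_of_eq ?_))
  ring

lemma NN_lower (hp : Subl p) (z : Euc d) :
    ENNReal.ofReal (hA p z) * volume (uset p) ≤ 6 * 2 ^ d * NN p z := by
  by_cases hz : z = 0
  · subst hz; simp [hp.hA_subl.zero]
  have h0 := hp.hA_subl.pos z hz
  set t := 3 / hA p z with ht
  have ht0 : 0 < t := by positivity
  obtain ⟨C, hC⟩ := prof_lip hp one_pos
  obtain ⟨R, hR, hRR⟩ := hp.bod.exists_bound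
  have hdis : ∀ a ∈ uset p, 1 < p (a + t • z) := by
    intro a ha
    by_contra h
    have hb : a + t • z ∈ uset p := not_lt.1 h
    have h1 : hA p (a + t • z) ≤ 1 := hp.macA_bod.polar.gauge_le_one.2 (uset_subset_polar_macA hb)
    have h2 : hA p (-a) ≤ 1 := by
      refine hp.macA_bod.polar.gauge_le_one.2 ?_
      intro v hv
      have := uset_subset_polar_macA ha (-v) (macA_symm hv)
      rwa [inner_neg_left, ← inner_neg_right] at this
    have h3 := hp.hA_subl.add (a + t • z) (-a)
    rw [show a + t • z + -a = t • z by abel, hp.hA_subl.smul t ht0.le, ht,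
      div_mul_cancel₀ _ h0.ne'] at h3
    linarith
  have h1 := tv_lower hC (t • z) (S := uset p) (B := closedBall 0 (R + ‖t • z‖)) hp.measurableSet
    measurableSet_closedBall measure_closedBall_lt_top.ne ?_
  · have h2 : ENNReal.ofReal 2⁻¹ * (ENNReal.ofReal 2⁻¹ ^ d * volume (uset p)) ≤
        ENNReal.ofReal t * NN p z := by
      rw [← NN_smul ht0.le]
      refine le_trans ?_ (h1.trans (hp.lint_prof _ _))
      have hsub : (2⁻¹ : ℝ) • uset p ⊆ uset p := by
        rintro _ ⟨x, hx, rfl⟩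
        change p ((2⁻¹ : ℝ) • x) ≤ 1
        rw [hp.smul _ (by norm_num)]
        have hx : p x ≤ 1 := hx
        linarith [hp.nonneg x]
      rw [← vol_smul (by norm_num), ← setLIntegral_const]
      refine le_trans (setLIntegral_mono' (hp.isCompact.smul _).measurableSet ?_)
        (lintegral_mono_set hsub)
      rintro _ ⟨x, hx, rfl⟩
      refine ENNReal.ofReal_le_ofReal ?_
      have hx1 : p x ≤ 1 := hx
      have e1 : prof p 1 ((2⁻¹ : ℝ) • x + t • z) = 0 := by
        have := hdis _ (hsub ⟨x, hx, rfl⟩)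
        rw [prof, div_one]
        exact max_eq_left ((min_le_right _ _).trans (by simp only at this; linarith))
      have e2 : (2⁻¹ : ℝ) ≤ prof p 1 ((2⁻¹ : ℝ) • x) := by
        rw [prof, hp.smul _ (by norm_num)]
        refine le_max_of_le_right (le_min (by norm_num) ?_)
        rw [div_one]; linarith
      simp only
      rw [e1, zero_sub, abs_neg]
      exact e2.trans (le_abs_self _)
    have e : ENNReal.ofReal 2⁻¹ = 2⁻¹ := by
      rw [ENNReal.ofReal_inv_of_pos (by norm_num)]; simp
    have e3 : ENNReal.ofReal (hA p z) * ENNReal.ofReal t = 3 := by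
      rw [← ENNReal.ofReal_mul h0.le, ht, mul_div_cancel₀ _ h0.ne']; simp
    rw [e] at h2
    have e4 : (2 : ℝ≥0∞) * 2⁻¹ = 1 := ENNReal.mul_inv_cancel (by simp) (by simp)
    calc ENNReal.ofReal (hA p z) * volume (uset p)
        = ENNReal.ofReal (hA p z) * ((2 * 2⁻¹) * (2 * 2⁻¹) ^ d * volume (uset p)) := by
          rw [e4]; simp
      _ = ENNReal.ofReal (hA p z) * 2 * 2 ^ d * (2⁻¹ * (2⁻¹ ^ d * volume (uset p))) := by
          rw [mul_pow]; ring
      _ ≤ ENNReal.ofReal (hA p z) * 2 * 2 ^ d * (ENNReal.ofReal t * NN p z) := by gcongr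
      _ = (ENNReal.ofReal (hA p z) * ENNReal.ofReal t) * 2 * 2 ^ d * NN p z := by ring
      _ = _ := by rw [e3]; ring
  · intro a ha s hs
    rw [mem_closedBall_zero_iff]
    refine (norm_add_le _ _).trans (add_le_add (by simpa using hRR ha) ?_)
    rw [norm_smul s, Real.norm_of_nonneg hs.1]
    exact mul_le_of_le_one_left (norm_nonneg _) hs.2

end Subl
end

noncomputable section

lemma lint_smul {d : ℕ} (F : Euc d → ℝ≥0∞) {c : ℝ} (hc : 0 < c) :
    ∫⁻ x, F (c • x) = (ENNReal.ofReal (c ^ d))⁻¹ * ∫⁻ x, F x := by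
  have h := (Homeomorph.smulOfNeZero c hc.ne' : Euc d ≃ₜ Euc d).measurableEmbedding.lintegral_map
    (μ := volume) F
  have e : ⇑(Homeomorph.smulOfNeZero c hc.ne' : Euc d ≃ₜ Euc d) = fun x => c • x := rfl
  rw [e] at h
  have h2 := Measure.map_addHaar_smul (volume : Measure (Euc d)) hc.ne'
  change Measure.map (fun x : Euc d => c • x) volume = _ at h2
  rw [h2, lintegral_smul_measure] at h
  rw [← h, abs_of_pos (by positivity), ENNReal.ofReal_inv_of_pos (by positivity)]
  simp

lemma ae_ne_zero {d : ℕ} (hd : 0 < d) : ∀ᵐ x : Euc d, x ≠ 0 := by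
  have : NeZero d := ⟨hd.ne'⟩
  have : volume ({0} : Set (Euc d)) = 0 := by
    have : Nontrivial (Euc d) := by
      refine ⟨0, EuclideanSpace.single ⟨0, hd⟩ 1, fun h => ?_⟩
      have := congrArg (fun v : Euc d => v ⟨0, hd⟩) h
      simp at this
    exact measure_singleton _
  exact measure_eq_zero_iff_ae_notMem.1 this

/-- cutoff weight -/
def psi (d : ℕ) (u : ℝ) : ℝ≥0∞ := if u ≤ 1 then ENNReal.ofReal (u ^ d) else 0

lemma psi_meas (d : ℕ) : Measurable (psi d) :=
  Measurable.ite measurableSet_Iic (by fun_prop) measurable_const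

lemma psi_int_pos (d : ℕ) : ∫⁻ u : ℝ, psi d (Real.exp u) ≠ 0 := by
  have h : ENNReal.ofReal (Real.exp (-1) ^ d) ≤ ∫⁻ u : ℝ, psi d (Real.exp u) := by
    calc ENNReal.ofReal (Real.exp (-1) ^ d) = ∫⁻ u in Icc (-1 : ℝ) 0, ENNReal.ofReal (Real.exp (-1) ^ d) := by
          rw [setLIntegral_const]; simp
      _ ≤ ∫⁻ u in Icc (-1 : ℝ) 0, psi d (Real.exp u) := by
          refine setLIntegral_mono' measurableSet_Icc fun u hu => ?_
          rw [psi, if_pos (by simpa using hu.2)]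
          gcongr; exact hu.1
      _ ≤ _ := setLIntegral_le_lintegral _ _
  intro h0
  rw [h0] at h
  have : 0 < ENNReal.ofReal (Real.exp (-1) ^ d) := ENNReal.ofReal_pos.2 (by positivity)
  exact absurd h (not_le.2 this)

lemma psi_int_fin {d : ℕ} (hd : 0 < d) : ∫⁻ u : ℝ, psi d (Real.exp u) ≠ ⊤ := by
  have h : ∫⁻ u : ℝ, psi d (Real.exp u) ≤ ∫⁻ u in Iic (0 : ℝ), ENNReal.ofReal (Real.exp u) := by
    rw [← lintegral_indicator measurableSet_Iic]
    refine lintegral_mono fun u => ?_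
    by_cases hu : u ≤ 0
    · rw [indicator_of_mem (show u ∈ Iic (0:ℝ) from hu), psi, if_pos (by simpa using hu)]
      refine ENNReal.ofReal_le_ofReal ?_
      exact pow_le_of_le_one (by positivity) (by simpa using hu) hd.ne'
    · simp [psi, hu]
  refine (h.trans_lt ?_).ne
  have := integrableOn_exp_Iic 0
  have h2 := this.2
  rw [hasFiniteIntegral_iff_ofReal (Filter.Eventually.of_forall fun u => (Real.exp_pos u).le)] at h2
  exact h2

lemma ray_aux {d : ℕ} (hd : 0 < d) {q1 q2 : Euc d → ℝ} (h1 : Subl q1) (h2 : Subl q2)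
    {W : Euc d → ℝ≥0∞} (hW : Measurable W)
    (hh : ∀ c : ℝ, 0 < c → ∀ x, W (c • x) = (ENNReal.ofReal (c ^ d))⁻¹ * W x) :
    ∫⁻ x, psi d (q1 x) * W x = ∫⁻ x, psi d (q2 x) * W x := by
  set c0 := ∫⁻ u : ℝ, psi d (Real.exp u) with hc0
  have hc : ∀ q : ℝ, 0 < q → ∫⁻ u : ℝ, psi d (Real.exp u * q) = c0 := by
    intro q hq
    rw [hc0, ← lintegral_add_right_eq_self (fun u => psi d (Real.exp u)) (Real.log q)]
    refine lintegral_congr fun u => ?_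
    rw [Real.exp_add, Real.exp_log hq]
  have hc' : ∀ q : ℝ, 0 < q → ∫⁻ u : ℝ, psi d (Real.exp (-u) * q) = c0 := by
    intro q hq
    rw [← hc q hq, ← lintegral_neg_eq_self (fun u => psi d (Real.exp u * q))]
  have hm1 := h1.measurable
  have hm2 := h2.measurable
  have hps := psi_meas d
  have e1 : c0 * ∫⁻ x, psi d (q1 x) * W x =
      ∫⁻ x, ∫⁻ u : ℝ, psi d (Real.exp u * q2 x) * (psi d (q1 x) * W x) := by
    rw [← lintegral_const_mul _ (by fun_prop)]
    refine lintegral_congr_ae ?_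
    filter_upwards [ae_ne_zero hd] with x hx
    rw [lintegral_mul_const _ (by fun_prop), hc _ (h2.pos x hx)]
  have e2 : c0 * ∫⁻ x, psi d (q2 x) * W x =
      ∫⁻ x, ∫⁻ u : ℝ, psi d (Real.exp (-u) * q1 x) * (psi d (q2 x) * W x) := by
    rw [← lintegral_const_mul _ (by fun_prop)]
    refine lintegral_congr_ae ?_
    filter_upwards [ae_ne_zero hd] with x hx
    rw [lintegral_mul_const _ (by fun_prop), hc' _ (h1.pos x hx)]
  have e3 : c0 * ∫⁻ x, psi d (q1 x) * W x = c0 * ∫⁻ x, psi d (q2 x) * W x := by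
    rw [e1, e2, lintegral_lintegral_swap (by fun_prop)]
    conv_rhs => rw [lintegral_lintegral_swap (by fun_prop)]
    refine lintegral_congr fun u => ?_
    have hu := Real.exp_pos u
    have := lint_smul (fun y => psi d (q2 y) * (psi d (q1 (Real.exp (-u) • y)) * W (Real.exp (-u) • y))) hu
    simp only [smul_smul, ← Real.exp_add, neg_add_cancel, Real.exp_zero, one_smul] at this
    calc _ = ∫⁻ x, psi d (q2 (Real.exp u • x)) * (psi d (q1 x) * W x) := by
          refine lintegral_congr fun x => ?_
          rw [h2.smul _ hu.le]
      _ = _ := this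
      _ = ∫⁻ x, (ENNReal.ofReal (Real.exp u ^ d))⁻¹ * (psi d (q2 x) * (psi d (q1 (Real.exp (-u) • x)) * W (Real.exp (-u) • x))) := by
          rw [lintegral_const_mul' _ _ (by simp [pow_pos hu])]
      _ = _ := by
          refine lintegral_congr fun x => ?_
          rw [hh _ (Real.exp_pos _), h1.smul _ (Real.exp_pos _).le]
          have : (ENNReal.ofReal (Real.exp u ^ d))⁻¹ * (ENNReal.ofReal (Real.exp (-u) ^ d))⁻¹ = 1 := by
            rw [← ENNReal.mul_inv (by simp) (by simp), ← ENNReal.ofReal_mul (by positivity), ← mul_pow, ← Real.exp_add]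
            simp
          calc _ = ((ENNReal.ofReal (Real.exp u ^ d))⁻¹ * (ENNReal.ofReal (Real.exp (-u) ^ d))⁻¹) *
              (psi d (Real.exp (-u) * q1 x) * (psi d (q2 x) * W x)) := by ring
            _ = _ := by rw [this, one_mul]
  exact (ENNReal.mul_right_inj (psi_int_pos d) (psi_int_fin hd)).1 e3

lemma ray {d : ℕ} (hd : 0 < d) {q1 q2 : Euc d → ℝ} (h1 : Subl q1) (h2 : Subl q2)
    {R : Euc d → ℝ≥0∞} (hR : Measurable R) (hh : ∀ c : ℝ, 0 < c → ∀ x, R (c • x) = R x) :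
    ∫⁻ x in uset q1, R x = ∫⁻ x in uset q2, R x * ENNReal.ofReal ((q2 x / q1 x) ^ d) := by
  have hm1 := h1.measurable
  have hm2 := h2.measurable
  have := ray_aux hd h1 h2 (W := fun x => R x * (ENNReal.ofReal (q1 x ^ d))⁻¹) (by fun_prop) ?_
  · rw [← lintegral_indicator h1.measurableSet, ← lintegral_indicator h2.measurableSet]
    convert this using 1
    · refine lintegral_congr_ae ?_
      filter_upwards [ae_ne_zero hd] with x hx
      have hp := h1.pos x hx
      by_cases h : q1 x ≤ 1
      · rw [indicator_of_mem (show x ∈ uset q1 from h), psi, if_pos h]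
        rw [mul_comm, mul_assoc, ENNReal.inv_mul_cancel (by simp [hp]) (by simp), mul_one]
      · rw [indicator_of_notMem (show x ∉ uset q1 from h), psi, if_neg h, zero_mul]
    · refine lintegral_congr_ae ?_
      filter_upwards [ae_ne_zero hd] with x hx
      have hp := h1.pos x hx
      by_cases h : q2 x ≤ 1
      · rw [indicator_of_mem (show x ∈ uset q2 from h), psi, if_pos h, div_pow,
          ENNReal.ofReal_div_of_pos (by positivity), div_eq_mul_inv]
        ring
      · rw [indicator_of_notMem (show x ∉ uset q2 from h), psi, if_neg h, zero_mul]
  · intro c hc x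
    rw [hh c hc, h1.smul c hc.le, mul_pow, ENNReal.ofReal_mul (by positivity),
      ENNReal.mul_inv (by simp [pow_pos hc]) (by simp)]
    ring

lemma lint_level {d : ℕ} {g : Euc d → ℝ} (hg : Subl g) {R : Euc d → ℝ≥0∞}
    (hh : ∀ c : ℝ, 0 < c → ∀ x, R (c • x) = R x) {c : ℝ} (hc : 0 < c) :
    ∫⁻ x in {x | g x ≤ c}, R x = ENNReal.ofReal (c ^ d) * ∫⁻ x in uset g, R x := by
  have hmc : MeasurableSet {x | g x ≤ c} := measurableSet_le hg.measurable measurable_const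
  have h := lint_smul (fun x => {x | g x ≤ c}.indicator R x) hc
  rw [lintegral_indicator hmc] at h
  have h2 : ∫⁻ x, {x | g x ≤ c}.indicator R (c • x) = ∫⁻ x in uset g, R x := by
    rw [← lintegral_indicator hg.measurableSet]
    refine lintegral_congr fun x => ?_
    have : c • x ∈ {x | g x ≤ c} ↔ x ∈ uset g := by
      change g (c • x) ≤ c ↔ g x ≤ 1
      rw [hg.smul c hc.le]
      constructor
      · intro h; by_contra h'; nlinarith
      · intro h; nlinarith
    by_cases hx : x ∈ uset g
    · rw [indicator_of_mem hx, indicator_of_mem (this.2 hx), hh c hc]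
    · rw [indicator_of_notMem hx, indicator_of_notMem (fun h => hx (this.1 h))]
  rw [h2] at h
  rw [h, ← mul_assoc, ENNReal.mul_inv_cancel (by simp [pow_pos hc]) (by simp), one_mul]

lemma shell_eq {d : ℕ} {g : Euc d → ℝ} (hg : Subl g) {R : Euc d → ℝ≥0∞}
    (hh : ∀ c : ℝ, 0 < c → ∀ x, R (c • x) = R x) {e : ℝ} (he : 0 < e) (he1 : e < 1) :
    ENNReal.ofReal ((1 - e) ^ d) * (∫⁻ x in uset g, R x) + ∫⁻ x in {x | 1 - e < g x ∧ g x < 1}, R x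
      = ∫⁻ x in uset g, R x := by
  rw [← lint_level hg hh (by linarith : 0 < 1 - e)]
  have hm : MeasurableSet {x | 1 - e < g x ∧ g x < 1} :=
    (measurableSet_lt measurable_const hg.measurable).inter (measurableSet_lt hg.measurable measurable_const)
  rw [← lintegral_union hm]
  · refine setLIntegral_congr ?_
    have h1 : ∀ᵐ a, g a ≠ 1 := measure_eq_zero_iff_ae_notMem.1 (level_null hg one_pos)
    filter_upwards [h1] with a ha
    refine propext ⟨?_, ?_⟩
    · rintro (h | h)
      · exact (show g a ≤ 1 - e from h).trans (by linarith)
      · exact (show 1 - e < g a ∧ g a < 1 from h).2.le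
    · intro h
      have h : g a < 1 := lt_of_le_of_ne h ha
      by_cases h' : g a ≤ 1 - e
      · exact Or.inl h'
      · exact Or.inr ⟨not_le.1 h', h⟩
  · rw [Set.disjoint_left]
    intro a (ha : g a ≤ 1 - e) (hb : 1 - e < g a ∧ g a < 1)
    exact absurd ha (not_le.2 hb.1)

lemma shell_lower {d : ℕ} (hd : 0 < d) {g : Euc d → ℝ} (hg : Subl g) {R : Euc d → ℝ≥0∞}
    (hh : ∀ c : ℝ, 0 < c → ∀ x, R (c • x) = R x) {e : ℝ} (he : 0 < e) (he1 : e < 1)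
    (hfin : ∫⁻ x in uset g, R x ≠ ⊤) :
    ENNReal.ofReal e * ∫⁻ x in uset g, R x ≤ ∫⁻ x in {x | 1 - e < g x ∧ g x < 1}, R x := by
  have h := shell_eq hg hh he he1
  set I := ∫⁻ x in uset g, R x
  have h2 : ENNReal.ofReal ((1 - e) ^ d) * I + ENNReal.ofReal e * I ≤
      ENNReal.ofReal ((1 - e) ^ d) * I + ∫⁻ x in {x | 1 - e < g x ∧ g x < 1}, R x := by
    rw [h, ← add_mul, ← ENNReal.ofReal_add (pow_nonneg (by linarith) _) he.le]
    refine mul_le_of_le_one_left (zero_le') ?_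
    rw [ENNReal.ofReal_le_one]
    have : (1 - e) ^ d ≤ 1 - e := pow_le_of_le_one (by linarith) (by linarith) hd.ne'
    linarith
  exact (ENNReal.add_le_add_iff_left (ENNReal.mul_ne_top ENNReal.ofReal_ne_top hfin)).1 h2

lemma shell_upper {d : ℕ} {g : Euc d → ℝ} (hg : Subl g) {R : Euc d → ℝ≥0∞}
    (hh : ∀ c : ℝ, 0 < c → ∀ x, R (c • x) = R x) {e : ℝ} (he : 0 < e) (he1 : e < 1)
    (hfin : ∫⁻ x in uset g, R x ≠ ⊤) :
    ∫⁻ x in {x | 1 - e < g x ∧ g x < 1}, R x ≤ ENNReal.ofReal (d * e) * ∫⁻ x in uset g, R x := by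
  have h := shell_eq hg hh he he1
  set I := ∫⁻ x in uset g, R x
  have h2 : ENNReal.ofReal ((1 - e) ^ d) * I + ∫⁻ x in {x | 1 - e < g x ∧ g x < 1}, R x ≤
      ENNReal.ofReal ((1 - e) ^ d) * I + ENNReal.ofReal (d * e) * I := by
    rw [h, ← add_mul, ← ENNReal.ofReal_add (pow_nonneg (by linarith) _) (by positivity)]
    refine le_mul_of_one_le_left (zero_le') ?_
    rw [ENNReal.one_le_ofReal]
    have := one_add_mul_le_pow (a := -e) (by linarith) d
    rw [← sub_eq_add_neg] at this
    linarith
  exact (ENNReal.add_le_add_iff_left (ENNReal.mul_ne_top ENNReal.ofReal_ne_top hfin)).1 h2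
end

noncomputable section

/-- shifted support function -/
def pp {d : ℕ} (h : Euc d → ℝ) (x θ : Euc d) : ℝ := h θ - ⟪x, θ⟫

def Dom {d : ℕ} (h : Euc d → ℝ) : Set (Euc d) := {x | ∀ θ, θ ≠ 0 → ⟪x, θ⟫ < h θ}

def Th {d : ℕ} (h : Euc d → ℝ) (x x' : Euc d) (t : ℝ) : Prop :=
  ∀ θ, pp h x θ ≤ Real.exp t * pp h x' θ ∧ pp h x' θ ≤ Real.exp t * pp h x θ

structure Pr {d : ℕ} (g h : Euc d → ℝ) : Prop where
  hg : Subl g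
  hh : Subl h
  lt : ∀ φ θ, φ ≠ 0 → θ ≠ 0 → ⟪φ, θ⟫ < g φ * h θ

def nz {d : ℕ} (g : Euc d → ℝ) (φ : Euc d) : Euc d := (g φ)⁻¹ • φ

def kk {d : ℕ} (g h : Euc d → ℝ) (φ θ : Euc d) : ℝ≥0∞ :=
  ENNReal.ofReal |⟪gradient h θ, gradient g φ⟫ - 1| *
    ENNReal.ofReal ((g φ * h θ / (g φ * h θ - ⟪φ, θ⟫)) ^ d)

def mass {d : ℕ} (g h : Euc d → ℝ) (S : Set (Euc d)) : ℝ≥0∞ :=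
  ∫⁻ φ in uset g, S.indicator (fun φ => ∫⁻ θ in uset h, kk g h φ θ) φ

variable {d : ℕ} {g h : Euc d → ℝ}

lemma pp_subl (hh : Subl h) {x : Euc d} (hx : x ∈ Dom h) : Subl (pp h x) where
  add a b := by
    rw [pp, pp, pp, inner_add_right]; linarith [hh.add a b]
  smul c hc a := by
    rw [pp, pp, inner_smul_right, hh.smul c hc]; ring
  pos θ hθ := sub_pos.2 (hx θ hθ)

lemma pp_nonneg (hh : Subl h) {x : Euc d} (hx : x ∈ Dom h) (θ : Euc d) : 0 ≤ pp h x θ :=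
  (pp_subl hh hx).nonneg θ

lemma Th.symm {x y : Euc d} {t : ℝ} (h' : Th h x y t) : Th h y x t := fun θ => (h' θ).symm

lemma Th.trans {x y z : Euc d} {s t : ℝ} (h1 : Th h x y s) (h2 : Th h y z t) : Th h x z (s + t) := by
  intro θ
  rw [Real.exp_add]
  constructor
  · calc _ ≤ _ := (h1 θ).1
      _ ≤ Real.exp s * (Real.exp t * pp h z θ) := by gcongr; exact (h2 θ).1
      _ = _ := by ring
  · calc _ ≤ _ := (h2 θ).2
      _ ≤ Real.exp t * (Real.exp s * pp h x θ) := by gcongr; exact (h1 θ).2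
      _ = _ := by ring

lemma Th.mono (hh : Subl h) {x y : Euc d} (hx : x ∈ Dom h) (hy : y ∈ Dom h) {s t : ℝ}
    (h1 : Th h x y s) (hst : s ≤ t) : Th h x y t := fun θ => by
  have := pp_nonneg hh hx θ
  have := pp_nonneg hh hy θ
  exact ⟨(h1 θ).1.trans (by gcongr), (h1 θ).2.trans (by gcongr)⟩

lemma Pr.symm (hP : Pr g h) : Pr h g :=
  ⟨hP.hh, hP.hg, fun φ θ h1 h2 => by rw [real_inner_comm, mul_comm]; exact hP.lt θ φ h2 h1⟩

lemma Pr.dom (hP : Pr g h) {x : Euc d} (hx : g x ≤ 1) : x ∈ Dom h := by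
  intro θ hθ
  by_cases h0 : x = 0
  · subst h0; rw [inner_zero_left]; exact hP.hh.pos θ hθ
  · exact (hP.lt x θ h0 hθ).trans_le (mul_le_of_le_one_left (hP.hh.nonneg _) hx)

lemma g_nz (hg : Subl g) {φ : Euc d} (h0 : φ ≠ 0) : g (nz g φ) = 1 := by
  rw [nz, hg.smul _ (inv_nonneg.2 (hg.nonneg _)), inv_mul_cancel₀ (hg.pos φ h0).ne']

lemma nz_smul (hg : Subl g) {c : ℝ} (hc : 0 < c) (φ : Euc d) : nz g (c • φ) = nz g φ := by
  rw [nz, nz, hg.smul c hc.le, smul_smul, mul_inv, mul_comm c⁻¹, mul_assoc, inv_mul_cancel₀ hc.ne', mul_one]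

lemma grad_smul (hg : Subl g) {c : ℝ} (hc : 0 < c) (x : Euc d) :
    gradient g (c • x) = gradient g x := by
  rw [gradient, gradient, hg.fderiv_smul hc]

lemma grad_meas (g : Euc d → ℝ) : Measurable (gradient g) :=
  (InnerProductSpace.toDual ℝ (Euc d)).symm.continuous.measurable.comp (measurable_fderiv ℝ g)

lemma kk_symm (φ θ : Euc d) : kk g h φ θ = kk h g θ φ := by
  rw [kk, kk, real_inner_comm, mul_comm (g φ), real_inner_comm φ θ]

lemma kk_meas (hg : Subl g) (hh : Subl h) : Measurable (Function.uncurry (kk g h)) := by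
  have h1 := grad_meas g
  have h2 := grad_meas h
  have h3 := hg.measurable
  have h4 := hh.measurable
  unfold Function.uncurry kk
  fun_prop

lemma mass_univ (g h : Euc d → ℝ) : mass g h univ = ∫⁻ φ in uset g, ∫⁻ θ in uset h, kk g h φ θ := by
  simp [mass]

lemma mass_symm (hP : Pr g h) : mass g h univ = mass h g univ := by
  rw [mass_univ, mass_univ, lintegral_lintegral_swap]
  · simp_rw [kk_symm (g := g) (h := h)]
  · exact (kk_meas hP.hg hP.hh).aemeasurable

lemma row (hd : 0 < d) (hP : Pr g h) {φ : Euc d} (h0 : φ ≠ 0) (hdiff : DifferentiableAt ℝ g φ) :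
    ∫⁻ θ in uset h, kk g h φ θ = NN (pp h (nz g φ)) (gradient g φ) := by
  have hgp := hP.hg.pos φ h0
  have hs : Subl (pp h (nz g φ)) := pp_subl hP.hh (hP.dom (g_nz hP.hg h0).le)
  have e1 : ⟪nz g φ, gradient g φ⟫ = 1 := by
    rw [real_inner_comm, inner_gradient_left, nz, map_smul, hP.hg.euler hdiff, smul_eq_mul,
      inv_mul_cancel₀ hgp.ne']
  have hm : Measurable fun θ => ENNReal.ofReal |⟪gradient h θ, gradient g φ⟫ - 1| := by
    have := grad_meas h
    fun_prop
  have e2 : NN (pp h (nz g φ)) (gradient g φ) =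
      ∫⁻ θ in uset (pp h (nz g φ)), ENNReal.ofReal |⟪gradient h θ, gradient g φ⟫ - 1| := by
    rw [NN]
    refine lintegral_congr_ae (ae_restrict_of_ae ?_)
    filter_upwards [hP.hh.ae_diff] with θ hθ
    have : HasFDerivAt (pp h (nz g φ)) (fderiv ℝ h θ - innerSL ℝ (nz g φ)) θ :=
      hθ.hasFDerivAt.sub (innerSL ℝ (nz g φ)).hasFDerivAt
    rw [this.fderiv, sub_apply, innerSL_apply_apply, e1, inner_gradient_left]
  rw [e2, ray hd hs hP.hh hm]
  · refine lintegral_congr_ae (ae_restrict_of_ae ?_)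
    filter_upwards [ae_ne_zero hd] with θ hθ
    have hpos := hs.pos θ hθ
    have : h θ / pp h (nz g φ) θ = g φ * h θ / (g φ * h θ - ⟪φ, θ⟫) := by
      have e : g φ * h θ - ⟪φ, θ⟫ = g φ * pp h (nz g φ) θ := by
        rw [pp, nz, inner_smul_left]
        simp only [conj_trivial]
        field_simp
      rw [e, mul_div_mul_left _ _ hgp.ne']
    rw [kk, this]
  · intro c hc x
    rw [grad_smul hP.hh hc]

lemma vol_level {a : Euc d → ℝ} (ha : Subl a) (y : Euc d) {c : ℝ} (hc : 0 < c) :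
    volume {φ | a (φ - y) ≤ c} = ENNReal.ofReal c ^ d * volume (uset a) := by
  have h1 : volume {φ | a (φ - y) ≤ c} = volume {φ | a φ ≤ c} := by
    have := measure_preimage_add_right volume (-y) {φ | a φ ≤ c}
    rw [← this]; simp only [sub_eq_add_neg]; rfl
  have h2 := lint_level ha (R := fun _ => 1) (fun _ _ _ => rfl) hc
  rw [setLIntegral_one, setLIntegral_one] at h2
  rw [h1, h2, ENNReal.ofReal_pow hc.le]

lemma hA_eq (q : Euc d → ℝ) (z : Euc d) : hA q z = gauge (polarSet (macA q)) z := rfl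

lemma inner_le_hA {q : Euc d → ℝ} (hq : Subl q) {v : Euc d} (hv : v ∈ macA q) (z : Euc d) :
    |⟪v, z⟫| ≤ hA q z := by
  rw [abs_le]
  have h1 := hq.macA_bod.inner_le_of_mem hv z
  have h2 := hq.macA_bod.inner_le_of_mem (Subl.macA_symm hv) z
  rw [inner_neg_left] at h2
  rw [hA_eq]
  exact ⟨by linarith, h1⟩

lemma avg {q : Euc d → ℝ} (hq : Subl q) (z : Euc d) :
    ENNReal.ofReal (hA q z) * volume (macA q) ≤
      4 * 4 ^ d * ∫⁻ v in macA q, ENNReal.ofReal |⟪z, v⟫| := by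
  obtain ⟨v0, hv0, hz⟩ := hq.macA_bod.exists_gauge_polar z
  rw [← hA_eq] at hz
  set H := hA q z
  have hA := hq.macA_bod
  have hmono : ∫⁻ v in {v | gauge (macA q) (v - (2⁻¹ : ℝ) • v0) ≤ 4⁻¹}, ENNReal.ofReal (H / 4) ≤
      ∫⁻ v in macA q, ENNReal.ofReal |⟪z, v⟫| := by
    have hm : MeasurableSet {v | gauge (macA q) (v - (2⁻¹ : ℝ) • v0) ≤ 4⁻¹} := by
      have := hA.sub.continuous
      exact (isClosed_le (by fun_prop) continuous_const).measurableSet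
    refine (setLIntegral_mono' hm ?_).trans (lintegral_mono_set ?_)
    · intro v hv
      refine ENNReal.ofReal_le_ofReal ?_
      have hv : gauge (macA q) (v - (2⁻¹ : ℝ) • v0) ≤ 4⁻¹ := hv
      have hw : (4 : ℝ) • (v - (2⁻¹ : ℝ) • v0) ∈ macA q := by
        rw [← hA.gauge_le_one, hA.sub.smul _ (by norm_num)]; linarith
      have h1 := (abs_le.1 (inner_le_hA hq hw z)).1
      rw [inner_smul_left, inner_sub_left, inner_smul_left, hz] at h1
      simp only [conj_trivial] at h1
      rw [real_inner_comm]
      refine le_trans ?_ (le_abs_self _)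
      change -H ≤ _ at h1
      linarith
    · intro v hv
      have hv : gauge (macA q) (v - (2⁻¹ : ℝ) • v0) ≤ 4⁻¹ := hv
      rw [← hA.gauge_le_one]
      have h1 := hA.sub.add (v - (2⁻¹ : ℝ) • v0) ((2⁻¹ : ℝ) • v0)
      rw [sub_add_cancel, hA.sub.smul _ (by norm_num) v0] at h1
      have := hA.gauge_le_one.2 hv0
      linarith
  rw [setLIntegral_const, vol_level hA.sub _ (by norm_num), hA.uset_gauge] at hmono
  have e : ENNReal.ofReal 4⁻¹ = 4⁻¹ := by
    rw [ENNReal.ofReal_inv_of_pos (by norm_num)]; simp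
  have e4 : (4 : ℝ≥0∞) * 4⁻¹ = 1 := ENNReal.mul_inv_cancel (by simp) (by simp)
  rw [div_eq_mul_inv, ENNReal.ofReal_mul (hq.hA_subl.nonneg z), e] at hmono
  calc _ = (4 * 4⁻¹) * (4 * 4⁻¹) ^ d * (ENNReal.ofReal H * volume (macA q)) := by rw [e4]; simp
    _ = 4 * 4 ^ d * (ENNReal.ofReal H * 4⁻¹ * (4⁻¹ ^ d * volume (macA q))) := by rw [mul_pow]; ring
    _ ≤ _ := by gcongr

/-- density of a cell -/
def RS (g q : Euc d → ℝ) (S : Set (Euc d)) (φ : Euc d) : ℝ≥0∞ :=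
  S.indicator (fun φ => ENNReal.ofReal (hA q (gradient g φ))) φ

lemma hA_meas {q : Euc d → ℝ} (hq : Subl q) (g : Euc d → ℝ) :
    Measurable fun φ => ENNReal.ofReal (hA q (gradient g φ)) :=
  (hq.hA_subl.measurable.comp (grad_meas g)).ennreal_ofReal

lemma RS_hom (hg : Subl g) (q : Euc d → ℝ) {S : Set (Euc d)}
    (hS : ∀ c : ℝ, 0 < c → ∀ φ, c • φ ∈ S ↔ φ ∈ S) (c : ℝ) (hc : 0 < c) (x : Euc d) :
    RS g q S (c • x) = RS g q S x := by
  unfold RS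
  by_cases hx : x ∈ S
  · rw [indicator_of_mem hx, indicator_of_mem ((hS c hc x).2 hx), grad_smul hg hc]
  · rw [indicator_of_notMem hx, indicator_of_notMem (fun h => hx ((hS c hc x).1 h))]

lemma RS_fin (hg : Subl g) {q : Euc d → ℝ} (hq : Subl q) (S : Set (Euc d)) :
    ∫⁻ x in uset g, RS g q S x ≠ ⊤ := by
  obtain ⟨C, hC⟩ := hg.lipschitz
  obtain ⟨C2, hC2, h2⟩ := hq.hA_subl.exists_upper
  have : ∀ x, RS g q S x ≤ ENNReal.ofReal (C2 * C) := by
    intro x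
    refine (indicator_le_self' (fun _ _ => zero_le) x).trans ?_
    refine ENNReal.ofReal_le_ofReal ((h2 _).trans ?_)
    gcongr
    rw [gradient, LinearIsometryEquiv.norm_map]
    exact norm_fderiv_le_of_lipschitz ℝ hC
  refine ((lintegral_mono this).trans_lt ?_).ne
  rw [setLIntegral_const]
  exact ENNReal.mul_lt_top ENNReal.ofReal_lt_top hg.vol_lt_top
end

noncomputable section
variable {d : ℕ} {g h : Euc d → ℝ}

lemma a_bound (hg : Subl g) {a : Euc d → ℝ} (ha : Subl a) : ∃ C : ℝ, 0 < C ∧ ∀ x, a x ≤ C * g x ∧ a (-x) ≤ C * g x := by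
  obtain ⟨C1, h1, hC1⟩ := ha.exists_upper
  obtain ⟨c, hc, hcc⟩ := hg.exists_lower
  refine ⟨C1 / c, by positivity, fun x => ?_⟩
  have : C1 * ‖x‖ ≤ C1 / c * g x := by
    rw [div_mul_eq_mul_div, le_div_iff₀ hc]
    nlinarith [hcc x]
  exact ⟨(hC1 x).trans this, (hC1 (-x)).trans (by rwa [norm_neg])⟩

lemma meas_level {a : Euc d → ℝ} (ha : Subl a) (y : Euc d) (c : ℝ) :
    MeasurableSet {φ | a (φ - y) ≤ c} := by
  have := ha.continuous
  exact (isClosed_le (by fun_prop) continuous_const).measurableSet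

lemma meas_shell (hg : Subl g) (e : ℝ) : MeasurableSet {x | 1 - e < g x ∧ g x < 1} :=
  (measurableSet_lt measurable_const hg.measurable).inter (measurableSet_lt hg.measurable measurable_const)

lemma gauge_macA_neg {q : Euc d → ℝ} (x : Euc d) : gauge (macA q) (-x) = gauge (macA q) x :=
  gauge_neg (fun _ hx => Subl.macA_symm hx) x

lemma cell_upper (hd : 0 < d) (hg : Subl g) {q : Euc d → ℝ} (hq : Subl q) {S : Set (Euc d)}
    (hSm : MeasurableSet S) (hS : ∀ c : ℝ, 0 < c → ∀ φ, c • φ ∈ S ↔ φ ∈ S) {y0 : Euc d} {r : ℝ} (hr : 0 < r)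
    (hy : ∀ φ ∈ S, φ ≠ 0 → gauge (macA q) (nz g φ - y0) ≤ r) :
    ENNReal.ofReal r * ∫⁻ φ in uset g, RS g q S φ ≤
      8 * 12 ^ d * (ENNReal.ofReal r ^ d * volume (macA q)) := by
  have hb := hq.macA_bod
  have ha := hb.sub
  obtain ⟨C, hC, hCC⟩ := a_bound hg ha
  set e := min (1 / 2) (r / C) with he
  have he0 : 0 < e := by positivity
  have he1 : e < 1 := (min_le_left _ _).trans_lt (by norm_num)
  have heC : e * C ≤ r := by
    have := min_le_right (1 / 2) (r / C)
    rw [← he, le_div_iff₀ hC] at this; exact this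
  obtain ⟨CL, hCL⟩ := prof_lip hg he0
  have hv : ∀ v ∈ macA q, ENNReal.ofReal (r / e) * ∫⁻ φ in {φ | gauge (macA q) (φ - y0) ≤ 2 * r} ∩
      {x | 1 - e < g x ∧ g x < 1}, ENNReal.ofReal |⟪gradient g φ, v⟫| ≤
        2 * (3 ^ d * (ENNReal.ofReal r ^ d * volume (macA q))) := by
    intro v hv
    have h1 := tv_upper hCL (r • v) (meas_level ha y0 (2 * r)) (meas_level ha y0 (3 * r)) ?_ ?_ (prof_var hg he0)
    · rw [vol_level ha y0 (by positivity), hb.uset_gauge, ENNReal.ofReal_mul (by norm_num), mul_pow] at h1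
      have e3 : ENNReal.ofReal 3 = 3 := by simp
      rw [e3, mul_assoc] at h1
      refine le_trans ?_ h1
      rw [← lintegral_const_mul' _ _ ENNReal.ofReal_ne_top]
      refine le_trans (setLIntegral_mono' ((meas_level ha y0 (2 * r)).inter (meas_shell hg e)) ?_)
        (lintegral_mono_set inter_subset_left)
      intro φ hφ
      have h3 : 1 - e < g φ ∧ g φ < 1 := hφ.2
      rw [prof_fderiv_in hg he0 h3.1 h3.2, ← ENNReal.ofReal_mul (by positivity), inner_gradient_left,
        map_smul, smul_eq_mul, abs_mul, abs_of_pos hr]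
      exact ENNReal.ofReal_le_ofReal (le_of_eq (by ring))
    · rw [vol_level ha y0 (by positivity), hb.uset_gauge]
      exact ENNReal.mul_ne_top (by finiteness) hb.vol_lt_top.ne
    · intro φ hφ t ht
      have hφ : gauge (macA q) (φ - y0) ≤ 2 * r := hφ
      change gauge (macA q) (φ - t • r • v - y0) ≤ 3 * r
      have h2 := ha.add (φ - y0) (-((t * r) • v))
      rw [gauge_macA_neg, ha.smul _ (mul_nonneg ht.1 hr.le)] at h2
      have h3 := hb.gauge_le_one.2 hv
      have h4 : t * r * gauge (macA q) v ≤ r := by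
        have : t * r ≤ r := by nlinarith [ht.2]
        have h0 : 0 ≤ gauge (macA q) v := ha.nonneg v
        have h0' : 0 ≤ t * r := mul_nonneg ht.1 hr.le
        nlinarith
      have h5 : φ - t • r • v - y0 = φ - y0 + -((t * r) • v) := by rw [smul_smul]; abel
      rw [h5]; linarith
  set B := {φ | gauge (macA q) (φ - y0) ≤ 2 * r} ∩ {x | 1 - e < g x ∧ g x < 1} with hB
  set M := ENNReal.ofReal r ^ d * volume (macA q) with hM
  have hint : ENNReal.ofReal (r / e) * ∫⁻ φ in B, ∫⁻ v in macA q, ENNReal.ofReal |⟪gradient g φ, v⟫| ≤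
      2 * (3 ^ d * M) * volume (macA q) := by
    rw [lintegral_lintegral_swap]
    · rw [← lintegral_const_mul' _ _ ENNReal.ofReal_ne_top, ← setLIntegral_const]
      exact setLIntegral_mono' hb.compact.measurableSet hv
    · have := grad_meas g
      apply Measurable.aemeasurable
      unfold Function.uncurry
      fun_prop
  have hmem : ∀ φ ∈ S, 1 - e < g φ ∧ g φ < 1 → φ ∈ B := by
    intro φ hφ h3
    refine ⟨?_, h3⟩
    have h0 : φ ≠ 0 := by
      rintro rfl; rw [hg.zero] at h3; linarith
    have hp := hg.pos φ h0
    have h1 := hy φ hφ h0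
    change gauge (macA q) (φ - y0) ≤ 2 * r
    have h2 := ha.add (nz g φ - y0) (-((1 - g φ) • nz g φ))
    rw [gauge_macA_neg, ha.smul _ (by linarith)] at h2
    have h5 : nz g φ - y0 + -((1 - g φ) • nz g φ) = φ - y0 := by
      have : φ = g φ • nz g φ := by rw [nz, smul_smul, mul_inv_cancel₀ hp.ne', one_smul]
      nth_rw 4 [this]; module
    rw [h5] at h2
    have h6 := (hCC (nz g φ)).1
    rw [g_nz hg h0] at h6
    have h7 : (1 - g φ) * gauge (macA q) (nz g φ) ≤ e * C :=
      mul_le_mul (by linarith) (by linarith) (ha.nonneg _) he0.le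
    linarith
  have hsh : ENNReal.ofReal e * ∫⁻ φ in uset g, RS g q S φ ≤
      ∫⁻ φ in B, ENNReal.ofReal (hA q (gradient g φ)) := by
    refine (shell_lower hd hg (RS_hom hg q hS) he0 he1 (RS_fin hg hq S)).trans ?_
    unfold RS
    rw [lintegral_indicator hSm, Measure.restrict_restrict hSm]
    exact lintegral_mono_set fun φ hφ => hmem φ hφ.1 hφ.2
  have hfin : (∫⁻ φ in B, ENNReal.ofReal (hA q (gradient g φ))) * volume (macA q) ≤
      4 * 4 ^ d * ∫⁻ φ in B, ∫⁻ v in macA q, ENNReal.ofReal |⟪gradient g φ, v⟫| := by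
    rw [← lintegral_mul_const _ (hA_meas hq g), ← lintegral_const_mul' _ _ (by finiteness)]
    exact lintegral_mono fun φ => avg hq _
  have e1 : ENNReal.ofReal r = ENNReal.ofReal (r / e) * ENNReal.ofReal e := by
    rw [← ENNReal.ofReal_mul (by positivity), div_mul_cancel₀ _ he0.ne']
  have hA0 : volume (macA q) ≠ 0 := hb.vol_pos.ne'
  have hAt : volume (macA q) ≠ ⊤ := hb.vol_lt_top.ne
  rw [← ENNReal.mul_le_mul_iff_left hA0 hAt]
  calc ENNReal.ofReal r * (∫⁻ φ in uset g, RS g q S φ) * volume (macA q)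
      = ENNReal.ofReal (r / e) * ((ENNReal.ofReal e * ∫⁻ φ in uset g, RS g q S φ) * volume (macA q)) := by
        rw [e1]; ring
    _ ≤ ENNReal.ofReal (r / e) * ((∫⁻ φ in B, ENNReal.ofReal (hA q (gradient g φ))) * volume (macA q)) := by
        gcongr
    _ ≤ ENNReal.ofReal (r / e) * (4 * 4 ^ d * ∫⁻ φ in B, ∫⁻ v in macA q, ENNReal.ofReal |⟪gradient g φ, v⟫|) := by
        gcongr
    _ = 4 * 4 ^ d * (ENNReal.ofReal (r / e) * ∫⁻ φ in B, ∫⁻ v in macA q, ENNReal.ofReal |⟪gradient g φ, v⟫|) := by ring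
    _ ≤ 4 * 4 ^ d * (2 * (3 ^ d * M) * volume (macA q)) := by gcongr
    _ = _ := by
        rw [show (12 : ℝ≥0∞) = 4 * 3 by norm_num, mul_pow]; ring

lemma cell_lower (hd : 0 < d) (hg : Subl g) {q : Euc d → ℝ} (hq : Subl q) {S : Set (Euc d)}
    (hSm : MeasurableSet S) (hS : ∀ c : ℝ, 0 < c → ∀ φ, c • φ ∈ S ↔ φ ∈ S) {x v' : Euc d} {β : ℝ} (hβ : 0 < β)
    (hv' : v' ∈ macA q) (hgy : g (x + β • v') = 1) (hin : ∀ v ∈ macA q, g (x + β • v) ≤ 1)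
    (hy : ∀ φ, φ ≠ 0 → gauge (macA q) (nz g φ - x) ≤ 4 * β → φ ∈ S) :
    ENNReal.ofReal β ^ d * volume (macA q) ≤
      2 * 8 ^ d * (ENNReal.ofReal β * ∫⁻ φ in uset g, RS g q S φ) := by
  have hb := hq.macA_bod
  have ha := hb.sub
  obtain ⟨C, hC, hCC⟩ := a_bound hg ha
  have hx0 : g x < 1 := by
    -- x is interior
    by_contra hcon
    push Not at hcon
    have hx1 : g x = 1 := le_antisymm (by simpa using hin 0 hb.zmem) hcon
    have hxne : x ≠ 0 := by rintro rfl; rw [hg.zero] at hx1; norm_num at hx1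
    have hp := ha.pos x hxne
    have h1 := hin ((gauge (macA q) x)⁻¹ • x) (by
      rw [← hb.gauge_le_one, ha.smul _ (by positivity), inv_mul_cancel₀ hp.ne'])
    rw [show x + β • (gauge (macA q) x)⁻¹ • x = (1 + β * (gauge (macA q) x)⁻¹) • x by
      rw [add_smul, one_smul, smul_smul], hg.smul _ (by positivity), hx1, mul_one] at h1
    have : 0 < β * (gauge (macA q) x)⁻¹ := by positivity
    linarith
  have hin4 : ∀ φ, gauge (macA q) (φ - x) ≤ 4⁻¹ * β → g φ ≤ 3 / 4 * g x + 1 / 4 := by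
    intro φ hφ
    have hw : (4 * β⁻¹) • (φ - x) ∈ macA q := by
      rw [← hb.gauge_le_one, ha.smul _ (by positivity)]
      calc _ ≤ 4 * β⁻¹ * (4⁻¹ * β) := by gcongr
        _ = 1 := by field_simp
    have h1 := hin _ hw
    have h2 := hg.add ((3 / 4 : ℝ) • x) ((1 / 4 : ℝ) • (x + β • (4 * β⁻¹) • (φ - x)))
    rw [hg.smul _ (by norm_num), hg.smul _ (by norm_num)] at h2
    have h3 : (3 / 4 : ℝ) • x + (1 / 4 : ℝ) • (x + β • (4 * β⁻¹) • (φ - x)) = φ := by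
      rw [smul_smul, show β * (4 * β⁻¹) = 4 by field_simp]; module
    rw [h3] at h2
    linarith
  set e := min (min (1 / 2) (β / (2 * C))) ((1 - g x) / 2) with he
  have he0 : 0 < e := by
    have : 0 < 1 - g x := by linarith
    positivity
  have he2 : e ≤ 1 / 2 := (min_le_left _ _).trans (min_le_left _ _)
  have he1 : e < 1 := he2.trans_lt (by norm_num)
  have heC : 2 * e * C ≤ β := by
    have : e ≤ β / (2 * C) := (min_le_left _ _).trans (min_le_right _ _)
    rw [le_div_iff₀ (by positivity)] at this; linarith
  have heg : e ≤ (1 - g x) / 2 := min_le_right _ _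
  obtain ⟨CL, hCL⟩ := prof_lip hg he0
  obtain ⟨u, hu, hu1⟩ := hg.bod.polar.exists_gauge_polar (x + β • v')
  rw [hg.bod.polar_polar, hg.gauge_uset, hgy] at hu1
  have hug : ∀ z, ⟪u, z⟫ ≤ g z := by
    intro z
    have := hg.bod.polar.inner_le_of_mem hu z
    rwa [hg.bod.polar_polar, hg.gauge_uset] at this
  have huv : ∀ v ∈ macA q, |⟪u, v⟫| ≤ ⟪u, v'⟫ := by
    have h1 : ∀ v ∈ macA q, ⟪u, v⟫ ≤ ⟪u, v'⟫ := by
      intro v hv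
      have h1 := (hug _).trans (hin v hv)
      rw [← hu1, inner_add_right, inner_add_right, inner_smul_right, inner_smul_right] at h1
      have : β * ⟪u, v⟫ ≤ β * ⟪u, v'⟫ := by linarith
      exact le_of_mul_le_mul_left this hβ
    intro v hv
    have h2 := h1 _ (Subl.macA_symm hv)
    rw [inner_neg_right] at h2
    exact abs_le.2 ⟨by linarith, h1 v hv⟩
  have hux : ⟪u, x⟫ + β * ⟪u, v'⟫ = 1 := by
    rw [inner_add_right, inner_smul_right] at hu1; exact hu1
  have huv0 : 0 ≤ β * ⟪u, v'⟫ := mul_nonneg hβ.le ((abs_nonneg _).trans (huv v' hv'))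
  have h1 := tv_lower hCL ((2 * β) • v') (meas_level ha x (4⁻¹ * β)) (meas_level ha x (3 * β)) ?_ ?_
  rotate_left
  · rw [vol_level ha x (by positivity), hb.uset_gauge]
    exact ENNReal.mul_ne_top (by finiteness) hb.vol_lt_top.ne
  · intro φ hφ t ht
    have hφ : gauge (macA q) (φ - x) ≤ 4⁻¹ * β := hφ
    change gauge (macA q) (φ + t • (2 * β) • v' - x) ≤ 3 * β
    have h2 := ha.add (φ - x) ((t * (2 * β)) • v')
    rw [ha.smul _ (mul_nonneg ht.1 (by positivity))] at h2
    have h3 := hb.gauge_le_one.2 hv'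
    have h4 : t * (2 * β) * gauge (macA q) v' ≤ 1 * (2 * β) * 1 := by
      have := ha.nonneg v'
      gcongr
      exact ht.2
    have h5 : φ + t • (2 * β) • v' - x = φ - x + (t * (2 * β)) • v' := by rw [smul_smul]; abel
    rw [h5]; linarith
  have hleft : ENNReal.ofReal (4⁻¹ * β) ^ d * volume (macA q) ≤
      ∫⁻ a in {φ | gauge (macA q) (φ - x) ≤ 4⁻¹ * β}, ENNReal.ofReal |prof g e (a + (2 * β) • v') - prof g e a| := by
    have := vol_level ha x (by positivity : 0 < 4⁻¹ * β)
    rw [hb.uset_gauge] at this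
    rw [← this, ← setLIntegral_one]
    refine setLIntegral_mono' (meas_level ha x _) fun φ hφ => ?_
    have hφ : gauge (macA q) (φ - x) ≤ 4⁻¹ * β := hφ
    have hg1 := hin4 φ hφ
    have e1 : prof g e φ = 1 := by
      have : 1 ≤ (1 - g φ) / e := by rw [le_div_iff₀ he0]; linarith
      rw [prof, min_eq_left this]; simp
    have hw : (4 * β⁻¹) • (φ - x) ∈ macA q := by
      rw [← hb.gauge_le_one, ha.smul _ (by positivity)]
      calc _ ≤ 4 * β⁻¹ * (4⁻¹ * β) := by gcongr
        _ = 1 := by field_simp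
    have e2 : prof g e (φ + (2 * β) • v') = 0 := by
      have h3 := (abs_le.1 (huv _ hw)).1
      rw [inner_smul_right] at h3
      have h4 : -(β * ⟪u, v'⟫) ≤ 4 * ⟪u, φ - x⟫ := by
        have := mul_le_mul_of_nonneg_left h3 hβ.le
        rw [show β * (4 * β⁻¹ * ⟪u, φ - x⟫) = 4 * ⟪u, φ - x⟫ by field_simp] at this
        linarith
      rw [inner_sub_right] at h4
      have h5 := hug (φ + (2 * β) • v')
      rw [inner_add_right, inner_smul_right] at h5
      have h6 : (1 - g (φ + (2 * β) • v')) / e ≤ 0 :=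
        div_nonpos_of_nonpos_of_nonneg (by linarith) he0.le
      rw [prof]
      exact max_eq_left ((min_le_right _ _).trans h6)
    rw [e1, e2]; simp
  have hmem : ∀ φ, gauge (macA q) (φ - x) ≤ 3 * β → 1 - e < g φ ∧ g φ < 1 → φ ∈ S := by
    intro φ hφ h3
    have h0 : φ ≠ 0 := by
      rintro rfl; rw [hg.zero] at h3; linarith
    have hp := hg.pos φ h0
    refine hy φ h0 ?_
    have h2 := ha.add (φ - x) ((1 - g φ) • nz g φ)
    rw [ha.smul _ (by linarith)] at h2
    have h5 : φ - x + (1 - g φ) • nz g φ = nz g φ - x := by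
      have : φ = g φ • nz g φ := by rw [nz, smul_smul, mul_inv_cancel₀ hp.ne', one_smul]
      nth_rw 1 [this]; module
    rw [h5] at h2
    have h6 := (hCC (nz g φ)).1
    rw [g_nz hg h0] at h6
    have h7 : (1 - g φ) * gauge (macA q) (nz g φ) ≤ e * C :=
      mul_le_mul (by linarith) (by linarith) (ha.nonneg _) he0.le
    have : 0 < e * C := by positivity
    linarith
  have hright : ∫⁻ a in {φ | gauge (macA q) (φ - x) ≤ 3 * β}, ENNReal.ofReal |fderiv ℝ (prof g e) a ((2 * β) • v')| ≤
      ENNReal.ofReal (2 * β / e) * ∫⁻ φ in {x | 1 - e < g x ∧ g x < 1}, RS g q S φ := by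
    rw [← lintegral_const_mul' _ _ ENNReal.ofReal_ne_top, ← lintegral_indicator (meas_shell hg e),
      ← lintegral_indicator (meas_level ha x _)]
    refine lintegral_mono_ae ?_
    have n1 : ∀ᵐ a, g a ≠ 1 := measure_eq_zero_iff_ae_notMem.1 (level_null hg one_pos)
    have n2 : ∀ᵐ a, g a ≠ 1 - e := measure_eq_zero_iff_ae_notMem.1 (level_null hg (by linarith))
    filter_upwards [n1, n2] with φ hn1 hn2
    by_cases hB : φ ∈ {φ | gauge (macA q) (φ - x) ≤ 3 * β}
    swap
    · rw [indicator_of_notMem hB]; exact zero_le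
    rw [indicator_of_mem hB]
    by_cases hs : 1 - e < g φ ∧ g φ < 1
    · rw [indicator_of_mem (show φ ∈ {x | 1 - e < g x ∧ g x < 1} from hs), RS,
        indicator_of_mem (hmem φ hB hs), ← ENNReal.ofReal_mul (by positivity),
        prof_fderiv_in hg he0 hs.1 hs.2]
      refine ENNReal.ofReal_le_ofReal ?_
      rw [map_smul, smul_eq_mul, abs_mul, abs_of_pos (by positivity), ← inner_gradient_left]
      have := inner_le_hA hq hv' (gradient g φ)
      rw [real_inner_comm] at this
      calc _ ≤ 2 * β * hA q (gradient g φ) / e := by gcongr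
        _ = _ := by ring
    · rw [indicator_of_notMem (show φ ∉ {x | 1 - e < g x ∧ g x < 1} from hs)]
      have : fderiv ℝ (prof g e) φ = 0 := by
        rcases lt_or_gt_of_ne hn1 with h1 | h1
        · refine prof_fderiv_out1 hg he0 (lt_of_le_of_ne ?_ hn2)
          by_contra hc
          exact hs ⟨not_le.1 hc, h1⟩
        · exact prof_fderiv_out2 hg he0 h1
      rw [this]; simp
  have hsh := shell_upper hg (RS_hom hg q hS) he0 he1 (RS_fin hg hq S)
  have e4 : (4 : ℝ≥0∞) * ENNReal.ofReal 4⁻¹ = 1 := by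
    rw [ENNReal.ofReal_inv_of_pos (by norm_num)]; simpa using ENNReal.mul_inv_cancel (by simp) (by simp)
  calc ENNReal.ofReal β ^ d * volume (macA q)
      = (4 * ENNReal.ofReal 4⁻¹) ^ d * (ENNReal.ofReal β ^ d * volume (macA q)) := by rw [e4]; simp
    _ = 4 ^ d * (ENNReal.ofReal (4⁻¹ * β) ^ d * volume (macA q)) := by
        rw [ENNReal.ofReal_mul (by norm_num), mul_pow, mul_pow]; ring
    _ ≤ 4 ^ d * (ENNReal.ofReal (2 * β / e) * (ENNReal.ofReal (d * e) * ∫⁻ φ in uset g, RS g q S φ)) := by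
        exact mul_le_mul' le_rfl (hleft.trans (h1.trans (hright.trans (mul_le_mul' le_rfl hsh))))
    _ = 4 ^ d * (ENNReal.ofReal (2 * d * β) * ∫⁻ φ in uset g, RS g q S φ) := by
        rw [← mul_assoc (ENNReal.ofReal _), ← ENNReal.ofReal_mul (by positivity)]
        congr 3; field_simp
    _ ≤ 4 ^ d * (ENNReal.ofReal (2 * 2 ^ d * β) * ∫⁻ φ in uset g, RS g q S φ) := by
        gcongr; exact_mod_cast Nat.lt_two_pow_self.le
    _ = _ := by
        rw [ENNReal.ofReal_mul (by positivity), ENNReal.ofReal_mul (by positivity),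
          ENNReal.ofReal_pow (by norm_num), show (8 : ℝ≥0∞) = 4 * 2 by norm_num, mul_pow]
        simp only [ENNReal.ofReal_ofNat]
        ring
end

noncomputable section
variable {d : ℕ} {g h : Euc d → ℝ}

lemma gauge_macA_le {q : Euc d → ℝ} (hq : Subl q) {v : Euc d} {s : ℝ} (hs : 0 ≤ s)
    (hv : ∀ θ, |⟪v, θ⟫| ≤ s * q θ) : gauge (macA q) v ≤ s := by
  rw [← hq.macA_bod.polar_polar]
  refine hq.macA_bod.polar.gauge_polar_le hs ?_
  intro θ hθ
  by_contra hc
  push Not at hc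
  -- θ ∈ polar of macA; scale v
  rw [real_inner_comm] at hc
  rcases hs.eq_or_lt with rfl | hs0
  · have := (le_abs_self _).trans (hv θ); linarith
  have hm : s⁻¹ • v ∈ macA q := by
    intro θ'
    rw [inner_smul_left]
    simp only [conj_trivial]
    rw [abs_mul, abs_of_pos (by positivity), inv_mul_le_iff₀ hs0]
    exact hv θ'
  have h1 := hθ _ hm
  rw [inner_smul_left] at h1
  simp only [conj_trivial] at h1
  rw [inv_mul_le_iff₀ hs0] at h1
  linarith

lemma le_of_gauge_macA {q : Euc d → ℝ} (hq : Subl q) {v : Euc d} {s : ℝ}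
    (hv : gauge (macA q) v ≤ s) (θ : Euc d) : |⟪v, θ⟫| ≤ s * q θ := by
  have hb := hq.macA_bod
  by_cases h0 : v = 0
  · subst h0
    rw [hb.sub.zero] at hv
    simpa using mul_nonneg hv (hq.nonneg θ)
  have hp := hb.sub.pos v h0
  have hm : (gauge (macA q) v)⁻¹ • v ∈ macA q := by
    rw [← hb.gauge_le_one, hb.sub.smul _ (by positivity), inv_mul_cancel₀ hp.ne']
  have h1 := hm θ
  rw [inner_smul_left] at h1
  simp only [conj_trivial] at h1
  rw [abs_mul, abs_of_pos (by positivity), inv_mul_le_iff₀ hp] at h1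
  exact h1.trans (by have := hq.nonneg θ; gcongr)

lemma Th.gauge_le (hh : Subl h) {x y : Euc d} (hx : x ∈ Dom h) (hy : y ∈ Dom h) {t : ℝ} (ht : 0 ≤ t)
    (hT : Th h x y t) : gauge (macA (pp h y)) (x - y) ≤ Real.exp t - 1 := by
  have h1 : 1 ≤ Real.exp t := Real.one_le_exp ht
  refine gauge_macA_le (pp_subl hh hy) (by linarith) fun θ => ?_
  have e : ⟪x - y, θ⟫ = pp h y θ - pp h x θ := by rw [pp, pp, inner_sub_left]; ring
  have h2 := hT θ
  have h3 := pp_nonneg hh hx θ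
  have h4 := pp_nonneg hh hy θ
  rw [e, abs_le]
  constructor
  · linarith [h2.1]
  · have : Real.exp t * (pp h y θ - pp h x θ) ≤ Real.exp t * ((Real.exp t - 1) * pp h y θ) := by
      nlinarith [h2.2, mul_nonneg (mul_nonneg (sub_nonneg.2 h1) (sub_nonneg.2 h1)) h4]
    exact le_of_mul_le_mul_left this (Real.exp_pos t)

lemma dom_of_gauge (hh : Subl h) {x y : Euc d} (hy : y ∈ Dom h) {s : ℝ} (hs1 : s < 1)
    (hg : gauge (macA (pp h y)) (x - y) ≤ s) : x ∈ Dom h := by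
  intro θ hθ
  have h1 := le_of_gauge_macA (pp_subl hh hy) hg θ
  have h2 := (pp_subl hh hy).pos θ hθ
  rw [inner_sub_left] at h1
  have h3 := (abs_le.1 h1).2
  rw [pp] at h2 h3
  nlinarith

lemma Th.of_gauge (hh : Subl h) {x y : Euc d} (hy : y ∈ Dom h) {s : ℝ} (hs0 : 0 ≤ s) (hs1 : s ≤ 1 / 2)
    (hg : gauge (macA (pp h y)) (x - y) ≤ s) : Th h x y (2 * s) := by
  intro θ
  have h1 := abs_le.1 (le_of_gauge_macA (pp_subl hh hy) hg θ)
  have h2 := pp_nonneg hh hy θ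
  have e : ⟪x - y, θ⟫ = pp h y θ - pp h x θ := by rw [pp, pp, inner_sub_left]; ring
  rw [e] at h1
  have h3 := Real.add_one_le_exp (2 * s)
  constructor
  · nlinarith
  · have h5 : (1 - s) * pp h y θ ≤ pp h x θ := by linarith
    have h7 : 1 ≤ (2 * s + 1) * (1 - s) := by nlinarith
    have h6 : 0 ≤ pp h x θ := le_trans (mul_nonneg (by linarith) h2) h5
    calc pp h y θ ≤ (2 * s + 1) * (1 - s) * pp h y θ := le_mul_of_one_le_left h2 h7
      _ = (2 * s + 1) * ((1 - s) * pp h y θ) := by ring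
      _ ≤ (2 * s + 1) * pp h x θ := by gcongr
      _ ≤ _ := by gcongr

lemma Th.hA_le (hh : Subl h) {x y : Euc d} (hx : x ∈ Dom h) (hy : y ∈ Dom h) {t : ℝ}
    (hT : Th h x y t) (z : Euc d) : hA (pp h x) z ≤ Real.exp t * hA (pp h y) z := by
  obtain ⟨v, hv, hz⟩ := (pp_subl hh hx).macA_bod.exists_gauge_polar z
  rw [← hA_eq] at hz
  rw [← hz]
  have hm : (Real.exp t)⁻¹ • v ∈ macA (pp h y) := by
    intro θ
    rw [inner_smul_left]
    simp only [conj_trivial]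
    rw [abs_mul, abs_of_pos (by positivity), inv_mul_le_iff₀ (Real.exp_pos t)]
    exact (hv θ).trans (hT θ).1
  have := (le_abs_self _).trans (inner_le_hA (pp_subl hh hy) hm z)
  rw [inner_smul_left] at this
  simp only [conj_trivial] at this
  rwa [inv_mul_le_iff₀ (Real.exp_pos t)] at this

lemma Th.vol_le (hh : Subl h) {x y : Euc d} (_ : x ∈ Dom h) (hy : y ∈ Dom h) {t : ℝ}
    (hT : Th h x y t) : volume (uset (pp h x)) ≤ ENNReal.ofReal (Real.exp t) ^ d * volume (uset (pp h y)) := by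
  rw [← vol_smul (Real.exp_pos t).le]
  refine measure_mono fun θ hθ => ?_
  have hθ : pp h x θ ≤ 1 := hθ
  rw [mem_smul_set_iff_inv_smul_mem₀ (Real.exp_pos t).ne']
  change pp h y _ ≤ 1
  rw [(pp_subl hh hy).smul _ (by positivity), inv_mul_le_iff₀ (Real.exp_pos t)]
  exact (hT θ).2.trans (by gcongr)

/-- cell -/
def cel (g h : Euc d → ℝ) (x : Euc d) (t : ℝ) : Set (Euc d) := {φ | φ ≠ 0 ∧ Th h (nz g φ) x t}

lemma isClosed_Th (h : Euc d → ℝ) (x : Euc d) (t : ℝ) : IsClosed {y | Th h y x t} := by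
  have : {y | Th h y x t} = ⋂ θ, {y | pp h y θ ≤ Real.exp t * pp h x θ ∧ pp h x θ ≤ Real.exp t * pp h y θ} := by
    ext y; simp [Th]
  rw [this]
  refine isClosed_iInter fun θ => ?_
  have h1 : IsClosed {y | pp h y θ ≤ Real.exp t * pp h x θ} := by
    unfold pp
    exact isClosed_le (by fun_prop) (by fun_prop)
  have h2 : IsClosed {y | pp h x θ ≤ Real.exp t * pp h y θ} := by
    unfold pp
    exact isClosed_le (by fun_prop) (by fun_prop)
  exact h1.inter h2

lemma cel_meas (hg : Subl g) (x : Euc d) (t : ℝ) : MeasurableSet (cel g h x t) := by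
  have hm : Measurable (nz g) := by
    have := hg.measurable
    unfold nz; fun_prop
  exact (measurableSet_singleton 0).compl.inter (hm (isClosed_Th h x t).measurableSet)

lemma cel_cone (hg : Subl g) (x : Euc d) (t c : ℝ) (hc : 0 < c) (φ : Euc d) :
    c • φ ∈ cel g h x t ↔ φ ∈ cel g h x t := by
  change (c • φ ≠ 0 ∧ Th h (nz g (c • φ)) x t) ↔ (φ ≠ 0 ∧ Th h (nz g φ) x t)
  rw [nz_smul hg hc]
  simp [hc.ne']

lemma mass_mono {S S' : Set (Euc d)} (hS : S ⊆ S') : mass g h S ≤ mass g h S' :=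
  lintegral_mono fun _ => indicator_le_indicator_of_subset hS (fun _ => zero_le) _

/-- volume ratio hypothesis -/
structure VR (d : ℕ) (c C Ω : ℝ≥0∞) : Prop where
  pos : Ω ≠ 0
  fin : Ω ≠ ⊤
  lower : ∀ p : Euc d → ℝ, Subl p → Ω ≤ c ^ d * (volume (macA p) * volume (uset p))
  upper : ∀ p : Euc d → ℝ, Subl p → volume (macA p) * volume (uset p) ≤ C ^ d * Ω

lemma exp_le_three {t : ℝ} (ht : t ≤ 1) : ENNReal.ofReal (Real.exp t) ≤ 3 := by
  rw [← ENNReal.ofReal_ofNat]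
  refine ENNReal.ofReal_le_ofReal ?_
  have := Real.exp_le_exp.2 ht
  have := Real.exp_one_lt_d9
  linarith

lemma exp_le_243' {t : ℝ} (ht : t ≤ 5) : Real.exp t ≤ 243 := by
  have h1 : Real.exp 5 = Real.exp 1 ^ 5 := by rw [← Real.exp_nat_mul]; norm_num
  have h2 : Real.exp 1 ≤ 3 := by have := Real.exp_one_lt_d9; linarith
  calc Real.exp t ≤ Real.exp 5 := Real.exp_le_exp.2 ht
    _ = Real.exp 1 ^ 5 := h1
    _ ≤ 3 ^ 5 := by gcongr
    _ = 243 := by norm_num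

lemma exp_le_243 {t : ℝ} (ht : t ≤ 5) : ENNReal.ofReal (Real.exp t) ≤ 243 := by
  rw [← ENNReal.ofReal_ofNat]
  exact ENNReal.ofReal_le_ofReal (exp_le_243' ht)

lemma mass_upper (hd : 0 < d) {c C Ω : ℝ≥0∞} (hV : VR d c C Ω) (hP : Pr g h) {y0 : Euc d}
    (hy0 : y0 ∈ Dom h) {t : ℝ} (ht : 0 < t) (ht1 : t ≤ 5) :
    ENNReal.ofReal t * mass g h (cel g h y0 t) ≤ 7776 * 2834352 ^ d * C ^ d * (Ω * ENNReal.ofReal t ^ d) := by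
  set q := pp h y0 with hq'
  have hq : Subl q := pp_subl hP.hh hy0
  set S := cel g h y0 t with hS
  have h1 : mass g h S ≤ 972 * 972 ^ d * volume (uset q) * ∫⁻ φ in uset g, RS g q S φ := by
    rw [mass, ← lintegral_const_mul' _ _ (by have := hq.vol_lt_top; finiteness)]
    refine lintegral_mono_ae (ae_restrict_of_ae ?_)
    filter_upwards [hP.hg.ae_diff] with φ hdiff
    by_cases hφ : φ ∈ S
    swap
    · rw [indicator_of_notMem hφ]; exact zero_le
    have hx : nz g φ ∈ Dom h := hP.dom (g_nz hP.hg hφ.1).le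
    rw [indicator_of_mem hφ, row hd hP hφ.1 hdiff, RS, indicator_of_mem hφ]
    refine ((pp_subl hP.hh hx).NN_upper _).trans ?_
    have h2 := hφ.2.hA_le hP.hh hx hy0 (gradient g φ)
    have h3 := hφ.2.vol_le hP.hh hx hy0
    calc _ ≤ ENNReal.ofReal (Real.exp t * hA q (gradient g φ)) * (4 * 4 ^ d *
          (ENNReal.ofReal (Real.exp t) ^ d * volume (uset q))) := by gcongr
      _ = ENNReal.ofReal (Real.exp t) * ENNReal.ofReal (hA q (gradient g φ)) * (4 * 4 ^ d *
          (ENNReal.ofReal (Real.exp t) ^ d * volume (uset q))) := by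
          rw [ENNReal.ofReal_mul (Real.exp_pos t).le]
      _ ≤ 243 * ENNReal.ofReal (hA q (gradient g φ)) * (4 * 4 ^ d *
          (243 ^ d * volume (uset q))) := by gcongr <;> exact exp_le_243 ht1
      _ = _ := by rw [show (972 : ℝ≥0∞) = 243 * 4 by norm_num, mul_pow]; ring
  set r := Real.exp t - 1 with hr
  have hrt : t ≤ r := by have := Real.add_one_le_exp t; linarith
  have hrt2 : r ≤ 243 * t := by
    have h1 : Real.exp t ≤ 243 := exp_le_243' ht1
    have h2 := Real.add_one_le_exp (-t)
    have h3 : Real.exp t * Real.exp (-t) = 1 := by rw [← Real.exp_add]; simp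
    nlinarith [Real.exp_pos t]
  have h2 := cell_upper hd hP.hg hq (cel_meas hP.hg y0 t) (cel_cone hP.hg y0 t) (lt_of_lt_of_le ht hrt) (y0 := y0)
    (fun φ hφ h0 => hφ.2.gauge_le hP.hh (hP.dom (g_nz hP.hg h0).le) hy0 ht.le)
  rw [← hS] at h2
  calc ENNReal.ofReal t * mass g h S ≤
      ENNReal.ofReal r * (972 * 972 ^ d * volume (uset q) * ∫⁻ φ in uset g, RS g q S φ) := by gcongr
    _ = 972 * 972 ^ d * volume (uset q) * (ENNReal.ofReal r * ∫⁻ φ in uset g, RS g q S φ) := by ring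
    _ ≤ 972 * 972 ^ d * volume (uset q) * (8 * 12 ^ d * (ENNReal.ofReal r ^ d * volume (macA q))) :=
        mul_le_mul' le_rfl h2
    _ ≤ 972 * 972 ^ d * volume (uset q) * (8 * 12 ^ d * (ENNReal.ofReal (243 * t) ^ d * volume (macA q))) := by gcongr
    _ = 7776 * 2834352 ^ d * ENNReal.ofReal t ^ d * (volume (macA q) * volume (uset q)) := by
        rw [ENNReal.ofReal_mul (by norm_num), mul_pow, show (2834352 : ℝ≥0∞) = 972 * 12 * 243 by norm_num, mul_pow, mul_pow]
        simp only [ENNReal.ofReal_ofNat]; ring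
    _ ≤ 7776 * 2834352 ^ d * ENNReal.ofReal t ^ d * (C ^ d * Ω) := mul_le_mul' le_rfl (hV.upper q hq)
    _ = _ := by ring

lemma mass_lower (hd : 0 < d) {c C Ω : ℝ≥0∞} (hV : VR d c C Ω) (hP : Pr g h) {x v' : Euc d}
    (hx : x ∈ Dom h) {β : ℝ} (hβ : 0 < β) (hβ1 : β ≤ 1 / 8)
    (hv' : v' ∈ macA (pp h x)) (hgy : g (x + β • v') = 1) (hin : ∀ v ∈ macA (pp h x), g (x + β • v) ≤ 1) :
    Ω * ENNReal.ofReal β ^ d ≤ 36 * 48 ^ d * c ^ d * (ENNReal.ofReal β * mass g h (cel g h x (8 * β))) := by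
  set q := pp h x with hq'
  have hq : Subl q := pp_subl hP.hh hx
  set S := cel g h x (8 * β) with hS
  have h1 : volume (uset q) * ∫⁻ φ in uset g, RS g q S φ ≤ 18 * 6 ^ d * mass g h S := by
    rw [mass, ← lintegral_const_mul' _ _ hq.vol_lt_top.ne, ← lintegral_const_mul' _ _ (by finiteness)]
    refine lintegral_mono_ae (ae_restrict_of_ae ?_)
    filter_upwards [hP.hg.ae_diff] with φ hdiff
    by_cases hφ : φ ∈ S
    swap
    · rw [RS, indicator_of_notMem hφ]; simp
    have hx' : nz g φ ∈ Dom h := hP.dom (g_nz hP.hg hφ.1).le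
    rw [indicator_of_mem hφ, row hd hP hφ.1 hdiff, RS, indicator_of_mem hφ]
    have h2 := hφ.2.symm.hA_le hP.hh hx hx' (gradient g φ)
    have h3 := hφ.2.symm.vol_le hP.hh hx hx'
    have h4 := (pp_subl hP.hh hx').NN_lower (gradient g φ)
    set q' := pp h (nz g φ)
    have h5 := exp_le_three (t := 8 * β) (by linarith)
    calc _ ≤ (ENNReal.ofReal (Real.exp (8 * β)) ^ d * volume (uset q')) *
          ENNReal.ofReal (Real.exp (8 * β) * hA q' (gradient g φ)) := by gcongr
      _ = (ENNReal.ofReal (Real.exp (8 * β)) ^ d * volume (uset q')) *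
          (ENNReal.ofReal (Real.exp (8 * β)) * ENNReal.ofReal (hA q' (gradient g φ))) := by
          rw [ENNReal.ofReal_mul (Real.exp_pos _).le]
      _ ≤ (3 ^ d * volume (uset q')) * (3 * ENNReal.ofReal (hA q' (gradient g φ))) := by gcongr
      _ = 3 * 3 ^ d * (ENNReal.ofReal (hA q' (gradient g φ)) * volume (uset q')) := by ring
      _ ≤ 3 * 3 ^ d * (6 * 2 ^ d * NN q' (gradient g φ)) := mul_le_mul' le_rfl h4
      _ = _ := by rw [show (6 : ℝ≥0∞) ^ d = (3 * 2) ^ d by norm_num, mul_pow]; ring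
  have h2 := cell_lower hd hP.hg hq (cel_meas hP.hg x (8 * β)) (cel_cone (h := h) hP.hg x (8 * β)) hβ hv' hgy hin
    (fun φ h0 hle => ⟨h0, by
      have := Th.of_gauge hP.hh hx (by positivity) (by linarith) hle
      rwa [show 2 * (4 * β) = 8 * β by ring] at this⟩)
  rw [← hS] at h2
  calc Ω * ENNReal.ofReal β ^ d ≤ c ^ d * (volume (macA q) * volume (uset q)) * ENNReal.ofReal β ^ d :=
        mul_le_mul' (hV.lower q hq) le_rfl
    _ = c ^ d * volume (uset q) * (ENNReal.ofReal β ^ d * volume (macA q)) := by ring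
    _ ≤ c ^ d * volume (uset q) * (2 * 8 ^ d * (ENNReal.ofReal β * ∫⁻ φ in uset g, RS g q S φ)) :=
        mul_le_mul' le_rfl h2
    _ = c ^ d * (2 * 8 ^ d * ENNReal.ofReal β) * (volume (uset q) * ∫⁻ φ in uset g, RS g q S φ) := by ring
    _ ≤ c ^ d * (2 * 8 ^ d * ENNReal.ofReal β) * (18 * 6 ^ d * mass g h S) := mul_le_mul' le_rfl h1
    _ = _ := by rw [show (48 : ℝ≥0∞) = 8 * 6 by norm_num, mul_pow]; ring
end

noncomputable section
variable {d : ℕ} {g h : Euc d → ℝ}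

/-- pairs -/
def GV (g h : Euc d → ℝ) : Set (Euc d × Euc d) := {z | g z.1 ≤ 1 ∧ z.2 ∈ macA (pp h z.1)}

/-- expanded body -/
def G1 (g h : Euc d → ℝ) (β : ℝ) : Set (Euc d) := (fun z : Euc d × Euc d => z.1 + β • z.2) '' GV g h

lemma GV_compact (hP : Pr g h) : IsCompact (GV g h) := by
  obtain ⟨C, hC, hCC⟩ := hP.hh.exists_upper
  obtain ⟨R, hR, hRR⟩ := hP.hg.bod.exists_bound
  refine IsCompact.of_isClosed_subset (hP.hg.isCompact.prod (isCompact_closedBall (0 : Euc d) (C + R))) ?_ ?_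
  · have h1 : GV g h = {z | g z.1 ≤ 1} ∩ ⋂ θ, {z : Euc d × Euc d | |⟪z.2, θ⟫| ≤ h θ - ⟪z.1, θ⟫} := by
      ext z; simp [GV, macA, pp]
    rw [h1]
    have := hP.hg.continuous
    refine (isClosed_le (by fun_prop) (by fun_prop)).inter (isClosed_iInter fun θ => ?_)
    exact isClosed_le (by fun_prop) (by fun_prop)
  · rintro ⟨x, v⟩ ⟨h1, h2⟩
    refine ⟨h1, ?_⟩
    rw [mem_closedBall_zero_iff]
    have h3 := (le_abs_self _).trans (h2 v)
    rw [real_inner_self_eq_norm_sq, pp] at h3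
    have h4 := abs_le.1 (abs_real_inner_le_norm x v)
    have h5 := hCC v
    have h6 : ‖x‖ ≤ R := by simpa using hRR h1
    have h7 : ‖v‖ * ‖v‖ ≤ (C + R) * ‖v‖ := by nlinarith [norm_nonneg v]
    by_contra hc
    push Not at hc
    change C + R < ‖v‖ at hc
    nlinarith

lemma GV_convex (hP : Pr g h) : Convex ℝ (GV g h) := by
  rintro ⟨x, v⟩ ⟨h1, h2⟩ ⟨x', v'⟩ ⟨h1', h2'⟩ a b ha hb hab
  refine ⟨hP.hg.convex h1 h1' ha hb hab, fun θ => ?_⟩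
  simp only [Prod.smul_mk, Prod.mk_add_mk, inner_add_left, inner_smul_left, conj_trivial, pp]
  have e1 := abs_le.1 (h2 θ)
  have e2 := abs_le.1 (h2' θ)
  simp only [pp] at e1 e2
  have : h θ = a * h θ + b * h θ := by rw [← add_mul, hab, one_mul]
  rw [abs_le]
  constructor <;> nlinarith

lemma subset_G1 (hP : Pr g h) (β : ℝ) : uset g ⊆ G1 g h β := by
  intro x hx
  exact ⟨(x, 0), ⟨hx, (pp_subl hP.hh (hP.dom hx)).macA_bod.zmem⟩, by simp⟩

lemma G1_bod (hP : Pr g h) (β : ℝ) : Bod (G1 g h β) := by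
  refine ⟨(GV_compact hP).image (by fun_prop), ?_, interior_mono (subset_G1 hP β) hP.hg.zero_mem⟩
  have := (GV_convex hP).linear_image (LinearMap.fst ℝ (Euc d) (Euc d) + β • LinearMap.snd ℝ (Euc d) (Euc d))
  exact this

lemma G1_Th (hP : Pr g h) {β : ℝ} (hβ : 0 ≤ β) {x v : Euc d} (hx : g x ≤ 1) (hv : v ∈ macA (pp h x)) :
    gauge (macA (pp h x)) (x + β • v - x) ≤ β := by
  have hb := (pp_subl hP.hh (hP.dom hx)).macA_bod
  rw [add_sub_cancel_left, hb.sub.smul _ hβ]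
  exact mul_le_of_le_one_right hβ (hb.gauge_le_one.2 hv)

lemma G1_Pr (hP : Pr g h) {β : ℝ} (hβ : 0 ≤ β) (hβ1 : β < 1) : Pr (gauge (G1 g h β)) h := by
  have hb := G1_bod hP β
  refine ⟨hb.sub, hP.hh, fun φ θ h0 h1 => ?_⟩
  have hp := hb.sub.pos φ h0
  have hm : nz (gauge (G1 g h β)) φ ∈ G1 g h β := by
    rw [← hb.gauge_le_one, g_nz hb.sub h0]
  obtain ⟨⟨x, v⟩, ⟨hx, hv⟩, he⟩ := hm
  have := dom_of_gauge hP.hh (hP.dom hx) hβ1 (G1_Th hP hβ hx hv) θ h1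
  simp only at he
  rw [he, nz, inner_smul_left] at this
  simp only [conj_trivial] at this
  rwa [inv_mul_lt_iff₀ hp] at this

lemma G1_Th_y (hP : Pr g h) {β : ℝ} (hβ : 0 ≤ β) (hβ1 : β ≤ 1 / 2) {y y' : Euc d} (hy : h y ≤ 1) (hy' : h y' ≤ 1)
    {t : ℝ} (hT : Th g y y' t) : Th (gauge (G1 g h β)) y y' (t + 4 * β) := by
  have hb := G1_bod hP β
  have hb1 : 1 + β ≤ Real.exp (4 * β) * (1 - β) := by
    have := Real.add_one_le_exp (4 * β)
    nlinarith
  have key : ∀ y y' : Euc d, h y ≤ 1 → h y' ≤ 1 → Th g y y' t → ∀ φ, pp (gauge (G1 g h β)) y φ ≤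
      Real.exp (t + 4 * β) * pp (gauge (G1 g h β)) y' φ := by
    intro y y' hy hy' hT φ
    by_cases h0 : φ = 0
    · subst h0; simp [pp, hb.sub.zero]
    have hp := hb.sub.pos φ h0
    have hm : nz (gauge (G1 g h β)) φ ∈ G1 g h β := by
      rw [← hb.gauge_le_one, g_nz hb.sub h0]
    obtain ⟨⟨x, v⟩, ⟨hx, hv⟩, he⟩ := hm
    simp only at he hx hv
    have hφ : φ = gauge (G1 g h β) φ • (x + β • v) := by
      rw [he, nz, smul_smul, mul_inv_cancel₀ hp.ne', one_smul]
    have e : ∀ z, pp (gauge (G1 g h β)) z φ = gauge (G1 g h β) φ * (1 - ⟪x, z⟫ - β * ⟪v, z⟫) := by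
      intro z
      have : ⟪z, φ⟫ = gauge (G1 g h β) φ * (⟪x, z⟫ + β * ⟪v, z⟫) := by
        conv_lhs => rw [hφ]
        rw [inner_smul_right, inner_add_right, inner_smul_right, real_inner_comm, real_inner_comm v]
      rw [pp, this]; ring
    have hs : 1 - ⟪x, y⟫ ≤ Real.exp t * (1 - ⟪x, y'⟫) := by
      have h1 := (hT x).1
      rw [pp, pp, real_inner_comm, real_inner_comm x] at h1
      by_cases hx0 : x = 0
      · subst hx0
        have := (hT (φ)).1
        have h2 : 0 ≤ t := by
          by_contra hc
          have h3 := hT φ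
          have p1 := pp_nonneg hP.hg (hP.symm.dom hy) φ
          have p2 := (pp_subl hP.hg (hP.symm.dom hy')).pos φ h0
          have : Real.exp t < 1 := Real.exp_lt_one_iff.2 (not_le.1 hc)
          nlinarith [h3.1, h3.2]
        simpa using Real.one_le_exp h2
      · -- scale up to the boundary is not available: use convexity
        have h2 : 1 ≤ Real.exp t := by
          by_contra hc
          have h3 := hT φ
          have p1 := pp_nonneg hP.hg (hP.symm.dom hy) φ
          have p2 := (pp_subl hP.hg (hP.symm.dom hy')).pos φ h0
          nlinarith [h3.1, h3.2]
        nlinarith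
    have hv1 := abs_le.1 (hv y)
    have hv2 := abs_le.1 (hv y')
    rw [pp] at hv1 hv2
    rw [e, e, Real.exp_add]
    have n1 : 0 ≤ 1 - ⟪x, y'⟫ := by
      have := pp_nonneg hP.hh (hP.dom hx) y'
      rw [pp] at this; linarith
    have a1 : 1 - ⟪x, y⟫ - β * ⟪v, y⟫ ≤ (1 + β) * (1 - ⟪x, y⟫) := by nlinarith
    have a2 : (1 - β) * (1 - ⟪x, y'⟫) ≤ 1 - ⟪x, y'⟫ - β * ⟪v, y'⟫ := by nlinarith
    have hE := Real.exp_pos t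
    have hE4 := Real.exp_pos (4 * β)
    have : 1 - ⟪x, y⟫ - β * ⟪v, y⟫ ≤ Real.exp t * Real.exp (4 * β) * (1 - ⟪x, y'⟫ - β * ⟪v, y'⟫) := by
      calc _ ≤ _ := a1
        _ ≤ (1 + β) * (Real.exp t * (1 - ⟪x, y'⟫)) := by gcongr
        _ ≤ (Real.exp (4 * β) * (1 - β)) * (Real.exp t * (1 - ⟪x, y'⟫)) := by gcongr
        _ = Real.exp t * Real.exp (4 * β) * ((1 - β) * (1 - ⟪x, y'⟫)) := by ring
        _ ≤ _ := by gcongr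
    calc _ ≤ gauge (G1 g h β) φ * (Real.exp t * Real.exp (4 * β) * (1 - ⟪x, y'⟫ - β * ⟪v, y'⟫)) := by gcongr
      _ = _ := by ring
  intro φ
  exact ⟨key y y' hy hy' hT φ, key y' y hy' hy hT.symm φ⟩

lemma G1_near (hP : Pr g h) {β : ℝ} (hβ : 0 < β) (hβ1 : β ≤ 1 / 8) {x : Euc d} (hx : g x = 1) :
    ∃ x1, gauge (G1 g h β) x1 = 1 ∧ Th h x1 x (6 * β) := by
  have hb := G1_bod hP β
  have hq := pp_subl hP.hh (hP.dom hx.le)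
  have hA := hq.macA_bod
  obtain ⟨u, hu, hu1⟩ := hP.hg.bod.polar.exists_gauge_polar x
  rw [hP.hg.bod.polar_polar, hP.hg.gauge_uset, hx] at hu1
  have hug : ∀ z, ⟪u, z⟫ ≤ g z := by
    intro z
    have := hP.hg.bod.polar.inner_le_of_mem hu z
    rwa [hP.hg.bod.polar_polar, hP.hg.gauge_uset] at this
  have hu0 : u ≠ 0 := by rintro rfl; simp at hu1
  obtain ⟨v0, hv0, hz⟩ := hA.exists_gauge_polar u
  have hH : 0 < gauge (polarSet (macA (pp h x))) u := hA.polar.sub.pos u hu0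
  rw [← hz] at hH
  have hmax : ∀ v ∈ macA (pp h x), ⟪v, u⟫ ≤ ⟪v0, u⟫ := by
    intro v hv
    rw [hz]; exact hA.inner_le_of_mem hv u
  have hout : 1 < gauge (G1 g h β) (x + (3 * β) • v0) := by
    by_contra hc
    push Not at hc
    rw [hb.gauge_le_one] at hc
    obtain ⟨⟨x', v'⟩, ⟨hx', hv'⟩, he⟩ := hc
    simp only at he hx' hv'
    have hv3 : ((1 - β) / (1 + 3 * β)) • v' ∈ macA (pp h x) := by
      intro θ
      rw [inner_smul_left]
      simp only [conj_trivial]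
      rw [abs_mul, abs_of_pos (div_pos (by linarith) (by linarith)), div_mul_eq_mul_div, div_le_iff₀ (by linarith)]
      have e : ⟪x', θ⟫ + β * ⟪v', θ⟫ = ⟪x, θ⟫ + 3 * β * ⟪v0, θ⟫ := by
        have := congrArg (fun w => ⟪w, θ⟫) he
        simpa [inner_add_left, inner_smul_left] using this
      have h1 := hv' θ
      have h2 := abs_le.1 (hv0 θ)
      have h3 := abs_le.1 (hv' θ)
      rw [pp] at h1 h2 ⊢
      rw [pp] at h3
      have h4 : (1 - β) * (h θ - ⟪x', θ⟫) ≤ (h θ - ⟪x, θ⟫) * (1 + 3 * β) := by nlinarith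
      nlinarith
    have h1 := hmax _ hv3
    rw [inner_smul_left] at h1
    simp only [conj_trivial] at h1
    rw [div_mul_eq_mul_div, div_le_iff₀ (by linarith)] at h1
    have h2 := (hug x').trans hx'
    have h3 : ⟪u, x'⟫ + β * ⟪v', u⟫ = 1 + 3 * β * ⟪v0, u⟫ := by
      have := congrArg (fun w => ⟪u, w⟫) he
      simp only [inner_add_right, inner_smul_right] at this
      rw [hu1] at this
      rw [real_inner_comm u v', real_inner_comm u v0]
      exact this
    have h4 : 3 * ⟪v0, u⟫ ≤ ⟪v', u⟫ := by
      have : β * (3 * ⟪v0, u⟫) ≤ β * ⟪v', u⟫ := by linarith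
      exact le_of_mul_le_mul_left this hβ
    nlinarith
  have hin : gauge (G1 g h β) x ≤ 1 := hb.gauge_le_one.2 (subset_G1 hP β (show g x ≤ 1 from hx.le))
  have hcont : ContinuousOn (fun t : ℝ => gauge (G1 g h β) (x + t • v0)) (Icc 0 (3 * β)) := by
    have := hb.sub.continuous
    fun_prop
  have := intermediate_value_Icc (by positivity) hcont
  obtain ⟨t, ht, ht1⟩ := this ⟨by simpa using hin, hout.le⟩
  refine ⟨x + t • v0, ht1, ?_⟩
  have h5 : gauge (macA (pp h x)) (x + t • v0 - x) ≤ 3 * β := by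
    rw [add_sub_cancel_left, hA.sub.smul _ ht.1]
    exact (mul_le_of_le_one_right ht.1 (hA.gauge_le_one.2 hv0)).trans ht.2
  have := Th.of_gauge hP.hh (hP.dom hx.le) (by positivity) (by linarith) h5
  rwa [show 2 * (3 * β) = 6 * β by ring] at this
end

noncomputable section
variable {d : ℕ} {g h : Euc d → ℝ}

def msr (g h : Euc d → ℝ) : Measure (Euc d) :=
  (volume.restrict (uset g)).withDensity fun φ => ∫⁻ θ in uset h, kk g h φ θ

lemma mass_eq_msr {S : Set (Euc d)} (hS : MeasurableSet S) : mass g h S = msr g h S := by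
  rw [msr, withDensity_apply _ hS, mass, lintegral_indicator hS]

lemma mass_le_sum (hd : 0 < d) {ι : Type*} [Fintype ι] {S : ι → Set (Euc d)}
    (hS : ∀ i, MeasurableSet (S i)) (hc : ∀ φ, φ ≠ 0 → ∃ i, φ ∈ S i) :
    mass g h univ ≤ ∑ i, mass g h (S i) := by
  have : Nonempty (Fin d) := ⟨⟨0, hd⟩⟩
  rw [mass_eq_msr MeasurableSet.univ]
  simp_rw [fun i => mass_eq_msr (g := g) (h := h) (hS i)]
  have h0 : msr g h {0} = 0 := by
    rw [msr]
    apply withDensity_absolutelyContinuous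
    exact Measure.restrict_le_self.absolutelyContinuous (measure_singleton 0)
  calc msr g h univ ≤ msr g h ({0} ∪ ⋃ i, S i) := by
        apply measure_mono
        intro φ _
        by_cases hφ : φ = 0
        · left; exact hφ
        · right; exact mem_iUnion.2 (hc φ hφ)
    _ ≤ msr g h {0} + msr g h (⋃ i, S i) := measure_union_le _ _
    _ ≤ _ := by rw [h0, zero_add]; exact measure_iUnion_fintype_le _ _

lemma sum_le_mass {ι : Type*} (s : Finset ι) {S : ι → Set (Euc d)}
    (hS : ∀ i, MeasurableSet (S i)) (hd : (s : Set ι).PairwiseDisjoint S) :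
    ∑ i ∈ s, mass g h (S i) ≤ mass g h univ := by
  rw [mass_eq_msr MeasurableSet.univ]
  simp_rw [fun i => mass_eq_msr (g := g) (h := h) (hS i)]
  rw [← measure_biUnion_finset hd (fun i _ => hS i)]
  exact measure_mono (subset_univ _)

lemma Th.refl (hh : Subl h) {x : Euc d} (hx : x ∈ Dom h) {t : ℝ} (ht : 0 ≤ t) : Th h x x t := fun θ => by
  have := pp_nonneg hh hx θ
  have := Real.one_le_exp ht
  constructor <;> nlinarith

/-- upper bound for the total mass from a covering -/
lemma total_upper (hd : 0 < d) {c C Ω : ℝ≥0∞} (hV : VR d c C Ω) (hP : Pr g h) {α : ℝ} (ha : 0 < α)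
    (ha1 : α ≤ 1) {m : ℕ} {Y : Fin m → Euc d} (hY : ∀ i, Y i ∈ Dom g)
    (hc : ∀ y, h y = 1 → ∃ i, Th g y (Y i) (2 * α)) {β : ℝ} (hβ : β = α / 32) :
    ENNReal.ofReal (5 * α) * mass (gauge (G1 g h β)) h univ ≤
      m * (7776 * 2834352 ^ d * C ^ d * (Ω * ENNReal.ofReal (5 * α) ^ d)) := by
  have hβ0 : 0 ≤ β := by rw [hβ]; positivity
  have hP1 := G1_Pr hP hβ0 (by linarith)
  rw [mass_symm hP1]
  set g1 := gauge (G1 g h β)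
  classical
  have : ∀ i : Fin m, ∃ y1, h y1 ≤ 1 ∧ ∀ y, h y = 1 → Th g y (Y i) (2 * α) → Th g y1 (Y i) (2 * α) := by
    intro i
    by_cases hi : ∃ y, h y = 1 ∧ Th g y (Y i) (2 * α)
    · obtain ⟨y, hy, hy'⟩ := hi
      exact ⟨y, hy.le, fun _ _ _ => hy'⟩
    · refine ⟨0, by rw [hP.hh.zero]; norm_num, fun y hy hy' => absurd ⟨y, hy, hy'⟩ hi⟩
  choose y1 hy1 hy2 using this
  have hcov : mass h g1 univ ≤ ∑ i, mass h g1 (cel h g1 (y1 i) (5 * α)) := by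
    apply mass_le_sum hd (fun i => cel_meas hP.hh _ _)
    intro φ hφ
    obtain ⟨i, hi⟩ := hc (nz h φ) (g_nz hP.hh hφ)
    refine ⟨i, hφ, ?_⟩
    have h1 := hi.trans (hy2 i _ (g_nz hP.hh hφ) hi).symm
    have h2 := G1_Th_y hP hβ0 (by linarith) (g_nz hP.hh hφ).le (hy1 i) h1
    exact h2.mono hP1.hg (hP1.symm.dom (g_nz hP.hh hφ).le) (hP1.symm.dom (hy1 i)) (by linarith)
  calc _ ≤ ENNReal.ofReal (5 * α) * ∑ i, mass h g1 (cel h g1 (y1 i) (5 * α)) := mul_le_mul' le_rfl hcov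
    _ = ∑ i, ENNReal.ofReal (5 * α) * mass h g1 (cel h g1 (y1 i) (5 * α)) := Finset.mul_sum _ _ _
    _ ≤ ∑ i : Fin m, (7776 * 2834352 ^ d * C ^ d * (Ω * ENNReal.ofReal (5 * α) ^ d)) :=
        Finset.sum_le_sum fun i _ => mass_upper hd hV hP1.symm (hP1.symm.dom (hy1 i)) (by linarith) (by linarith)
    _ = _ := by simp

lemma total_lower (hd : 0 < d) {c C Ω : ℝ≥0∞} (hV : VR d c C Ω) (hP : Pr g h) {β : ℝ} (hβ : 0 < β)
    (hβ1 : β ≤ 1 / 32) (s : Finset (Euc d)) (hs : ∀ x ∈ s, gauge (G1 g h β) x = 1)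
    (hsep : ∀ x ∈ s, ∀ y ∈ s, Th h x y (20 * β) → x = y) :
    s.card * (Ω * ENNReal.ofReal β ^ d) ≤
      36 * 48 ^ d * c ^ d * (ENNReal.ofReal β * mass (gauge (G1 g h β)) h univ) := by
  classical
  have hP1 := G1_Pr hP hβ.le (by linarith)
  have hB := G1_bod hP β
  set g1 := gauge (G1 g h β) with hg1
  have hx' : ∀ x : Euc d, ∃ x' v', x ∈ s → g x' ≤ 1 ∧ v' ∈ macA (pp h x') ∧ x = x' + β • v' := by
    intro x
    by_cases hx : x ∈ s
    · obtain ⟨z, hz, hz'⟩ := (hB.gauge_le_one (x := x)).1 (hs x hx).le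
      exact ⟨z.1, z.2, fun _ => ⟨hz.1, hz.2, hz'.symm⟩⟩
    · exact ⟨0, 0, fun h => absurd h hx⟩
  choose x' v' hx' using hx'
  have hTh : ∀ x ∈ s, Th h x (x' x) (2 * β) := by
    intro x hx
    obtain ⟨h1, h2, h3⟩ := hx' x hx
    have := G1_Th hP hβ.le h1 h2
    rw [← h3] at this
    exact Th.of_gauge hP.hh (hP.dom h1) hβ.le (by linarith) this
  have hdis : (s : Set (Euc d)).PairwiseDisjoint fun x => cel g1 h (x' x) (8 * β) := by
    intro x hx y hy hxy
    refine Set.disjoint_left.2 fun φ h1 h2 => hxy (hsep x hx y hy ?_)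
    have := (((hTh x hx).trans h1.2.symm).trans h2.2).trans (hTh y hy).symm
    convert this using 1; ring
  have hsum := sum_le_mass (g := g1) (h := h) s (fun x => cel_meas hP1.hg (x' x) (8 * β)) hdis
  calc _ = ∑ x ∈ s, Ω * ENNReal.ofReal β ^ d := by simp
    _ ≤ ∑ x ∈ s, 36 * 48 ^ d * c ^ d * (ENNReal.ofReal β * mass g1 h (cel g1 h (x' x) (8 * β))) := by
        apply Finset.sum_le_sum
        intro x hx
        obtain ⟨h1, h2, h3⟩ := hx' x hx
        refine mass_lower hd hV hP1 (hP.dom h1) hβ (by linarith) h2 (by rw [← h3]; exact hs x hx) ?_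
        intro v hv
        exact (hB.gauge_le_one).2 ⟨(x' x, v), ⟨h1, hv⟩, rfl⟩
    _ ≤ _ := by
        rw [← Finset.mul_sum, ← Finset.mul_sum]
        exact mul_le_mul' le_rfl (mul_le_mul' le_rfl hsum)

def KC : ℝ≥0∞ := 279936 * (48 * 2834352 * 160)

lemma count_bound (hd : 0 < d) {c C Ω : ℝ≥0∞} (hV : VR d c C Ω) (hP : Pr g h) {α : ℝ} (ha : 0 < α)
    (ha1 : α ≤ 1) {m : ℕ} {Y : Fin m → Euc d} (hY : ∀ i, Y i ∈ Dom g)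
    (hc : ∀ y, h y = 1 → ∃ i, Th g y (Y i) (2 * α)) {β : ℝ} (hβ : β = α / 32)
    (s : Finset (Euc d)) (hs : ∀ x ∈ s, gauge (G1 g h β) x = 1)
    (hsep : ∀ x ∈ s, ∀ y ∈ s, Th h x y (20 * β) → x = y) :
    (s.card : ℝ≥0∞) ≤ (KC * (c * C)) ^ d * m := by
  have hβ0 : 0 < β := by rw [hβ]; positivity
  have hu := total_upper hd hV hP ha ha1 hY hc hβ
  have hl := total_lower hd hV hP hβ0 (by linarith) s hs hsep
  set M := mass (gauge (G1 g h β)) h univ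
  have h160 : ENNReal.ofReal (5 * α) = 160 * ENNReal.ofReal β := by
    rw [show 5 * α = 160 * β by rw [hβ]; ring, ENNReal.ofReal_mul (by norm_num)]
    norm_num
  have hM : ENNReal.ofReal β * M ≤ ENNReal.ofReal (5 * α) * M := by
    rw [h160]
    refine mul_le_mul' ?_ le_rfl
    calc ENNReal.ofReal β = 1 * ENNReal.ofReal β := (one_mul _).symm
      _ ≤ _ := mul_le_mul' (by norm_num) le_rfl
  have hb0 : ENNReal.ofReal β ≠ 0 := by simpa using hβ0
  have hQ0 : Ω * ENNReal.ofReal β ^ d ≠ 0 := mul_ne_zero hV.pos (pow_ne_zero _ hb0)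
  have hQ1 : Ω * ENNReal.ofReal β ^ d ≠ ⊤ := by have := hV.fin; finiteness
  have h3 : (s.card : ℝ≥0∞) * (Ω * ENNReal.ofReal β ^ d) ≤
      ((KC * (c * C)) ^ d * m) * (Ω * ENNReal.ofReal β ^ d) := by
    calc _ ≤ 36 * 48 ^ d * c ^ d * (m * (7776 * 2834352 ^ d * C ^ d * (Ω * ENNReal.ofReal (5 * α) ^ d))) :=
          hl.trans (mul_le_mul' le_rfl (hM.trans hu))
      _ = (36 * 7776) * (48 * 2834352 * 160) ^ d * (c * C) ^ d * m * (Ω * ENNReal.ofReal β ^ d) := by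
          rw [h160]; simp only [mul_pow]; ring
      _ ≤ 279936 ^ d * (48 * 2834352 * 160) ^ d * (c * C) ^ d * m * (Ω * ENNReal.ofReal β ^ d) := by
          refine mul_le_mul' (mul_le_mul' (mul_le_mul' (mul_le_mul' ?_ le_rfl) le_rfl) le_rfl) le_rfl
          calc (36 * 7776 : ℝ≥0∞) = 279936 ^ 1 := by norm_num
            _ ≤ _ := pow_le_pow_right₀ (by norm_num) hd
      _ = _ := by rw [KC, mul_pow (279936 * (48 * 2834352 * 160)), mul_pow (279936:ℝ≥0∞)]
  exact (ENNReal.mul_le_mul_iff_left hQ0 hQ1).1 h3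

theorem counting (hd : 0 < d) {c C Ω : ℝ≥0∞} (hV : VR d c C Ω) (hcC : c * C ≠ ⊤) (hP : Pr g h) {α : ℝ} (ha : 0 < α)
    (ha1 : α ≤ 1) {m : ℕ} {Y : Fin m → Euc d} (hY : ∀ i, Y i ∈ Dom g)
    (hc : ∀ y, h y = 1 → ∃ i, Th g y (Y i) (2 * α)) :
    ∃ n : ℕ, (n : ℝ≥0∞) ≤ (KC * (c * C)) ^ d * m ∧ ∃ X : Fin n → Euc d, (∀ i, X i ∈ Dom h) ∧
      ∀ x, g x = 1 → ∃ i, Th h x (X i) α := by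
  classical
  set β := α / 32 with hβ
  have hβ0 : 0 < β := by rw [hβ]; positivity
  have hP1 := G1_Pr hP hβ0.le (by linarith)
  let P : ℕ → Prop := fun n => ∃ s : Finset (Euc d), s.card = n ∧ (∀ x ∈ s, gauge (G1 g h β) x = 1) ∧
    ∀ x ∈ s, ∀ y ∈ s, Th h x y (20 * β) → x = y
  have hfin : (KC * (c * C)) ^ d * m ≠ ⊤ := by
    have : KC ≠ ⊤ := by unfold KC; finiteness
    finiteness
  have hbd : ∀ n, P n → n ≤ ⌊((KC * (c * C)) ^ d * m).toReal⌋₊ := by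
    rintro n ⟨s, hs, h1, h2⟩
    have := count_bound hd hV hP ha ha1 hY hc hβ s h1 h2
    rw [hs] at this
    apply Nat.le_floor
    rw [← ENNReal.toReal_natCast]
    exact ENNReal.toReal_mono hfin this
  have hP0 : P 0 := ⟨∅, rfl, by simp, by simp⟩
  obtain ⟨s, hs, h1, h2⟩ := Nat.findGreatest_spec (P := P) (Nat.zero_le ⌊((KC * (c * C)) ^ d * m).toReal⌋₊) hP0
  set n := Nat.findGreatest P ⌊((KC * (c * C)) ^ d * m).toReal⌋₊ with hn
  refine ⟨n, ?_, fun i => (s.equivFin.symm (Fin.cast hs.symm i)).1, ?_, ?_⟩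
  · rw [← hs]; exact count_bound hd hV hP ha ha1 hY hc hβ s h1 h2
  · intro i
    exact hP1.dom (h1 _ (s.equivFin.symm (Fin.cast hs.symm i)).2).le
  · intro x hx
    obtain ⟨x1, hx1, hT⟩ := G1_near hP hβ0 (by linarith) hx
    obtain ⟨y, hy, hxy⟩ : ∃ y ∈ s, Th h x1 y (20 * β) := by
      by_contra hcon
      push Not at hcon
      have hx1s : x1 ∉ s := fun h => hcon x1 h (Th.refl hP.hh (hP1.dom hx1.le) (by linarith))
      have : P (n + 1) := by
        refine ⟨insert x1 s, by rw [Finset.card_insert_of_notMem hx1s, hs], ?_, ?_⟩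
        · intro x hx
          rcases Finset.mem_insert.1 hx with rfl | hx
          · exact hx1
          · exact h1 x hx
        · intro x hx y hy hT'
          rcases Finset.mem_insert.1 hx with rfl | hx2 <;> rcases Finset.mem_insert.1 hy with rfl | hy2
          · rfl
          · exact absurd hT' (hcon y hy2)
          · exact absurd hT'.symm (hcon x hx2)
          · exact h2 x hx2 y hy2 hT'
      have := Nat.le_findGreatest (hbd _ this) this
      omega
    refine ⟨Fin.cast hs (s.equivFin ⟨y, hy⟩), ?_⟩
    have e : (s.equivFin.symm (Fin.cast hs.symm (Fin.cast hs (s.equivFin ⟨y, hy⟩)))) = ⟨y, hy⟩ := by simp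
    beta_reduce
    rw [e]
    exact (hT.symm.trans hxy).mono hP.hh (hP.dom hx.le) (hP1.dom (h1 y hy).le) (by linarith)
end

noncomputable section
variable {d : ℕ} {K G : Set (Euc d)}

lemma Bod.interior_eq_dom (hK : Bod K) : interior K = Dom (gauge (polarSet K)) := by
  have e : interior K = {x | gauge K x < 1} := by
    conv_lhs => rw [← hK.uset_gauge]
    exact hK.sub.interior_eq
  rw [e]
  ext x
  constructor
  · intro hx θ hθ
    have h1 := hK.inner_le x θ
    have h2 := hK.polar.sub.pos θ hθ
    have h3 : gauge K x < 1 := hx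
    nlinarith
  · intro hx
    obtain ⟨θ, hθ, h1⟩ := hK.polar.exists_gauge_polar x
    rw [hK.polar_polar] at h1
    show gauge K x < 1
    by_cases h0 : θ = 0
    · rw [← h1, h0]; simp
    · rw [← h1, real_inner_comm]
      exact (hx θ h0).trans_le (hK.polar.gauge_le_one.2 hθ)

lemma gauge_shift_iff (hK : Bod K) {x y : Euc d} (hx : x ∈ Dom (gauge (polarSet K))) {s : ℝ} (hs : 0 ≤ s) :
    gauge ((fun k => k - x) '' K) (y - x) ≤ s ↔
      ∀ θ, (1 - s) * pp (gauge (polarSet K)) x θ ≤ pp (gauge (polarSet K)) y θ := by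
  set h := gauge (polarSet K) with hh
  have hhs : Subl h := hK.polar.sub
  have key : ∀ θ, pp h x θ - pp h y θ = ⟪y - x, θ⟫ := by
    intro θ; rw [pp, pp, inner_sub_left]; ring
  have habs : Absorbent ℝ ((fun k => k - x) '' K) := by
    apply absorbent_nhds_zero
    rw [← hK.interior_eq_dom] at hx
    have h1 := mem_interior_iff_mem_nhds.1 hx
    have : (fun k => k - x) '' K = (fun z => z + x) ⁻¹' K := by
      ext z; simp [sub_eq_iff_eq_add]
    rw [this]
    apply (continuous_add_const x).continuousAt.preimage_mem_nhds
    simpa using h1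
  constructor
  · intro hg θ
    have hq := pp_nonneg hhs hx θ
    have : ∀ s' > s, ⟪y - x, θ⟫ ≤ s' * pp h x θ := by
      intro s' hs'
      obtain ⟨b, hb0, hb, ⟨_, ⟨k, hk, rfl⟩, ha⟩⟩ := exists_lt_of_gauge_lt habs (hg.trans_lt hs')
      have h1 := hK.inner_le_of_mem hk θ
      have : ⟪y - x, θ⟫ = b * (⟪k, θ⟫ - ⟪x, θ⟫) := by
        rw [← ha]; simp only [real_inner_smul_left, inner_sub_left]
      rw [this]
      have : ⟪k, θ⟫ - ⟪x, θ⟫ ≤ pp h x θ := by rw [pp]; linarith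
      nlinarith
    have h2 : ⟪y - x, θ⟫ ≤ s * pp h x θ := by
      have hcont : Filter.Tendsto (fun s' : ℝ => s' * pp h x θ) (nhdsWithin s (Ioi s)) (nhds (s * pp h x θ)) :=
        ((continuous_id.mul continuous_const).tendsto s).mono_left nhdsWithin_le_nhds
      exact ge_of_tendsto hcont (Filter.eventually_of_mem self_mem_nhdsWithin fun s' hs' => this s' hs')
    have := key θ
    linarith
  · intro hg
    refine le_of_forall_gt_imp_ge_of_dense fun s' hs' => ?_
    have hs0 : 0 < s' := hs.trans_lt hs'
    refine gauge_le_of_mem hs0.le ⟨s'⁻¹ • (y - x), ⟨s'⁻¹ • (y - x) + x, ?_, by simp⟩, ?_⟩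
    · rw [← hK.polar_polar]
      intro θ hθ
      have h1 := hg θ
      have h2 := key θ
      have hq := pp_nonneg hhs hx θ
      have h3 : h θ ≤ 1 := hK.polar.gauge_le_one.2 hθ
      have h4 : ⟪y - x, θ⟫ ≤ s' * pp h x θ := by nlinarith
      rw [real_inner_comm, inner_add_left, real_inner_smul_left]
      have h5 : s'⁻¹ * ⟪y - x, θ⟫ ≤ pp h x θ := by
        rw [inv_mul_le_iff₀ hs0]; exact h4
      rw [pp] at h5
      linarith
    · simp [smul_smul, hs0.ne']

lemma hilbertDist_le (hK : Bod K) {x y : Euc d} (hx : x ∈ Dom (gauge (polarSet K)))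
    (hy : y ∈ Dom (gauge (polarSet K))) {t : ℝ} (ht : 0 ≤ t) (hT : Th (gauge (polarSet K)) x y t) :
    hilbertDist K x y ≤ t := by
  have aux : ∀ {x y : Euc d}, x ∈ Dom (gauge (polarSet K)) → Th (gauge (polarSet K)) x y t →
      Real.exp (-t) ≤ 1 - gauge ((fun k => k - x) '' K) (y - x) := by
    intro x y hx hT
    have := (gauge_shift_iff hK hx (y := y) (s := 1 - Real.exp (-t))
      (by linarith [Real.exp_le_one_iff.2 (neg_nonpos.2 ht)])).2 (fun θ => by
        have h1 := (hT θ).1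
        rw [sub_sub_cancel, Real.exp_neg, inv_mul_le_iff₀ (Real.exp_pos _)]
        exact h1)
    linarith
  have h1 := aux hx hT
  have h2 := aux hy hT.symm
  have h3 := Real.exp_pos (-t)
  have h4 : Real.log (Real.exp (-t) * Real.exp (-t)) ≤ Real.log ((1 - gauge ((fun k => k - x) '' K) (y - x)) *
    (1 - gauge ((fun k => k - y) '' K) (x - y))) :=
    Real.log_le_log (by positivity) (mul_le_mul h1 h2 h3.le (h3.le.trans h1))
  rw [Real.log_mul h3.ne' h3.ne', Real.log_exp] at h4
  rw [hilbertDist]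
  linarith

lemma Th_of_hilbertDist (hK : Bod K) {x y : Euc d} (hx : x ∈ interior K)
    (hy : y ∈ interior K) {t : ℝ} (hD : hilbertDist K x y ≤ t) : Th (gauge (polarSet K)) x y (2 * t) := by
  have aux : ∀ {x y : Euc d}, x ∈ interior K → y ∈ interior K →
      0 ≤ gauge ((fun k => k - x) '' K) (y - x) ∧ 0 < 1 - gauge ((fun k => k - x) '' K) (y - x) := by
    intro x y hx hy
    refine ⟨gauge_nonneg _, ?_⟩
    have : gauge ((fun k => k - x) '' K) (y - x) < 1 := by
      apply interior_subset_gauge_lt_one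
      have : (fun k => k - x) '' K = (Homeomorph.subRight x) '' K := rfl
      rw [this, ← Homeomorph.image_interior]
      exact ⟨y, hy, rfl⟩
    linarith
  obtain ⟨a1, a2⟩ := aux hx hy
  obtain ⟨b1, b2⟩ := aux hy hx
  rw [hilbertDist] at hD
  set a := gauge ((fun k => k - x) '' K) (y - x) with ha
  set b := gauge ((fun k => k - y) '' K) (x - y) with hb
  have hl : -(2 * t) ≤ Real.log ((1 - a) * (1 - b)) := by linarith
  rw [Real.le_log_iff_exp_le (mul_pos a2 b2)] at hl
  have ha' : Real.exp (-(2 * t)) ≤ 1 - a := by nlinarith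
  have hb' : Real.exp (-(2 * t)) ≤ 1 - b := by nlinarith
  have fin : ∀ {x y : Euc d} , x ∈ interior K → y ∈ interior K → Real.exp (-(2 * t)) ≤ 1 - gauge ((fun k => k - x) '' K) (y - x) →
      ∀ θ, pp (gauge (polarSet K)) x θ ≤ Real.exp (2 * t) * pp (gauge (polarSet K)) y θ := by
    intro x y hx hy hle θ
    rw [hK.interior_eq_dom] at hx
    have h1 := (gauge_shift_iff hK hx (y := y) (gauge_nonneg _)).1 le_rfl θ
    have h2 := pp_nonneg hK.polar.sub hx θ
    rw [← inv_mul_le_iff₀ (Real.exp_pos _), ← Real.exp_neg]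
    nlinarith
  exact fun θ => ⟨fin hx hy ha' θ, fin hy hx hb' θ⟩

lemma cov_nonempty (hK : Bod K) {U : Set (Euc d)} (hU : IsCompact U) (hUK : U ⊆ interior K) {α : ℝ} (ha : 0 < α) :
    {m : ℕ | ∃ x : Fin m → Euc d, (∀ i, x i ∈ interior K) ∧ U ⊆ ⋃ i, hilbertBall K (x i) α}.Nonempty := by
  set h := gauge (polarSet K) with hh
  have hhs : Subl h := hK.polar.sub
  set s := min (α / 2) (1 / 2) with hs
  have hs0 : 0 < s := by positivity
  have hnb : ∀ x ∈ U, hilbertBall K x α ∈ nhds x := by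
    intro x hx
    have hxD : x ∈ Dom h := hK.interior_eq_dom ▸ hUK hx
    have hq := (pp_subl hhs hxD)
    have ho : IsOpen {y | gauge (macA (pp h x)) (y - x) < s} :=
      isOpen_lt (hq.macA_bod.sub.continuous.comp (continuous_id.sub continuous_const)) continuous_const
    refine Filter.mem_of_superset (ho.mem_nhds ?_) ?_
    · show gauge (macA (pp h x)) (x - x) < s
      simpa using hs0
    · intro y hy
      have hy' : gauge (macA (pp h x)) (y - x) ≤ s := le_of_lt hy
      have hyD := dom_of_gauge hhs hxD (lt_of_le_of_lt (min_le_right _ _) (by norm_num)) hy'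
      have hT := Th.of_gauge hhs hxD hs0.le (min_le_right _ _) hy'
      refine ⟨hK.interior_eq_dom ▸ hyD, hilbertDist_le hK hxD hyD ha.le ?_⟩
      exact (hT.mono hhs hyD hxD (by linarith [min_le_left (α / 2) (1 / 2)])).symm
  obtain ⟨t, ht, hc⟩ := hU.elim_nhds_subcover _ hnb
  refine ⟨t.card, fun i => (t.equivFin.symm i).1, fun i => hUK (ht _ (t.equivFin.symm i).2), ?_⟩
  refine hc.trans ?_
  intro y hy
  obtain ⟨x, hx, hxy⟩ := mem_iUnion₂.1 hy
  refine mem_iUnion.2 ⟨t.equivFin ⟨x, hx⟩, ?_⟩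
  simpa using hxy

lemma Bod.frontier_eq (hK : Bod K) : frontier K = {x | gauge K x = 1} := by
  conv_lhs => rw [← hK.uset_gauge]
  exact hK.sub.frontier_eq

lemma half (hd : 0 < d) {c C Ω : ℝ≥0∞} (hV : VR d c C Ω) (hcC : c * C ≠ ⊤) (hG : Bod G) (hK : Bod K)
    (hP : Pr (gauge G) (gauge (polarSet K))) {α : ℝ} (ha : 0 < α) (ha1 : α ≤ 1) :
    (hilbertCov K (frontier G) α : ℝ≥0∞) ≤
      (KC * (c * C)) ^ d * (hilbertCov (polarSet G) (frontier (polarSet K)) α : ℝ≥0∞) := by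
  have hne := cov_nonempty (K := polarSet G) (U := frontier (polarSet K)) hG.polar
    (hK.polar.compact.of_isClosed_subset isClosed_frontier hK.polar.compact.isClosed.frontier_subset)
    (by
      rw [hG.polar.interior_eq_dom, hG.polar_polar, hK.polar.frontier_eq]
      intro y hy
      exact hP.symm.dom (le_of_eq hy)) ha
  obtain ⟨Y, hY, hcov⟩ := Nat.sInf_mem hne
  change ∀ i, Y i ∈ interior (polarSet G) at hY
  set m := hilbertCov (polarSet G) (frontier (polarSet K)) α with hm
  obtain ⟨n, hn, X, hX, hXc⟩ := counting hd hV hcC hP ha ha1 (m := m) (Y := Y)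
    (fun i => by have := hY i; rwa [hG.polar.interior_eq_dom, hG.polar_polar] at this)
    (fun y hy => by
      have hy' : y ∈ frontier (polarSet K) := by rw [hK.polar.frontier_eq]; exact hy
      obtain ⟨i, hi⟩ := mem_iUnion.1 (hcov hy')
      refine ⟨i, ?_⟩
      have := Th_of_hilbertDist hG.polar (hY i) hi.1 hi.2
      rw [hG.polar_polar] at this
      exact this.symm)
  refine le_trans ?_ hn
  have : hilbertCov K (frontier G) α ≤ n := by
    apply Nat.sInf_le
    refine ⟨X, fun i => by rw [hK.interior_eq_dom]; exact hX i, ?_⟩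
    rw [hG.frontier_eq]
    intro x hx
    obtain ⟨i, hi⟩ := hXc x hx
    have hxD := hP.dom (le_of_eq hx)
    exact mem_iUnion.2 ⟨i, by rw [hK.interior_eq_dom]; exact hxD, hilbertDist_le hK (hX i) hxD ha.le hi.symm⟩
  exact_mod_cast this

theorem main_of_VR {c C : ℝ≥0∞} (hcC : c * C ≠ ⊤) (hV : ∀ d : ℕ, 0 < d → ∃ Ω, VR d c C Ω) :
    ∃ c : ℝ, 1 ≤ c ∧ ∀ d : ℕ, 2 ≤ d →
      ∀ G K : Set (Euc d), IsConvexBody G → IsConvexBody K →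
        (0 : Euc d) ∈ interior G → G ⊆ interior K →
        ∀ α : ℝ, 0 < α → α ≤ 1 →
          (c ^ d)⁻¹ * (hilbertCov (polarSet G) (frontier (polarSet K)) α : ℝ) ≤
              (hilbertCov K (frontier G) α : ℝ) ∧
          (hilbertCov K (frontier G) α : ℝ) ≤
              c ^ d * (hilbertCov (polarSet G) (frontier (polarSet K)) α : ℝ) := by
  have hKC : KC * (c * C) ≠ ⊤ := by
    have : KC ≠ ⊤ := by unfold KC; finiteness
    finiteness
  set k := max 1 (KC * (c * C)).toReal with hk
  have hk1 : 1 ≤ k := le_max_left _ _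
  have hkE : KC * (c * C) ≤ ENNReal.ofReal k := by
    rw [ENNReal.le_ofReal_iff_toReal_le hKC (by linarith)]; exact le_max_right _ _
  refine ⟨k, hk1, fun d hd G K hG hK h0 hGK α ha ha1 => ?_⟩
  have hGb : Bod G := ⟨hG.1, hG.2.1, h0⟩
  have hKb : Bod K := ⟨hK.1, hK.2.1, interior_mono (hGK.trans interior_subset) h0⟩
  have hP : Pr (gauge G) (gauge (polarSet K)) := by
    refine ⟨hGb.sub, hKb.polar.sub, fun φ θ hφ hθ => ?_⟩
    have h1 : nz (gauge G) φ ∈ G := hGb.gauge_le_one.1 (g_nz hGb.sub hφ).le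
    have h2 := hGK h1
    rw [hKb.interior_eq_dom] at h2
    have h3 := h2 θ hθ
    have h4 := hGb.sub.pos φ hφ
    rw [nz, real_inner_smul_left, inv_mul_lt_iff₀ h4] at h3
    exact h3
  obtain ⟨Ω, hVR⟩ := hV d (by omega)
  have r : ∀ a b : ℕ, (a : ℝ≥0∞) ≤ (KC * (c * C)) ^ d * (b : ℝ≥0∞) → (a : ℝ) ≤ k ^ d * b := by
    intro a b hab
    have h1 : (a : ℝ≥0∞) ≤ ENNReal.ofReal (k ^ d * b) := by
      rw [ENNReal.ofReal_mul (by positivity), ENNReal.ofReal_pow (by positivity), ENNReal.ofReal_natCast]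
      exact hab.trans (mul_le_mul' (pow_le_pow_left' hkE d) le_rfl)
    rw [← ENNReal.ofReal_natCast] at h1
    exact (ENNReal.ofReal_le_ofReal_iff (by positivity)).1 h1
  have h1 := half (by omega) hVR hcC hGb hKb hP ha ha1
  have h2 := half (G := polarSet K) (K := polarSet G) (by omega) hVR hcC hKb.polar hGb.polar
    (by rw [hGb.polar_polar]; exact hP.symm) ha ha1
  rw [hGb.polar_polar, hKb.polar_polar] at h2
  refine ⟨?_, r _ _ h1⟩
  rw [inv_mul_le_iff₀ (by positivity)]
  exact r _ _ h2
end

noncomputable section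

lemma holo_integral {X : Type*} [TopologicalSpace X] [MetrizableSpaceX : TopologicalSpace.PseudoMetrizableSpace X]
    [MeasurableSpace X] [OpensMeasurableSpace X] [SecondCountableTopology X] [LocallyCompactSpace X]
    {μ : Measure X} {S : Set X} (hS : IsCompact S) (hSm : MeasurableSet S) (hμ : μ S < ⊤)
    {H : ℂ → X → ℂ} (hc : Continuous (Function.uncurry H))
    (hd : ∀ x, Differentiable ℂ fun τ => H τ x) :
    Differentiable ℂ fun τ => ∫ x in S, H τ x ∂μ := by
  intro τ₀
  have hcx : ∀ τ, Continuous (H τ) := fun τ => hc.comp (Continuous.prodMk_right τ)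
  obtain ⟨C, hC⟩ : ∃ C, ∀ p ∈ (closedBall τ₀ 2 ×ˢ S), ‖Function.uncurry H p‖ ≤ C :=
    ((isCompact_closedBall τ₀ 2).prod hS).exists_bound_of_continuousOn hc.continuousOn
  haveI : IsFiniteMeasure (μ.restrict S) := ⟨by simpa using hμ⟩
  have key := hasDerivAt_integral_of_dominated_loc_of_deriv_le (𝕜 := ℂ) (μ := μ.restrict S)
    (F := H) (F' := fun τ x => deriv (fun t => H t x) τ) (x₀ := τ₀) (bound := fun _ => C / 1)
    (ball_mem_nhds τ₀ one_pos)
    (Filter.Eventually.of_forall fun τ => (hcx τ).aestronglyMeasurable)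
    ?_ ?_ ?_ (integrable_const _) ?_
  · exact key.2.differentiableAt
  · refine Integrable.of_bound (hcx τ₀).aestronglyMeasurable C ?_
    filter_upwards [ae_restrict_mem hSm] with x hx
    exact hC (τ₀, x) ⟨mem_closedBall_self (by norm_num), hx⟩
  · have h := measurable_deriv_with_param (𝕜 := ℂ) (f := fun (x : X) (t : ℂ) => H t x)
      (hc.comp continuous_swap)
    exact (h.comp (measurable_id.prodMk measurable_const)).aestronglyMeasurable
  · filter_upwards [ae_restrict_mem hSm] with x hx
    intro τ hτ
    refine Complex.norm_deriv_le_of_forall_mem_sphere_norm_le one_pos (hd x).diffContOnCl ?_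
    intro z hz
    refine hC (z, x) ⟨?_, hx⟩
    have h1 := mem_sphere.1 hz
    have h2 := mem_ball.1 hτ
    have h3 := dist_triangle z τ τ₀
    simp only [mem_closedBall]; linarith
  · exact Filter.Eventually.of_forall fun x τ _ => (hd x τ).hasDerivAt

end

noncomputable section

lemma planch_aux {n : ℕ} {ε : ℝ} (hε : 0 < ε) (x x' : Euc n) (a b : ℝ) {M : ℝ} (hM : 0 ≤ M)
    (ha : |a| ≤ M) (hb : |b| ≤ M) :
    ‖∫ ξ : Euc n, Complex.exp (-(ε : ℂ) * ‖ξ‖ ^ 2) *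
      ((a * Complex.exp (Complex.I * ⟪x, ξ⟫)) * (b * Complex.exp (-(Complex.I * ⟪x', ξ⟫))))‖
    ≤ M ^ 2 * ((Real.pi / ε) ^ (n / 2 : ℝ) * Real.exp (-(1 / (4 * ε)) * ‖x - x'‖ ^ 2)) := by
  have h1 : ∀ ξ : Euc n, Complex.exp (-(ε : ℂ) * ‖ξ‖ ^ 2) *
      ((a * Complex.exp (Complex.I * ⟪x, ξ⟫)) * (b * Complex.exp (-(Complex.I * ⟪x', ξ⟫)))) =
      ((a * b : ℝ) : ℂ) * Complex.exp (-(ε : ℂ) * ‖ξ‖ ^ 2 + Complex.I * ⟪x - x', ξ⟫) := by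
    intro ξ
    rw [inner_sub_left, Complex.exp_add]
    push_cast
    rw [mul_sub, sub_eq_add_neg, Complex.exp_add]
    ring
  simp_rw [h1]
  rw [integral_const_mul, GaussianFourier.integral_cexp_neg_mul_sq_norm_add (by simpa using hε)]
  have h2 : Complex.I ^ 2 * (‖x - x'‖ : ℂ) ^ 2 / (4 * (ε : ℂ)) =
      ((-(1 / (4 * ε)) * ‖x - x'‖ ^ 2 : ℝ) : ℂ) := by
    rw [Complex.I_sq]; push_cast; ring
  have h3 : ((Real.pi : ℂ) / (ε : ℂ)) ^ ((Module.finrank ℝ (Euc n) : ℂ) / 2) =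
      (((Real.pi / ε) ^ (n / 2 : ℝ) : ℝ) : ℂ) := by
    rw [Complex.ofReal_cpow (by positivity)]
    simp
  rw [h2, h3, ← Complex.ofReal_exp, ← Complex.ofReal_mul, ← Complex.ofReal_mul, Complex.norm_real,
    Real.norm_eq_abs, abs_mul, abs_mul]
  have h4 : |a| * |b| ≤ M ^ 2 := by
    rw [sq]; exact mul_le_mul ha hb (abs_nonneg _) hM
  rw [abs_of_nonneg (by positivity : 0 ≤ (Real.pi / ε) ^ (n / 2 : ℝ) * Real.exp (-(1 / (4 * ε)) * ‖x - x'‖ ^ 2))]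
  exact mul_le_mul_of_nonneg_right h4 (by positivity)

lemma planch {n : ℕ} {K : Set (Euc n)} (hK : IsCompact K) {h : Euc n → ℝ} (hh : Continuous h)
    {M : ℝ} (hM : 0 ≤ M) (hhM : ∀ x ∈ K, |h x| ≤ M) {ε : ℝ} (hε : 0 < ε) :
    ∫⁻ ξ : Euc n, ENNReal.ofReal (Real.exp (-ε * ‖ξ‖ ^ 2) *
      ‖∫ x in K, (h x : ℂ) * Complex.exp (Complex.I * ⟪x, ξ⟫)‖ ^ 2) ≤
    ENNReal.ofReal (M ^ 2 * (2 * Real.pi) ^ n) * volume K := by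
  have hKm := hK.measurableSet
  set ν := (volume : Measure (Euc n)).restrict K with hν
  have hfin : IsFiniteMeasure ν := ⟨by simpa [hν] using hK.measure_lt_top⟩
  set P : Euc n → Euc n → ℂ := fun ξ x => (h x : ℂ) * Complex.exp (Complex.I * ⟪x, ξ⟫) with hP
  set Q : Euc n → Euc n → ℂ := fun ξ x => (h x : ℂ) * Complex.exp (-(Complex.I * ⟪x, ξ⟫)) with hQ
  have hconj : ∀ ξ x, (starRingEnd ℂ) (P ξ x) = Q ξ x := by
    intro ξ x
    simp only [hP, hQ, map_mul, Complex.conj_ofReal, ← Complex.exp_conj, Complex.conj_I]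
    ring_nf
  have hPn : ∀ ξ x, ‖P ξ x‖ = |h x| := by
    intro ξ x
    simp only [hP, norm_mul, Complex.norm_real, Real.norm_eq_abs]
    rw [mul_comm Complex.I, Complex.norm_exp_ofReal_mul_I, mul_one]
  have hQn : ∀ ξ x, ‖Q ξ x‖ = |h x| := by
    intro ξ x
    rw [← hconj, RCLike.norm_conj, hPn]
  set Φ : Euc n → ℂ := fun ξ => ∫ x, P ξ x ∂ν with hΦ
  set g : Euc n → ℂ := fun ξ => Complex.exp (-(ε : ℂ) * ‖ξ‖ ^ 2) with hg
  have hgr : ∀ ξ, g ξ = ((Real.exp (-ε * ‖ξ‖ ^ 2) : ℝ) : ℂ) := by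
    intro ξ; simp [hg]
  have hgi : Integrable g := by
    have := GaussianFourier.integrable_cexp_neg_mul_sq_norm_add (b := (ε : ℂ)) (V := Euc n)
      (by simpa using hε) 0 0
    simpa [hg] using this
  have hsq : ∀ ξ, ((‖Φ ξ‖ ^ 2 : ℝ) : ℂ) = ∫ p, P ξ p.1 * Q ξ p.2 ∂(ν.prod ν) := by
    intro ξ
    rw [integral_prod_mul]
    simp_rw [← hconj]
    rw [integral_conj, Complex.mul_conj, Complex.normSq_eq_norm_sq]
  set f : Euc n → Euc n × Euc n → ℂ := fun ξ p => g ξ * (P ξ p.1 * Q ξ p.2) with hf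
  have hcontf : Continuous (Function.uncurry f) := by
    simp only [hf, hg, hP, hQ, Function.uncurry_def]; fun_prop
  have hKK : ∀ᵐ p ∂(ν.prod ν), p ∈ K ×ˢ K := by
    rw [hν, Measure.prod_restrict]
    exact ae_restrict_mem (hKm.prod hKm)
  have hfi : Integrable (Function.uncurry f) ((volume : Measure (Euc n)).prod (ν.prod ν)) := by
    refine (hgi.mul_prod (integrable_const ((M ^ 2 : ℝ) : ℂ))).mono hcontf.aestronglyMeasurable ?_
    have h2 : ∀ᵐ q ∂((volume : Measure (Euc n)).prod (ν.prod ν)), q.2 ∈ K ×ˢ K :=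
      Measure.quasiMeasurePreserving_snd.ae hKK
    filter_upwards [h2] with q hq
    simp only [Function.uncurry, hf, norm_mul, hPn, hQn, Complex.norm_real, Real.norm_eq_abs]
    refine mul_le_mul_of_nonneg_left ?_ (norm_nonneg _)
    rw [abs_of_nonneg (sq_nonneg M), sq]
    exact mul_le_mul (hhM _ hq.1) (hhM _ hq.2) (abs_nonneg _) hM
  have hEq : ∀ ξ, ((Real.exp (-ε * ‖ξ‖ ^ 2) * ‖Φ ξ‖ ^ 2 : ℝ) : ℂ) = ∫ p, f ξ p ∂(ν.prod ν) := by
    intro ξ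
    rw [Complex.ofReal_mul, hsq, ← hgr, ← integral_const_mul]
  have hint : Integrable fun ξ => Real.exp (-ε * ‖ξ‖ ^ 2) * ‖Φ ξ‖ ^ 2 := by
    have := hfi.integral_prod_left
    have h2 : Integrable fun ξ => ((Real.exp (-ε * ‖ξ‖ ^ 2) * ‖Φ ξ‖ ^ 2 : ℝ) : ℂ) := by
      refine this.congr (Filter.Eventually.of_forall fun ξ => ?_)
      simp only [hEq]; rfl
    have h3 := h2.re
    simpa only [RCLike.ofReal_re, Complex.coe_algebraMap, RCLike.re_to_complex, Complex.ofReal_re] using h3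
  rw [← ofReal_integral_eq_lintegral_ofReal hint (Filter.Eventually.of_forall fun ξ => by positivity)]
  rw [← ENNReal.ofReal_toReal hK.measure_lt_top.ne, ← ENNReal.ofReal_mul (by positivity)]
  apply ENNReal.ofReal_le_ofReal
  set c : ℝ := (Real.pi / ε) ^ (n / 2 : ℝ) with hc
  have hc0 : 0 ≤ c := by positivity
  set b : ℝ := 1 / (4 * ε) with hb
  have hb0 : 0 < b := by positivity
  have hGi : Integrable fun v : Euc n => Real.exp (-b * ‖v‖ ^ 2) := by
    have h2 := GaussianFourier.integrable_cexp_neg_mul_sq_norm_add (b := (b : ℂ)) (V := Euc n)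
      (by simpa using hb0) 0 0
    have h3 := h2.re
    refine h3.congr (Filter.Eventually.of_forall fun v => ?_)
    have : (-(b : ℂ) * (‖v‖ : ℂ) ^ 2 + 0 * ((⟪(0 : Euc n), v⟫ : ℝ) : ℂ)) = ((-b * ‖v‖ ^ 2 : ℝ) : ℂ) := by
      push_cast; ring
    simp only [this, ← Complex.ofReal_exp, RCLike.re_to_complex, Complex.ofReal_re]
  have hup : Integrable (fun p : Euc n × Euc n => M ^ 2 * (c * Real.exp (-b * ‖p.1 - p.2‖ ^ 2)))
      (ν.prod ν) := by
    refine Integrable.of_bound (Continuous.aestronglyMeasurable (by fun_prop)) (M ^ 2 * (c * 1)) ?_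
    refine Filter.Eventually.of_forall fun p => ?_
    rw [Real.norm_eq_abs, abs_of_nonneg (by positivity)]
    have : Real.exp (-b * ‖p.1 - p.2‖ ^ 2) ≤ 1 := Real.exp_le_one_iff.2 (by nlinarith [sq_nonneg ‖p.1 - p.2‖])
    gcongr
  calc ∫ ξ, Real.exp (-ε * ‖ξ‖ ^ 2) * ‖Φ ξ‖ ^ 2
      ≤ ‖((∫ ξ, Real.exp (-ε * ‖ξ‖ ^ 2) * ‖Φ ξ‖ ^ 2 : ℝ) : ℂ)‖ := by
        rw [Complex.norm_real]; exact Real.le_norm_self _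
    _ = ‖∫ p, (∫ ξ, f ξ p) ∂(ν.prod ν)‖ := by
        rw [← integral_integral_swap hfi, ← integral_complex_ofReal]
        simp_rw [hEq]
    _ ≤ ∫ p : Euc n × Euc n, M ^ 2 * (c * Real.exp (-b * ‖p.1 - p.2‖ ^ 2)) ∂(ν.prod ν) := by
        refine norm_integral_le_of_norm_le hup ?_
        filter_upwards [hKK] with p hp
        exact planch_aux hε p.1 p.2 _ _ hM (hhM _ hp.1) (hhM _ hp.2)
    _ = ∫ x, ∫ x', M ^ 2 * (c * Real.exp (-b * ‖x - x'‖ ^ 2)) ∂ν ∂ν := integral_prod _ hup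
    _ ≤ ∫ x : Euc n, M ^ 2 * (2 * Real.pi) ^ n ∂ν := by
        refine integral_mono hup.integral_prod_left (integrable_const _) fun x => ?_
        simp only [integral_const_mul]
        refine mul_le_mul_of_nonneg_left ?_ (by positivity)
        have h5 : ∫ x', Real.exp (-b * ‖x - x'‖ ^ 2) ∂ν ≤ ∫ x' : Euc n, Real.exp (-b * ‖x - x'‖ ^ 2) := by
          refine setIntegral_le_integral ?_ (Filter.Eventually.of_forall fun x' => by positivity)
          exact hGi.comp_sub_left x
        rw [integral_sub_left_eq_self (fun v : Euc n => Real.exp (-b * ‖v‖ ^ 2)) volume x,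
          GaussianFourier.integral_rexp_neg_mul_sq_norm hb0] at h5
        refine (mul_le_mul_of_nonneg_left h5 hc0).trans (le_of_eq ?_)
        rw [finrank_euclideanSpace, Fintype.card_fin, hc, ← Real.mul_rpow (by positivity) (by positivity)]
        have : Real.pi / ε * (Real.pi / b) = (2 * Real.pi) ^ 2 := by
          rw [hb]; field_simp; ring
        rw [this, ← Real.rpow_natCast, ← Real.rpow_mul (by positivity),
          ← Real.rpow_natCast]
        congr 1; push_cast; ring
    _ = M ^ 2 * (2 * Real.pi) ^ n * (volume K).toReal := by
        rw [integral_const, smul_eq_mul, mul_comm]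
        simp [hν, Measure.real]
end

noncomputable section

/-- Rotation mixing the two factors. -/
def rotL (n : ℕ) (θ : ℝ) : (Euc n × Euc n) →ₗ[ℝ] (Euc n × Euc n) :=
  LinearMap.prod (Real.cos θ • LinearMap.fst ℝ _ _ - Real.sin θ • LinearMap.snd ℝ _ _)
    (Real.sin θ • LinearMap.fst ℝ _ _ + Real.cos θ • LinearMap.snd ℝ _ _)

lemma rotL_apply (n : ℕ) (θ : ℝ) (w : Euc n × Euc n) : rotL n θ w =
    (Real.cos θ • w.1 - Real.sin θ • w.2, Real.sin θ • w.1 + Real.cos θ • w.2) := rfl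

lemma rotL_det (n : ℕ) (θ : ℝ) : |LinearMap.det (rotL n θ)| = 1 := by
  set J : (Euc n × Euc n) →ₗ[ℝ] (Euc n × Euc n) :=
    LinearMap.prod (LinearMap.fst ℝ _ _) (- LinearMap.snd ℝ _ _) with hJ
  have e1 : (J ∘ₗ rotL n θ) ∘ₗ (J ∘ₗ rotL n θ) = LinearMap.id := by
    refine LinearMap.ext fun w => ?_
    have hcs := Real.sin_sq_add_cos_sq θ
    have : Real.cos θ * Real.cos θ + Real.sin θ * Real.sin θ = 1 := by nlinarith
    ext1
    · simp only [hJ, LinearMap.comp_apply, LinearMap.prod_apply, rotL_apply, Function.prod_apply, LinearMap.fst_apply,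
        LinearMap.neg_apply, LinearMap.snd_apply, LinearMap.id_apply]
      calc _ = (Real.cos θ * Real.cos θ + Real.sin θ * Real.sin θ) • w.1 := by module
        _ = _ := by rw [this, one_smul]
    · simp only [hJ, LinearMap.comp_apply, LinearMap.prod_apply, rotL_apply, Function.prod_apply, LinearMap.fst_apply,
        LinearMap.neg_apply, LinearMap.snd_apply, LinearMap.id_apply]
      calc _ = (Real.cos θ * Real.cos θ + Real.sin θ * Real.sin θ) • w.2 := by module
        _ = _ := by rw [this, one_smul]
  have e2 : J ∘ₗ J = LinearMap.id := by
    refine LinearMap.ext fun w => ?_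
    ext1 <;> simp [hJ]
  have d1 := congrArg LinearMap.det e1
  have d2 := congrArg LinearMap.det e2
  simp only [LinearMap.det_comp, LinearMap.det_id] at d1 d2
  have : LinearMap.det (rotL n θ) ^ 2 = 1 := by
    linear_combination d1 - (LinearMap.det (rotL n θ)) ^ 2 * d2
  rw [← sq_abs] at this
  nlinarith [abs_nonneg (LinearMap.det (rotL n θ))]

instance volProdHaar {n : ℕ} : (volume : Measure (Euc n × Euc n)).IsAddHaarMeasure := by
  rw [Measure.volume_eq_prod]; infer_instance

lemma rotL_mp (n : ℕ) (θ : ℝ) : MeasurePreserving (rotL n θ) := by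
  have hd := rotL_det n θ
  have h0 : LinearMap.det (rotL n θ) ≠ 0 := by
    intro h; rw [h] at hd; simp at hd
  refine ⟨(LinearMap.continuous_of_finiteDimensional _).measurable, ?_⟩
  rw [Measure.map_linearMap_addHaar_eq_smul_addHaar _ h0, abs_inv, hd]
  simp

/-- Fourier-Laplace transform of the indicator of `K`. -/
def FL {n : ℕ} (K : Set (Euc n)) (w : Euc n × Euc n) : ℂ :=
  ∫ x in K, Complex.exp ((⟪x, w.1⟫ : ℝ) + Complex.I * (⟪x, w.2⟫ : ℝ))

lemma FL_continuous {n : ℕ} {K : Set (Euc n)} (hK : IsCompact K) : Continuous (FL K) := by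
  unfold FL
  refine continuous_parametric_integral_of_continuous ?_ hK
  simp only [Function.uncurry_def]; fun_prop

lemma FL_mean {n : ℕ} {K : Set (Euc n)} (hK : IsCompact K) (w : Euc n × Euc n) :
    ENNReal.ofReal (2 * Real.pi) * volume K ^ 2 ≤
      ∫⁻ θ in Ioc 0 (2 * Real.pi), ENNReal.ofReal (‖FL K (rotL n θ w)‖ ^ 2) := by
  set G : ℂ → ℂ := fun l => ∫ x in K, Complex.exp (l * ((⟪x, w.1⟫ : ℝ) + Complex.I * (⟪x, w.2⟫ : ℝ))) with hG
  have hGd : Differentiable ℂ G := by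
    refine holo_integral hK hK.measurableSet hK.measure_lt_top ?_ fun x => ?_
    · simp only [Function.uncurry_def]; fun_prop
    · fun_prop
  have h0 : G 0 = (volume K).toReal := by simp [hG, Measure.real]
  have h1 : ∀ θ : ℝ, G (circleMap 0 1 θ) = FL K (rotL n θ w) := by
    intro θ
    simp only [hG, FL, rotL_apply]
    congr 1; ext x
    congr 1
    rw [circleMap_zero, Complex.ofReal_one, one_mul, Complex.exp_mul_I]
    simp only [inner_sub_right, inner_add_right, inner_smul_right]
    push_cast
    linear_combination (Complex.sin θ * (⟪x, w.2⟫ : ℝ)) * Complex.I_sq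
  have h2 := (hGd.pow 2).diffContOnCl.circleAverage (c := 0) (R := 1)
  rw [Real.circleAverage_def] at h2
  simp only [Pi.pow_apply, h1, h0] at h2
  have hcont : Continuous fun θ : ℝ => FL K (rotL n θ w) := by
    refine (FL_continuous hK).comp ?_
    simp only [rotL_apply]; fun_prop
  have h3 : 2 * Real.pi * (volume K).toReal ^ 2 ≤ ∫ θ in Ioc 0 (2 * Real.pi), ‖FL K (rotL n θ w)‖ ^ 2 := by
    have h4 : ((2 * Real.pi * (volume K).toReal ^ 2 : ℝ) : ℂ) = ∫ (θ : ℝ) in 0..2 * Real.pi, FL K (rotL n θ w) ^ 2 := by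
      have hpi : ((2 * Real.pi : ℝ)) ≠ 0 := by positivity
      rw [inv_smul_eq_iff₀ hpi] at h2
      rw [h2]; push_cast; simp
    have h5 := congrArg norm h4
    rw [Complex.norm_real, Real.norm_eq_abs, abs_of_nonneg (by positivity)] at h5
    rw [h5, intervalIntegral.integral_of_le (by positivity)]
    refine (norm_integral_le_integral_norm _).trans (le_of_eq ?_)
    simp
  have h6 : Integrable (fun θ : ℝ => ‖FL K (rotL n θ w)‖ ^ 2) (volume.restrict (Ioc 0 (2 * Real.pi))) := by
    have : Continuous fun θ : ℝ => ‖FL K (rotL n θ w)‖ ^ 2 := by fun_prop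
    exact (this.integrableOn_Icc).mono_set Ioc_subset_Icc_self
  rw [← ofReal_integral_eq_lintegral_ofReal h6 (Filter.Eventually.of_forall fun _ => by positivity)]
  refine le_trans (le_of_eq ?_) (ENNReal.ofReal_le_ofReal h3)
  rw [ENNReal.ofReal_mul (p := 2 * Real.pi) (by positivity), ENNReal.ofReal_pow (by positivity), ENNReal.ofReal_toReal hK.measure_lt_top.ne]

lemma FL_double {n : ℕ} {K D0 D1 : Set (Euc n)} (hK : IsCompact K) (h0 : MeasurableSet D0)
    (h1 : MeasurableSet D1) (h01 : ∀ θ, ∀ w ∈ D0 ×ˢ D0, rotL n θ w ∈ D1 ×ˢ D1) :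
    volume K ^ 2 * volume D0 ^ 2 ≤ ∫⁻ w in D1 ×ˢ D1, ENNReal.ofReal (‖FL K w‖ ^ 2) := by
  set I := ∫⁻ w in D1 ×ˢ D1, ENNReal.ofReal (‖FL K w‖ ^ 2) with hI
  have hFc := FL_continuous hK
  have hgm : Measurable fun w => ENNReal.ofReal (‖FL K w‖ ^ 2) := by
    have : Continuous fun w => ‖FL K w‖ ^ 2 := by fun_prop
    exact this.measurable.ennreal_ofReal
  have hb : ∀ θ, ∫⁻ w in D0 ×ˢ D0, ENNReal.ofReal (‖FL K (rotL n θ w)‖ ^ 2) ≤ I := by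
    intro θ
    rw [hI, ← lintegral_indicator (h1.prod h1), ← (rotL_mp n θ).lintegral_comp (hgm.indicator (h1.prod h1))]
    refine le_trans ?_ (setLIntegral_le_lintegral (D0 ×ˢ D0) _)
    refine setLIntegral_mono_ae' (h0.prod h0) (Filter.Eventually.of_forall fun w hw => ?_)
    rw [indicator_of_mem (h01 θ w hw)]
  have hpi : ENNReal.ofReal (2 * Real.pi) ≠ 0 := by
    simp only [ne_eq, ENNReal.ofReal_eq_zero, not_le]; positivity
  refine (ENNReal.mul_le_mul_iff_right hpi ENNReal.ofReal_ne_top).1 ?_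
  calc ENNReal.ofReal (2 * Real.pi) * (volume K ^ 2 * volume D0 ^ 2)
      = ∫⁻ w in D0 ×ˢ D0, ENNReal.ofReal (2 * Real.pi) * volume K ^ 2 := by
        rw [setLIntegral_const, Measure.volume_eq_prod, Measure.prod_prod]; ring
    _ ≤ ∫⁻ w in D0 ×ˢ D0, ∫⁻ θ in Ioc 0 (2 * Real.pi), ENNReal.ofReal (‖FL K (rotL n θ w)‖ ^ 2) :=
        lintegral_mono fun w => FL_mean hK w
    _ = ∫⁻ θ in Ioc 0 (2 * Real.pi), ∫⁻ w in D0 ×ˢ D0, ENNReal.ofReal (‖FL K (rotL n θ w)‖ ^ 2) := by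
        refine lintegral_lintegral_swap ?_
        have : Continuous fun p : (Euc n × Euc n) × ℝ => rotL n p.2 p.1 := by
          simp only [rotL_apply]; fun_prop
        exact (hgm.comp this.measurable).aemeasurable
    _ ≤ ∫⁻ θ in Ioc 0 (2 * Real.pi), I := lintegral_mono fun θ => hb θ
    _ = ENNReal.ofReal (2 * Real.pi) * I := by
        rw [setLIntegral_const, Real.volume_Ioc, sub_zero, mul_comm]

lemma Bod.neg_smul_mem {n : ℕ} {L : Set (Euc n)} (hL : Bod L) (hs : ∀ v ∈ L, -v ∈ L) {c a b : ℝ}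
    (ha : |a| ≤ 1) (hb : |b| ≤ 1) {v w : Euc n} (hc : 0 ≤ c) (hv : v ∈ (c / 2) • L) (hw : w ∈ (c / 2) • L) :
    a • v + b • w ∈ c • L := by
  obtain ⟨v, hv, rfl⟩ := hv
  obtain ⟨w, hw, rfl⟩ := hw
  have key : ∀ t : ℝ, |t| ≤ 1 → ∀ v ∈ L, t • v ∈ L := by
    intro t ht v hv
    have h1 := hL.convex hv (hs v hv) (a := (1 + t) / 2) (b := (1 - t) / 2)
      (by linarith [(abs_le.1 ht).1]) (by linarith [(abs_le.1 ht).2]) (by ring)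
    convert h1 using 1; module
  refine ⟨(1 / 2 : ℝ) • (a • v) + (1 / 2 : ℝ) • (b • w),
    hL.convex (key a ha v hv) (key b hb w hw) (by norm_num) (by norm_num) (by norm_num), ?_⟩
  simp only; module

theorem santalo {n : ℕ} (hn : 0 < n) {A : Set (Euc n)} (hA : Bod A) (hs : ∀ v ∈ A, -v ∈ A) :
    volume A * volume (polarSet A) ≤
      (ENNReal.ofReal (16 * Real.pi * Real.exp 2)) ^ n * ((n : ℝ≥0∞) ^ n)⁻¹ := by
  set L := polarSet A with hL
  have hLB : Bod L := hA.polar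
  have hLs : ∀ v ∈ L, -v ∈ L := by
    intro v hv x hx
    have := hv (-x) (hs x hx)
    simpa using this
  have hn0 : (0 : ℝ) < n := by exact_mod_cast hn
  set D0 := ((n : ℝ) / 2) • L with hD0
  set D1 := (n : ℝ) • L with hD1
  have hB0 : Bod D0 := hLB.smul (by positivity)
  have hB1 : Bod D1 := hLB.smul hn0
  have h1 := FL_double hA.compact (D0 := D0) (D1 := D1) hB0.compact.measurableSet hB1.compact.measurableSet ?_
  swap
  · rintro θ w ⟨hw1, hw2⟩
    rw [rotL_apply]
    refine ⟨?_, hLB.neg_smul_mem hLs (Real.abs_sin_le_one θ) (Real.abs_cos_le_one θ) hn0.le hw1 hw2⟩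
    have := hLB.neg_smul_mem hLs (a := Real.cos θ) (b := -Real.sin θ) (Real.abs_cos_le_one θ)
      (by rw [abs_neg]; exact Real.abs_sin_le_one θ) hn0.le hw1 hw2
    simp only
    convert this using 1; module
  obtain ⟨R, hR0, hR⟩ := hB1.exists_bound
  have hlog : 0 < Real.log 2 := Real.log_pos (by norm_num)
  set ε := Real.log 2 / R ^ 2 with hε
  have hε0 : 0 < ε := by positivity
  have h2 : ∀ y ∈ D1, ∫⁻ ξ in D1, ENNReal.ofReal (‖FL A (y, ξ)‖ ^ 2) ≤
      2 * (ENNReal.ofReal ((Real.exp n) ^ 2 * (2 * Real.pi) ^ n) * volume A) := by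
    intro y hy
    have hy' : ∀ x ∈ A, ⟪x, y⟫ ≤ n := by
      obtain ⟨z, hz, rfl⟩ := hy
      intro x hx
      have := hz x hx
      simp only [inner_smul_right]
      nlinarith
    have hp := planch hA.compact (h := fun x => Real.exp ⟪x, y⟫) (by fun_prop) (M := Real.exp n) (by positivity)
      (fun x hx => by rw [abs_of_pos (Real.exp_pos _)]; exact Real.exp_le_exp.2 (hy' x hx)) hε0
    have hF : ∀ ξ, FL A (y, ξ) = ∫ x in A, ((Real.exp ⟪x, y⟫ : ℝ) : ℂ) * Complex.exp (Complex.I * ⟪x, ξ⟫) := by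
      intro ξ
      simp only [FL, Complex.exp_add, Complex.ofReal_exp]
    simp_rw [← hF] at hp
    refine le_trans ?_ (mul_le_mul' le_rfl hp)
    rw [← lintegral_const_mul']
    · refine le_trans ?_ (setLIntegral_le_lintegral D1 _)
      refine setLIntegral_mono_ae' hB1.compact.measurableSet (Filter.Eventually.of_forall fun ξ hξ => ?_)
      have : (2 : ℝ≥0∞) = ENNReal.ofReal 2 := by simp
      refine le_trans ?_ (mul_le_mul' this.ge le_rfl)
      rw [← ENNReal.ofReal_mul (by norm_num)]
      apply ENNReal.ofReal_le_ofReal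
      have h3 : 1 / 2 ≤ Real.exp (-ε * ‖ξ‖ ^ 2) := by
        have h4 : ‖ξ‖ ≤ R := by simpa using hR hξ
        have h5 : ‖ξ‖ ^ 2 ≤ R ^ 2 := by gcongr
        have h6 : ε * ‖ξ‖ ^ 2 ≤ Real.log 2 := by
          calc ε * ‖ξ‖ ^ 2 ≤ ε * R ^ 2 := by gcongr
            _ = Real.log 2 := by rw [hε]; field_simp
        calc (1 / 2 : ℝ) = Real.exp (- Real.log 2) := by rw [Real.exp_neg, Real.exp_log (by norm_num)]; norm_num
          _ ≤ _ := Real.exp_le_exp.2 (by linarith)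
      nlinarith [sq_nonneg ‖FL A (y, ξ)‖]
    · simp
  have hFc := FL_continuous hA.compact
  have hgm : Measurable fun w => ENNReal.ofReal (‖FL A w‖ ^ 2) := by
    have : Continuous fun w => ‖FL A w‖ ^ 2 := by fun_prop
    exact this.measurable.ennreal_ofReal
  have h3 : volume A ^ 2 * volume D0 ^ 2 ≤
      2 * (ENNReal.ofReal ((Real.exp n) ^ 2 * (2 * Real.pi) ^ n) * volume A) * volume D1 := by
    refine h1.trans ?_
    rw [Measure.volume_eq_prod, setLIntegral_prod _ hgm.aemeasurable]
    refine (setLIntegral_mono_ae' hB1.compact.measurableSet (Filter.Eventually.of_forall h2)).trans ?_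
    rw [setLIntegral_const]
  rw [hD0, hD1, vol_smul (by positivity), vol_smul hn0.le] at h3
  have ha := hA.vol_lt_top
  have hl := hLB.vol_lt_top
  have ha0 := ENNReal.toReal_pos hA.vol_pos.ne' ha.ne
  have hl0 := ENNReal.toReal_pos hLB.vol_pos.ne' hl.ne
  set a := (volume A).toReal with haa
  set l := (volume L).toReal with hll
  rw [← ENNReal.ofReal_toReal ha.ne, ← ENNReal.ofReal_toReal hl.ne] at h3 ⊢
  rw [← haa, ← hll] at h3 ⊢
  have h2' : (2 : ℝ≥0∞) = ENNReal.ofReal 2 := by simp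
  rw [h2'] at h3
  rw [← ENNReal.ofReal_pow (by positivity), ← ENNReal.ofReal_pow (by positivity), ← ENNReal.ofReal_pow (by positivity),
    ← ENNReal.ofReal_mul (by positivity), ← ENNReal.ofReal_mul (by positivity), ← ENNReal.ofReal_pow (by positivity),
    ← ENNReal.ofReal_mul (by positivity), ← ENNReal.ofReal_mul (by positivity), ← ENNReal.ofReal_mul (by positivity),
    ← ENNReal.ofReal_mul (by positivity),
    ENNReal.ofReal_le_ofReal_iff (by positivity)] at h3
  have h4 : a * l * (n : ℝ) ^ n ≤ 2 * (8 * Real.pi * Real.exp 2) ^ n := by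
    have e1 : Real.exp n ^ 2 = Real.exp 2 ^ n := by
      rw [← Real.exp_nat_mul, ← Real.exp_nat_mul]; congr 1; push_cast; ring
    have e2 : (8 * Real.pi * Real.exp 2) ^ n = 4 ^ n * (Real.exp 2 ^ n * (2 * Real.pi) ^ n) := by
      rw [← mul_pow, ← mul_pow]; congr 1; ring
    have e3 : ((n : ℝ) / 2) ^ n * ((n : ℝ) / 2) ^ n * 4 ^ n = (n : ℝ) ^ n * (n : ℝ) ^ n := by
      rw [← mul_pow, ← mul_pow, ← mul_pow]; congr 1; ring
    rw [e1] at h3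
    rw [e2]
    have hp : 0 < a * l * (n : ℝ) ^ n := by positivity
    have h5 : (a * l * (n : ℝ) ^ n) * (a * l * (n : ℝ) ^ n) ≤
        (a * l * (n : ℝ) ^ n) * (2 * (4 ^ n * (Real.exp 2 ^ n * (2 * Real.pi) ^ n))) := by
      calc (a * l * (n : ℝ) ^ n) * (a * l * (n : ℝ) ^ n) = (a ^ 2 * (((n : ℝ) / 2) ^ n * l) ^ 2) * 4 ^ n := by
            linear_combination (-(a ^ 2 * l ^ 2)) * e3
        _ ≤ _ := mul_le_mul_of_nonneg_right h3 (by positivity)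
        _ = _ := by ring
    exact le_of_mul_le_mul_left h5 hp
  have h5 : a * l * (n : ℝ) ^ n ≤ (16 * Real.pi * Real.exp 2) ^ n := by
    refine h4.trans ?_
    have : (16 * Real.pi * Real.exp 2) ^ n = 2 ^ n * (8 * Real.pi * Real.exp 2) ^ n := by
      rw [← mul_pow]; congr 1; ring
    rw [this]
    refine mul_le_mul_of_nonneg_right ?_ (by positivity)
    calc (2 : ℝ) = 2 ^ 1 := by norm_num
      _ ≤ 2 ^ n := pow_le_pow_right₀ (by norm_num) hn
  rw [← div_eq_mul_inv, ENNReal.le_div_iff_mul_le (by simp [hn.ne']) (by simp), ← ENNReal.ofReal_natCast,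
    ← ENNReal.ofReal_pow (by positivity), ← ENNReal.ofReal_pow (by positivity), ← ENNReal.ofReal_mul (by positivity),
    ← ENNReal.ofReal_mul (by positivity)]
  exact ENNReal.ofReal_le_ofReal h5

end

noncomputable section

abbrev VV (n : ℕ) := Euc n × Euc n

/-- Standard basis of the doubled space. -/
def bV (n : ℕ) : Module.Basis (Fin n ⊕ Fin n) ℝ (VV n) :=
  (EuclideanSpace.basisFun (Fin n) ℝ).toBasis.prod (EuclideanSpace.basisFun (Fin n) ℝ).toBasis

/-- Euclidean bilinear form. -/
def bet {n : ℕ} (z w : VV n) : ℝ := ⟪z.1, w.1⟫ + ⟪z.2, w.2⟫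

lemma bet_continuous {n : ℕ} : Continuous fun p : VV n × VV n => bet p.1 p.2 := by
  unfold bet; fun_prop

lemma bet_comm {n : ℕ} (z w : VV n) : bet z w = bet w z := by
  simp only [bet, real_inner_comm]

lemma bet_expand {n : ℕ} (a b : ℝ) (z u v : VV n) :
    bet (z + a • u + b • v) (z + a • u + b • v) =
    bet z z + a ^ 2 * bet u u + b ^ 2 * bet v v + 2 * a * bet z u + 2 * b * bet z v + 2 * a * b * bet u v := by
  simp only [bet, Prod.fst_add, Prod.snd_add, Prod.smul_fst, Prod.smul_snd, inner_add_left, inner_add_right,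
    inner_smul_left, inner_smul_right, RCLike.conj_to_real]
  rw [real_inner_comm u.1 z.1, real_inner_comm u.2 z.2, real_inner_comm v.1 z.1, real_inner_comm v.2 z.2,
    real_inner_comm v.1 u.1, real_inner_comm v.2 u.2]
  ring

/-- Jacobian matrix (complexified). -/
def Jm {n : ℕ} (σ : VV n → VV n) (z : VV n) : Matrix (Fin n ⊕ Fin n) (Fin n ⊕ Fin n) ℂ :=
  (LinearMap.toMatrix (bV n) (bV n) (fderiv ℝ σ z : VV n →ₗ[ℝ] VV n)).map Complex.ofReal

/-- complexified quadratic form along the deformation -/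
def Qf {n : ℕ} (σ₁ σ₂ : VV n → VV n) (a b : ℂ) (z : VV n) : ℂ :=
  (bet z z : ℂ) + a ^ 2 * (bet (σ₁ z) (σ₁ z) : ℂ) + b ^ 2 * (bet (σ₂ z) (σ₂ z) : ℂ)
  + 2 * a * (bet z (σ₁ z) : ℂ) + 2 * b * (bet z (σ₂ z) : ℂ) + 2 * a * b * (bet (σ₁ z) (σ₂ z) : ℂ)

/-- deformed integrand -/
def Hf {n : ℕ} (σ₁ σ₂ : VV n → VV n) (a b : ℂ) (z : VV n) : ℂ :=
  Complex.exp (-(Qf σ₁ σ₂ a b z)) * (1 + a • Jm σ₁ z + b • Jm σ₂ z).det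

lemma Jm_continuous {n : ℕ} {σ : VV n → VV n} (h : ContDiff ℝ 1 σ) : Continuous (Jm σ) := by
  have hc : Continuous (fderiv ℝ σ) := h.continuous_fderiv (by norm_num)
  refine continuous_matrix fun i j => ?_
  simp only [Jm, Matrix.map_apply, LinearMap.toMatrix_apply]
  have h1 : Continuous fun z => (fderiv ℝ σ z) (bV n j) := by fun_prop
  have h2 : Continuous fun v : VV n => (bV n).repr v i :=
    LinearMap.continuous_of_finiteDimensional ((bV n).coord i)
  exact Complex.continuous_ofReal.comp (h2.comp h1)

lemma Jm_zero {n : ℕ} {σ : VV n → VV n} {z : VV n} (h : z ∉ tsupport σ) : Jm σ z = 0 := by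
  rw [Jm, fderiv_of_notMem_tsupport ℝ h]
  simp

lemma gauss_integrable {n : ℕ} : Integrable fun z : VV n => Real.exp (-(bet z z)) := by
  have hG : Integrable fun v : Euc n => Real.exp (-(‖v‖ ^ 2)) := by
    have h2 := GaussianFourier.integrable_cexp_neg_mul_sq_norm_add (b := (1 : ℂ)) (V := Euc n)
      (by simp) 0 0
    refine h2.re.congr (Filter.Eventually.of_forall fun v => ?_)
    have : (-(1 : ℂ) * (‖v‖ : ℂ) ^ 2 + 0 * ((⟪(0 : Euc n), v⟫ : ℝ) : ℂ)) = ((-(‖v‖ ^ 2) : ℝ) : ℂ) := by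
      push_cast; ring
    simp only [this, ← Complex.ofReal_exp, RCLike.re_to_complex, Complex.ofReal_re]
  rw [Measure.volume_eq_prod]
  refine (hG.mul_prod hG).congr (Filter.Eventually.of_forall fun z => ?_)
  simp only [bet, real_inner_self_eq_norm_sq, ← Real.exp_add]
  congr 1; ring

lemma gauss_integral {n : ℕ} : ∫ z : VV n, Real.exp (-(bet z z)) = Real.pi ^ n := by
  have h1 : ∀ z : VV n, Real.exp (-(bet z z)) = Real.exp (-1 * ‖z.1‖ ^ 2) * Real.exp (-1 * ‖z.2‖ ^ 2) := by
    intro z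
    simp only [bet, real_inner_self_eq_norm_sq, ← Real.exp_add]
    congr 1; ring
  simp_rw [h1]
  rw [Measure.volume_eq_prod, integral_prod_mul (fun v : Euc n => Real.exp (-1 * ‖v‖ ^ 2))
    (fun v : Euc n => Real.exp (-1 * ‖v‖ ^ 2)), GaussianFourier.integral_rexp_neg_mul_sq_norm one_pos]
  rw [div_one, finrank_euclideanSpace, Fintype.card_fin, ← Real.rpow_add Real.pi_pos, ← Real.rpow_natCast]
  congr 1; ring

lemma bij_of_lip {V : Type*} [NormedAddCommGroup V] [CompleteSpace V] {g : V → V} {k : NNReal} (hk : k < 1)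
    (hg : LipschitzWith k g) : Function.Bijective fun z => z + g z := by
  constructor
  · intro a b hab
    simp only at hab
    have h1 := hg.dist_le_mul a b
    have h2 : dist a b = dist (g a) (g b) := by
      rw [dist_eq_norm, dist_eq_norm, ← norm_neg]
      congr 1
      have : a - b = g b - g a := by rw [sub_eq_sub_iff_add_eq_add, hab, add_comm]
      rw [this]; abel
    rw [← h2] at h1
    have hk' : (k : ℝ) < 1 := by exact_mod_cast hk
    have : dist a b ≤ 0 := by nlinarith [dist_nonneg (x := a) (y := b)]
    exact dist_le_zero.1 this
  · intro w
    have hc : ContractingWith k (fun z => w - g z) := by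
      refine ⟨hk, LipschitzWith.of_dist_le_mul fun a b => ?_⟩
      rw [dist_sub_left]; exact hg.dist_le_mul a b
    have := hc.fixedPoint_isFixedPt
    refine ⟨ContractingWith.fixedPoint _ hc, ?_⟩
    have h := this.eq
    simp only at h ⊢
    conv_lhs => enter [1]; rw [← h]
    abel

lemma Hf_real {n : ℕ} {σ₁ σ₂ : VV n → VV n} (h1 : ContDiff ℝ 1 σ₁) (h2 : ContDiff ℝ 1 σ₂) (a b : ℝ)
    {k : NNReal} (hk : k < 1) (hl : LipschitzWith k fun z => a • σ₁ z + b • σ₂ z)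
    (hpos : ∀ z, 0 < ((1 : Matrix (Fin n ⊕ Fin n) (Fin n ⊕ Fin n) ℂ) + (a : ℂ) • Jm σ₁ z + (b : ℂ) • Jm σ₂ z).det.re) :
    ∫ z, Hf σ₁ σ₂ a b z = ((∫ z : VV n, Real.exp (-(bet z z)) : ℝ) : ℂ) := by
  set f : VV n → VV n := fun z => z + (a • σ₁ z + b • σ₂ z) with hf
  have hb := bij_of_lip hk hl
  set f' : VV n → (VV n →L[ℝ] VV n) := fun z =>
    ContinuousLinearMap.id ℝ _ + (a • fderiv ℝ σ₁ z + b • fderiv ℝ σ₂ z) with hf'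
  have hd : ∀ z, HasFDerivAt f (f' z) z := by
    intro z
    have e1 := (h1.differentiable (by norm_num) z).hasFDerivAt
    have e2 := (h2.differentiable (by norm_num) z).hasFDerivAt
    exact (hasFDerivAt_id z).add ((e1.const_smul a).add (e2.const_smul b))
  have hdet : ∀ z, ((1 : Matrix (Fin n ⊕ Fin n) (Fin n ⊕ Fin n) ℂ) + (a : ℂ) • Jm σ₁ z + (b : ℂ) • Jm σ₂ z).det =
      (((f' z).det : ℝ) : ℂ) := by
    intro z
    have : (1 : Matrix (Fin n ⊕ Fin n) (Fin n ⊕ Fin n) ℂ) + (a : ℂ) • Jm σ₁ z + (b : ℂ) • Jm σ₂ z =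
        Complex.ofRealHom.mapMatrix (LinearMap.toMatrix (bV n) (bV n) (f' z : VV n →ₗ[ℝ] VV n)) := by
      have e : ((f' z : VV n →L[ℝ] VV n) : VV n →ₗ[ℝ] VV n) = LinearMap.id +
          (a • (fderiv ℝ σ₁ z : VV n →ₗ[ℝ] VV n) + b • (fderiv ℝ σ₂ z : VV n →ₗ[ℝ] VV n)) := rfl
      rw [e, map_add, map_add, map_add, map_add, LinearMap.toMatrix_id, map_one, add_assoc]
      congr 2
      · ext i j; simp [Jm]
      · ext i j; simp [Jm]
    rw [this, ← RingHom.map_det, LinearMap.det_toMatrix]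
    rfl
  have hcv := integral_image_eq_integral_abs_det_fderiv_smul volume MeasurableSet.univ
    (fun z _ => (hd z).hasFDerivWithinAt) hb.1.injOn (fun z : VV n => Real.exp (-(bet z z)))
  rw [image_univ, hb.2.range_eq, setIntegral_univ, setIntegral_univ] at hcv
  rw [hcv, ← integral_complex_ofReal]
  congr 1; ext z
  have hp := hpos z
  rw [hdet, Complex.ofReal_re] at hp
  rw [Hf, hdet, abs_of_pos hp, smul_eq_mul, mul_comm, Complex.ofReal_mul, Complex.ofReal_exp]
  congr 2
  have := bet_expand a b z (σ₁ z) (σ₂ z)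
  rw [add_assoc] at this
  rw [this, Qf]; push_cast; rfl

lemma det_entire {ι : Type*} [Fintype ι] [DecidableEq ι] {f : ℂ → Matrix ι ι ℂ}
    (h : ∀ i j, Differentiable ℂ fun τ => f τ i j) : Differentiable ℂ fun τ => (f τ).det := by
  simp only [Matrix.det_apply]
  refine Differentiable.fun_sum fun s _ => ?_
  simp only [Units.smul_def, zsmul_eq_mul]
  refine (differentiable_const _).mul ?_
  exact Differentiable.fun_finsetProd fun i _ => h _ _

lemma bet_cont {n : ℕ} {f g : VV n → VV n} (hf : Continuous f) (hg : Continuous g) :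
    Continuous fun z => bet (f z) (g z) := by
  unfold bet; fun_prop

lemma Hf_cont {n : ℕ} {σ₁ σ₂ : VV n → VV n} (h1 : ContDiff ℝ 1 σ₁) (h2 : ContDiff ℝ 1 σ₂) :
    Continuous fun p : ℂ × VV n => Hf σ₁ σ₂ (-p.1 ^ 2) p.1 p.2 := by
  have hJ1 := Jm_continuous h1
  have hJ2 := Jm_continuous h2
  have b1 : Continuous fun z : VV n => bet z z := bet_cont continuous_id continuous_id
  have b2 := bet_cont h1.continuous h1.continuous
  have b3 := bet_cont h2.continuous h2.continuous
  have b4 : Continuous fun z : VV n => bet z (σ₁ z) := bet_cont continuous_id h1.continuous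
  have b5 : Continuous fun z : VV n => bet z (σ₂ z) := bet_cont continuous_id h2.continuous
  have b6 := bet_cont h1.continuous h2.continuous
  have key : ∀ q1 q2 q3 q4 q5 q6 : VV n → ℝ, Continuous q1 → Continuous q2 → Continuous q3 →
      Continuous q4 → Continuous q5 → Continuous q6 → Continuous fun a : ℂ × VV n =>
      Complex.exp (-((q1 a.2 : ℂ) + (-a.1 ^ 2) ^ 2 * (q2 a.2 : ℂ) + a.1 ^ 2 * (q3 a.2 : ℂ) +
          2 * -a.1 ^ 2 * (q4 a.2 : ℂ) + 2 * a.1 * (q5 a.2 : ℂ) + 2 * -a.1 ^ 2 * a.1 * (q6 a.2 : ℂ))) := by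
    intro q1 q2 q3 q4 q5 q6 c1 c2 c3 c4 c5 c6
    fun_prop
  have hk := key (fun z => bet z z) (fun z => bet (σ₁ z) (σ₁ z)) (fun z => bet (σ₂ z) (σ₂ z))
    (fun z => bet z (σ₁ z)) (fun z => bet z (σ₂ z)) (fun z => bet (σ₁ z) (σ₂ z)) b1 b2 b3 b4 b5 b6
  simp only [Hf, Qf]
  refine Continuous.mul hk (Continuous.matrix_det ?_)
  fun_prop

theorem Hf_main {n : ℕ} {σ₁ σ₂ : VV n → VV n} (h1 : ContDiff ℝ 1 σ₁) (h2 : ContDiff ℝ 1 σ₂)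
    (hc1 : HasCompactSupport σ₁) (hc2 : HasCompactSupport σ₂) :
    ∫ z, Hf σ₁ σ₂ 1 Complex.I z = ((∫ z : VV n, Real.exp (-(bet z z)) : ℝ) : ℂ) := by
  obtain ⟨S, hS⟩ : ∃ S : Set (VV n), S = tsupport σ₁ ∪ tsupport σ₂ := ⟨_, rfl⟩
  have hSc : IsCompact S := hS ▸ hc1.isCompact.union hc2.isCompact
  set gs : VV n → ℂ := fun z => ((Real.exp (-(bet z z)) : ℝ) : ℂ) with hgs
  have hgi : Integrable gs := gauss_integrable.ofReal
  have hbc : ∀ {f g : VV n → VV n}, Continuous f → Continuous g → Continuous fun z => bet (f z) (g z) :=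
    fun hf hg => bet_continuous.comp (hf.prodMk hg)
  have hgc : Continuous gs := by
    have := hbc continuous_id continuous_id
    simp only [id] at this
    simp only [hgs]; fun_prop
  set E : ℂ → VV n → ℂ := fun τ z => Hf σ₁ σ₂ (-τ ^ 2) τ z - gs z with hE
  have hJ1 := Jm_continuous h1
  have hJ2 := Jm_continuous h2
  have hEc : Continuous (Function.uncurry E) :=
    (Hf_cont h1 h2).sub (hgc.comp continuous_snd)
  have hE0 : ∀ τ, ∀ z ∉ S, E τ z = 0 := by
    intro τ z hz
    have z1 : z ∉ tsupport σ₁ := fun h => hz (hS ▸ Or.inl h)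
    have z2 : z ∉ tsupport σ₂ := fun h => hz (hS ▸ Or.inr h)
    have e1 := image_eq_zero_of_notMem_tsupport z1
    have e2 := image_eq_zero_of_notMem_tsupport z2
    simp [hE, Hf, Qf, Jm_zero z1, Jm_zero z2, e1, e2, hgs, bet]
  have hEd : ∀ z, Differentiable ℂ fun τ => E τ z := by
    intro z
    refine Differentiable.sub ?_ (differentiable_const _)
    simp only [Hf, Qf]
    refine Differentiable.mul (by fun_prop) (det_entire fun i j => ?_)
    simp only [Matrix.add_apply, Matrix.smul_apply, smul_eq_mul]
    fun_prop
  set D : ℂ → ℂ := fun τ => ∫ z in S, E τ z with hD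
  have hDd : Differentiable ℂ D := holo_integral hSc hSc.measurableSet hSc.measure_lt_top hEc hEd
  have hDH : ∀ τ, ∫ z, Hf σ₁ σ₂ (-τ ^ 2) τ z = (∫ z, gs z) + D τ := by
    intro τ
    have hcE : Continuous (E τ) := hEc.comp (f := fun z => (τ, z)) (by fun_prop)
    have hEi : Integrable (E τ) :=
      hcE.integrable_of_hasCompactSupport (HasCompactSupport.intro hSc (hE0 τ))
    have : ∫ z, Hf σ₁ σ₂ (-τ ^ 2) τ z = ∫ z, (gs z + E τ z) := by
      congr 1; ext z; simp [hE]
    rw [this, integral_add hgi hEi, hD]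
    simp only
    rw [setIntegral_eq_integral_of_forall_compl_eq_zero (hE0 τ)]
  have hgI : ∫ z, gs z = ((∫ z : VV n, Real.exp (-(bet z z)) : ℝ) : ℂ) := by
    rw [← integral_complex_ofReal]
  obtain ⟨C1, hC1⟩ := h1.lipschitzWith_of_hasCompactSupport hc1 (by norm_num)
  obtain ⟨C2, hC2⟩ := h2.lipschitzWith_of_hasCompactSupport hc2 (by norm_num)
  have hsmall : ∀ᶠ t : ℝ in nhds 0, D t = 0 := by
    have ev1 : ∀ᶠ t : ℝ in nhds 0, ‖-t ^ 2‖₊ * C1 + ‖t‖₊ * C2 < 1 := by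
      have : Continuous fun t : ℝ => ‖-t ^ 2‖₊ * C1 + ‖t‖₊ * C2 := by fun_prop
      exact this.continuousAt.eventually_lt continuousAt_const (by simp)
    have hdc : Continuous fun p : ℝ × VV n => ((1 : Matrix (Fin n ⊕ Fin n) (Fin n ⊕ Fin n) ℂ)
        + ((-p.1 ^ 2 : ℝ) : ℂ) • Jm σ₁ p.2 + (p.1 : ℂ) • Jm σ₂ p.2).det.re := by
      refine Complex.continuous_re.comp (Continuous.matrix_det ?_)
      fun_prop
    have ev2 : ∀ᶠ t : ℝ in nhds 0, ∀ z ∈ S, 0 < ((1 : Matrix (Fin n ⊕ Fin n) (Fin n ⊕ Fin n) ℂ)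
        + ((-t ^ 2 : ℝ) : ℂ) • Jm σ₁ z + (t : ℂ) • Jm σ₂ z).det.re := by
      refine hSc.eventually_forall_of_forall_eventually fun z _ => ?_
      refine continuousAt_const.eventually_lt hdc.continuousAt ?_
      simp
    filter_upwards [ev1, ev2] with t ht1 ht2
    have hl : LipschitzWith (‖-t ^ 2‖₊ * C1 + ‖t‖₊ * C2) fun z => (-t ^ 2) • σ₁ z + t • σ₂ z :=
      ((lipschitzWith_smul _).comp hC1).add ((lipschitzWith_smul _).comp hC2)
    have hr := Hf_real h1 h2 (-t ^ 2) t ht1 hl ?_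
    · have h3 := hDH t
      rw [hgI] at h3
      have e : (-(t : ℂ) ^ 2) = ((-t ^ 2 : ℝ) : ℂ) := by push_cast; rfl
      rw [e, hr] at h3
      simpa using h3
    · intro z
      by_cases hz : z ∈ S
      · exact ht2 z hz
      · have z1 : z ∉ tsupport σ₁ := fun h => hz (hS ▸ Or.inl h)
        have z2 : z ∉ tsupport σ₂ := fun h => hz (hS ▸ Or.inr h)
        simp [Jm_zero z1, Jm_zero z2]
  have hDz : D = fun _ => 0 := by
    refine AnalyticOnNhd.eq_of_frequently_eq (z₀ := 0) (fun z _ => hDd.analyticAt z)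
      (fun z _ => analyticAt_const) ?_
    have hfr : ∃ᶠ t : ℝ in nhdsWithin 0 {0}ᶜ, D t = 0 :=
      (hsmall.filter_mono nhdsWithin_le_nhds).frequently
    have htend : Filter.Tendsto (fun t : ℝ => (t : ℂ)) (nhdsWithin 0 {0}ᶜ) (nhdsWithin 0 {0}ᶜ) := by
      refine tendsto_nhdsWithin_of_tendsto_nhds_of_eventually_within _ ?_ ?_
      · have : Filter.Tendsto (fun t : ℝ => (t : ℂ)) (nhds 0) (nhds ((0 : ℝ) : ℂ)) :=
          Complex.continuous_ofReal.continuousAt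
        simpa using this.mono_left nhdsWithin_le_nhds
      · filter_upwards [self_mem_nhdsWithin] with t ht
        simpa using ht
    exact htend.frequently hfr
  have h3 := hDH Complex.I
  rw [hDz, hgI] at h3
  simpa using h3

end

noncomputable section

lemma exists_net {n : ℕ} {K : Set (Euc n)} (hK : Bod K) :
    ∃ T : Finset (Euc n), (∀ t ∈ T, t ∈ polarSet K) ∧ ∀ x, ∃ t ∈ T, gauge K x / 2 ≤ ⟪x, t⟫ := by
  obtain ⟨c, hc, hcl⟩ := hK.sub.exists_lower
  obtain ⟨t, htL, htf, htc⟩ := hK.polar.compact.finite_cover_balls (half_pos hc)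
  refine ⟨htf.toFinset, fun s hs => htL (htf.mem_toFinset.1 hs), fun x => ?_⟩
  obtain ⟨y, hy, hxy⟩ := hK.polar.exists_gauge_polar x
  rw [hK.polar_polar] at hxy
  obtain ⟨s, hs, hys⟩ := mem_iUnion₂.1 (htc hy)
  refine ⟨s, htf.mem_toFinset.2 hs, ?_⟩
  have h1 : ⟪x, y - s⟫ ≤ ‖x‖ * ‖y - s‖ := real_inner_le_norm _ _
  have h2 : ‖y - s‖ < c / 2 := by simpa [dist_eq_norm] using hys
  have h3 := hcl x
  have h4 : ⟪x, y - s⟫ = gauge K x - ⟪x, s⟫ := by rw [inner_sub_right, real_inner_comm, hxy]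
  nlinarith [norm_nonneg x]

section softmax
variable {n : ℕ} (T : Finset (Euc n)) (l : ℝ)

/-- exponential weight -/
def sE (t x : Euc n) : ℝ := Real.exp (l * ⟪x, t⟫)
/-- partition function -/
def sZ (x : Euc n) : ℝ := ∑ t ∈ T, sE l t x
/-- numerator -/
def sN (x : Euc n) : Euc n := ∑ t ∈ T, sE l t x • t
/-- softmax map -/
def sY (x : Euc n) : Euc n := (sZ T l x)⁻¹ • sN T l x

lemma sE_pos (t x : Euc n) : 0 < sE l t x := Real.exp_pos _

variable {T}
lemma sZ_pos (hT : T.Nonempty) (x : Euc n) : 0 < sZ T l x := Finset.sum_pos (fun t _ => sE_pos l t x) hT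

lemma sY_mem {L : Set (Euc n)} (hT : T.Nonempty) (hL : Convex ℝ L) (h : ∀ t ∈ T, t ∈ L) (x : Euc n) :
    sY T l x ∈ L := by
  have := hL.sum_mem (t := T) (w := fun t => (sZ T l x)⁻¹ * sE l t x) (z := id)
    (fun t _ => mul_nonneg (inv_nonneg.2 (sZ_pos l hT x).le) (sE_pos l t x).le) ?_ h
  · rw [sY, sN, Finset.smul_sum]
    simpa only [smul_smul, id] using this
  · rw [← Finset.mul_sum]
    exact inv_mul_cancel₀ (sZ_pos l hT x).ne'

lemma sE_contDiff (t : Euc n) : ContDiff ℝ 1 (sE l t) := by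
  unfold sE; exact (contDiff_const.mul (contDiff_id.inner ℝ contDiff_const)).exp

lemma sY_contDiff (hT : T.Nonempty) : ContDiff ℝ 1 (sY T l) := by
  have h1 : ContDiff ℝ 1 (sZ T l) := by
    unfold sZ; exact ContDiff.sum fun t _ => sE_contDiff l t
  have h2 : ContDiff ℝ 1 (sN T l) := by
    unfold sN; exact ContDiff.sum fun t _ => (sE_contDiff l t).smul contDiff_const
  exact (h1.inv fun x => (sZ_pos l hT x).ne').smul h2

lemma sE_hasFDeriv (t x : Euc n) : ∃ D : Euc n →L[ℝ] ℝ, HasFDerivAt (sE l t) D x ∧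
    ‖D‖ ≤ |l| * ‖t‖ * sE l t x := by
  have h1 : HasFDerivAt (fun x : Euc n => l * ⟪x, t⟫) (l • innerSL ℝ t) x := by
    have := ((innerSL ℝ t).hasFDerivAt (x := x)).const_mul l
    refine this.congr_of_eventuallyEq (Filter.Eventually.of_forall fun z => ?_)
    simp [real_inner_comm]
  refine ⟨_, h1.exp, ?_⟩
  rw [norm_smul, norm_smul, Real.norm_eq_abs, abs_of_pos (Real.exp_pos _), innerSL_apply_norm, Real.norm_eq_abs, sE]
  exact le_of_eq (by ring)

lemma sY_fderiv (hT : T.Nonempty) {R : ℝ} (hR : 0 ≤ R) (h : ∀ t ∈ T, ‖t‖ ≤ R) (x : Euc n) :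
    ‖fderiv ℝ (sY T l) x‖ ≤ 2 * |l| * R ^ 2 := by
  choose D hD hDn using fun t => sE_hasFDeriv l t x
  have hZp := sZ_pos l hT x
  have hZ : HasFDerivAt (sZ T l) (∑ t ∈ T, D t) x := by
    unfold sZ; exact HasFDerivAt.fun_sum fun t _ => hD t
  have hN : HasFDerivAt (sN T l) (∑ t ∈ T, (D t).smulRight t) x := by
    unfold sN; exact HasFDerivAt.fun_sum fun t _ => (hD t).smul_const t
  have hi : HasFDerivAt (fun x => (sZ T l x)⁻¹) (-(sZ T l x ^ 2)⁻¹ • (∑ t ∈ T, D t)) x :=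
    (hasDerivAt_inv hZp.ne').comp_hasFDerivAt x hZ
  have hY := hi.smul hN
  have e : fderiv ℝ (sY T l) x = _ := hY.fderiv
  rw [e]
  have hDb : ∀ t ∈ T, ‖D t‖ ≤ |l| * R * sE l t x := fun t ht => (hDn t).trans <|
    mul_le_mul_of_nonneg_right (mul_le_mul_of_nonneg_left (h t ht) (abs_nonneg _)) (sE_pos l t x).le
  have b1 : ‖∑ t ∈ T, D t‖ ≤ |l| * R * sZ T l x := by
    rw [sZ, Finset.mul_sum]
    exact norm_sum_le_of_le _ hDb
  have b2 : ‖∑ t ∈ T, (D t).smulRight t‖ ≤ |l| * R * sZ T l x * R := by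
    rw [sZ, Finset.mul_sum, Finset.sum_mul]
    refine norm_sum_le_of_le _ fun t ht => ?_
    rw [ContinuousLinearMap.norm_smulRight_apply]
    exact mul_le_mul (hDb t ht) (h t ht) (norm_nonneg _) (by have := sE_pos l t x; positivity)
  have b3 : ‖sN T l x‖ ≤ sZ T l x * R := by
    rw [sN, sZ, Finset.sum_mul]
    refine norm_sum_le_of_le _ fun t ht => ?_
    rw [norm_smul, Real.norm_eq_abs, abs_of_pos (sE_pos l t x)]
    exact mul_le_mul_of_nonneg_left (h t ht) (sE_pos l t x).le
  refine (norm_add_le _ _).trans ?_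
  rw [norm_smul, ContinuousLinearMap.norm_smulRight_apply, norm_smul, norm_neg, norm_inv, norm_inv, norm_pow,
    Real.norm_eq_abs, abs_of_pos hZp]
  calc _ ≤ (sZ T l x)⁻¹ * (|l| * R * sZ T l x * R) + (sZ T l x ^ 2)⁻¹ * (|l| * R * sZ T l x) * (sZ T l x * R) := by
        gcongr
    _ = _ := by field_simp; ring

lemma sY_inner_le (hT : T.Nonempty) (hl : 0 < l) {t₀ : Euc n} (ht₀ : t₀ ∈ T) (x : Euc n)
    (hmax : ∀ t ∈ T, ⟪x, t⟫ ≤ ⟪x, t₀⟫) : ⟪x, t₀⟫ - T.card / l ≤ ⟪x, sY T l x⟫ := by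
  have hZp := sZ_pos l hT x
  have h0 := sE_pos l t₀ x
  have hge : sE l t₀ x ≤ sZ T l x := Finset.single_le_sum (f := fun t => sE l t x) (fun t _ => (sE_pos l t x).le) ht₀
  have h1 : ∀ t ∈ T, sE l t x * (⟪x, t₀⟫ - ⟪x, t⟫) ≤ sE l t₀ x / l := by
    intro t ht
    have ha : 0 ≤ l * (⟪x, t₀⟫ - ⟪x, t⟫) := mul_nonneg hl.le (sub_nonneg.2 (hmax t ht))
    have hb := Real.add_one_le_exp (l * (⟪x, t₀⟫ - ⟪x, t⟫))
    have hc : sE l t₀ x = sE l t x * Real.exp (l * (⟪x, t₀⟫ - ⟪x, t⟫)) := by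
      rw [sE, sE, ← Real.exp_add]; congr 1; ring
    rw [le_div_iff₀ hl, hc]
    have := sE_pos l t x
    nlinarith
  have h2 : sZ T l x * ⟪x, t₀⟫ - ⟪x, sN T l x⟫ ≤ T.card * (sE l t₀ x / l) := by
    have e : sZ T l x * ⟪x, t₀⟫ - ⟪x, sN T l x⟫ = ∑ t ∈ T, sE l t x * (⟪x, t₀⟫ - ⟪x, t⟫) := by
      rw [sZ, sN, Finset.sum_mul, inner_sum, ← Finset.sum_sub_distrib]
      refine Finset.sum_congr rfl fun t _ => ?_
      rw [inner_smul_right]; ring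
    rw [e, ← nsmul_eq_mul]
    exact Finset.sum_le_card_nsmul _ _ _ h1
  have h3 : (T.card : ℝ) * (sE l t₀ x / l) ≤ sZ T l x * (T.card / l) := by
    rw [mul_div_assoc', mul_div_assoc', mul_comm (sZ T l x)]
    gcongr
  rw [sY, inner_smul_right, ← div_eq_inv_mul, le_div_iff₀ hZp]
  nlinarith

lemma sY_mono (hT : T.Nonempty) (hl : 0 < l) {x x' : Euc n}
    (hs : ∃ s ∈ T, ∃ t ∈ T, ⟪x - x', s⟫ ≠ ⟪x - x', t⟫) : 0 < ⟪x - x', sY T l x - sY T l x'⟫ := by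
  have hZ1 := sZ_pos l hT x
  have hZ2 := sZ_pos l hT x'
  set Δ := x - x' with hΔ
  have key : 2 * (sZ T l x * sZ T l x') * ⟪Δ, sY T l x - sY T l x'⟫ =
      ∑ s ∈ T, ∑ t ∈ T, (sE l s x * sE l t x' - sE l t x * sE l s x') * (⟪Δ, s⟫ - ⟪Δ, t⟫) := by
    have e1 : sZ T l x * sZ T l x' * ⟪Δ, sY T l x - sY T l x'⟫ =
        ∑ s ∈ T, ∑ t ∈ T, (sE l s x * sE l t x') * (⟪Δ, s⟫ - ⟪Δ, t⟫) := by
      have : sZ T l x * sZ T l x' * ⟪Δ, sY T l x - sY T l x'⟫ =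
          ⟪Δ, sN T l x⟫ * sZ T l x' - sZ T l x * ⟪Δ, sN T l x'⟫ := by
        rw [inner_sub_right, sY, sY, inner_smul_right, inner_smul_right]; field_simp
      rw [this, sN, sN, inner_sum, inner_sum, sZ, sZ, Finset.sum_mul_sum, Finset.sum_mul_sum, ← Finset.sum_sub_distrib]
      refine Finset.sum_congr rfl fun s _ => ?_
      rw [← Finset.sum_sub_distrib]
      refine Finset.sum_congr rfl fun t _ => ?_
      rw [inner_smul_right, inner_smul_right]; ring
    have e2 := e1
    rw [Finset.sum_comm] at e2
    have : 2 * (sZ T l x * sZ T l x') * ⟪Δ, sY T l x - sY T l x'⟫ = sZ T l x * sZ T l x' * ⟪Δ, sY T l x - sY T l x'⟫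
      + sZ T l x * sZ T l x' * ⟪Δ, sY T l x - sY T l x'⟫ := by ring
    rw [this]
    nth_rewrite 1 [e1]
    rw [e2, ← Finset.sum_add_distrib]
    refine Finset.sum_congr rfl fun s _ => ?_
    rw [← Finset.sum_add_distrib]
    refine Finset.sum_congr rfl fun t _ => ?_
    ring
  have hfac : ∀ s t : Euc n, sE l s x * sE l t x' = (sE l t x * sE l s x') * Real.exp (l * (⟪Δ, s⟫ - ⟪Δ, t⟫)) := by
    intro s t
    simp only [sE, ← Real.exp_add, hΔ, inner_sub_left]
    congr 1; ring
  have hterm : ∀ s t : Euc n, ⟪Δ, s⟫ ≠ ⟪Δ, t⟫ →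
      0 < (sE l s x * sE l t x' - sE l t x * sE l s x') * (⟪Δ, s⟫ - ⟪Δ, t⟫) := by
    intro s t hst
    rw [hfac s t]
    have hp : 0 < sE l t x * sE l s x' := mul_pos (sE_pos ..) (sE_pos ..)
    have e : ((sE l t x * sE l s x') * Real.exp (l * (⟪Δ, s⟫ - ⟪Δ, t⟫)) - sE l t x * sE l s x') * (⟪Δ, s⟫ - ⟪Δ, t⟫)
        = (sE l t x * sE l s x') * ((Real.exp (l * (⟪Δ, s⟫ - ⟪Δ, t⟫)) - 1) * (⟪Δ, s⟫ - ⟪Δ, t⟫)) := by ring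
    rw [e]
    refine mul_pos hp ?_
    rcases lt_or_gt_of_ne hst with h | h
    · refine mul_pos_of_neg_of_neg ?_ (by linarith)
      have : Real.exp (l * (⟪Δ, s⟫ - ⟪Δ, t⟫)) < 1 := by rw [← Real.exp_zero]; exact Real.exp_lt_exp.2 (mul_neg_of_pos_of_neg hl (by linarith))
      linarith
    · refine mul_pos ?_ (by linarith)
      have : 1 < Real.exp (l * (⟪Δ, s⟫ - ⟪Δ, t⟫)) := Real.one_lt_exp_iff.2 (mul_pos hl (by linarith))
      linarith
  have hnn : ∀ s t : Euc n, 0 ≤ (sE l s x * sE l t x' - sE l t x * sE l s x') * (⟪Δ, s⟫ - ⟪Δ, t⟫) := by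
    intro s t
    by_cases h : ⟪Δ, s⟫ = ⟪Δ, t⟫
    · rw [h]; simp
    · exact (hterm s t h).le
  obtain ⟨s, hs, t, ht, hst⟩ := hs
  have hpos : 0 < ∑ s ∈ T, ∑ t ∈ T, (sE l s x * sE l t x' - sE l t x * sE l s x') * (⟪Δ, s⟫ - ⟪Δ, t⟫) :=
    Finset.sum_pos' (fun s _ => Finset.sum_nonneg fun t _ => hnn s t)
      ⟨s, hs, Finset.sum_pos' (fun t _ => hnn s t) ⟨t, ht, hterm s t hst⟩⟩
  rw [← key] at hpos
  exact (mul_pos_iff_of_pos_left (by positivity)).1 hpos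
end softmax

/-- the monotone map used for the deformation -/
structure MonoMap {n : ℕ} (K : Set (Euc n)) (y : Euc n → Euc n) : Prop where
  smooth : ContDiff ℝ 1 y
  mem : ∀ x, y x ∈ polarSet K
  bdd : ∃ C : ℝ, ∀ x, ‖fderiv ℝ y x‖ ≤ C
  coer : ∀ x, gauge K x / 2 - 1 ≤ ⟪x, y x⟫
  mono : ∀ x x', x ≠ x' → 0 < ⟪x - x', y x - y x'⟫

theorem exists_monoMap {n : ℕ} {K : Set (Euc n)} (hK : Bod K) : ∃ y, MonoMap K y := by
  obtain ⟨T, hTL, hT⟩ := exists_net hK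
  have hTn : T.Nonempty := by obtain ⟨t, ht, -⟩ := hT 0; exact ⟨t, ht⟩
  have hc : (0 : ℝ) < T.card := by exact_mod_cast hTn.card_pos
  obtain ⟨R, hR0, hR⟩ := hK.polar.exists_bound
  refine ⟨sY T T.card, sY_contDiff _ hTn, sY_mem _ hTn hK.polar.convex hTL,
    ⟨_, sY_fderiv _ hTn hR0.le fun t ht => by simpa using hR (hTL t ht)⟩, fun x => ?_, fun x x' hx => ?_⟩
  · obtain ⟨t₀, ht₀, hmax⟩ := T.exists_max_image (fun t => ⟪x, t⟫) hTn
    obtain ⟨t, ht, hle⟩ := hT x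
    have := sY_inner_le (T.card : ℝ) hTn hc ht₀ x hmax
    rw [div_self hc.ne'] at this
    linarith [hmax t ht]
  · refine sY_mono _ hTn hc ?_
    have hx0 : x - x' ≠ 0 := sub_ne_zero.2 hx
    have hx1 : -(x - x') ≠ 0 := neg_ne_zero.2 hx0
    obtain ⟨s, hs, h1⟩ := hT (x - x')
    obtain ⟨t, ht, h2⟩ := hT (-(x - x'))
    have p1 := hK.sub.pos _ hx0
    have p2 := hK.sub.pos _ hx1
    rw [inner_neg_left] at h2
    exact ⟨s, hs, t, ht, by intro h; linarith⟩

end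

noncomputable section

/-- the bump function used for cutoffs -/
def bmp (n : ℕ) : ContDiffBump (0 : VV n) := ⟨1, 2, one_pos, one_lt_two⟩

/-- cutoff at scale `k+1` -/
def chi (n k : ℕ) (z : VV n) : ℝ := bmp n (((k : ℝ) + 1)⁻¹ • z)

lemma chi_contDiff (n k : ℕ) : ContDiff ℝ 1 (chi n k) := by
  unfold chi
  exact (bmp n).contDiff.comp (contDiff_const_smul _)

lemma chi_nonneg (n k : ℕ) (z : VV n) : 0 ≤ chi n k z := (bmp n).nonneg
lemma chi_le_one (n k : ℕ) (z : VV n) : chi n k z ≤ 1 := (bmp n).le_one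

lemma chi_zero {n k : ℕ} {z : VV n} (h : 2 * ((k : ℝ) + 1) ≤ ‖z‖) : chi n k z = 0 := by
  have hk : (0 : ℝ) < (k : ℝ) + 1 := by positivity
  refine (bmp n).zero_of_le_dist ?_
  rw [dist_zero_right, norm_smul, norm_inv, Real.norm_eq_abs, abs_of_pos hk, ← div_eq_inv_mul, le_div_iff₀ hk]
  exact h

lemma chi_one {n k : ℕ} {z : VV n} (h : ‖z‖ ≤ (k : ℝ) + 1) : chi n k z = 1 := by
  have hk : (0 : ℝ) < (k : ℝ) + 1 := by positivity
  refine (bmp n).one_of_mem_closedBall ?_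
  rw [mem_closedBall, dist_zero_right, norm_smul, norm_inv, Real.norm_eq_abs, abs_of_pos hk, ← div_eq_inv_mul,
    div_le_iff₀ hk]
  simpa [bmp] using h

lemma chi_smul_compact {n : ℕ} (k : ℕ) (σ : VV n → VV n) : HasCompactSupport fun z => chi n k z • σ z := by
  refine HasCompactSupport.of_support_subset_isCompact (isCompact_closedBall (0 : VV n) (2 * ((k : ℝ) + 1))) ?_
  intro z hz
  by_contra h
  rw [mem_closedBall, dist_zero_right, not_le] at h
  exact hz (by simp only [chi_zero h.le, zero_smul])

lemma chi_smul_contDiff {n : ℕ} (k : ℕ) {σ : VV n → VV n} (h : ContDiff ℝ 1 σ) :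
    ContDiff ℝ 1 fun z => chi n k z • σ z := (chi_contDiff n k).smul h

lemma chi_smul_eventually {n : ℕ} (σ : VV n → VV n) (z : VV n) :
    ∀ᶠ k : ℕ in Filter.atTop, (fun z => chi n k z • σ z) =ᶠ[nhds z] σ := by
  obtain ⟨N, hN⟩ := exists_nat_gt ‖z‖
  filter_upwards [Filter.eventually_ge_atTop N] with k hk
  have h1 : ‖z‖ < (k : ℝ) + 1 := by
    have : (N : ℝ) ≤ k := by exact_mod_cast hk
    linarith
  filter_upwards [(isOpen_lt continuous_norm continuous_const).mem_nhds h1] with w hw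
  rw [chi_one (le_of_lt hw), one_smul]

lemma chi_smul_fderiv {n : ℕ} {σ : VV n → VV n} (h : ContDiff ℝ 1 σ) (hb : ∃ C, ∀ z, ‖fderiv ℝ σ z‖ ≤ C) :
    ∃ C, ∀ (k : ℕ) z, ‖fderiv ℝ (fun z => chi n k z • σ z) z‖ ≤ C := by
  obtain ⟨C, hC⟩ := hb
  have hC0 : 0 ≤ C := (norm_nonneg _).trans (hC 0)
  have hd : Differentiable ℝ σ := h.differentiable (by norm_num)
  have hb1 : ContDiff ℝ 1 (bmp n) := (bmp n).contDiff
  obtain ⟨M, hM⟩ := ((bmp n).hasCompactSupport.fderiv (𝕜 := ℝ)).exists_bound_of_continuous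
    (hb1.continuous_fderiv (by norm_num))
  have hM0 : 0 ≤ M := (norm_nonneg _).trans (hM 0)
  have hg : ∀ z, ‖σ z‖ ≤ ‖σ 0‖ + C * ‖z‖ := by
    intro z
    have := Convex.norm_image_sub_le_of_norm_fderiv_le (𝕜 := ℝ) (f := σ) (s := univ) (x := 0) (y := z)
      (fun x _ => hd x) (fun x _ => hC x) convex_univ (mem_univ _) (mem_univ _)
    rw [sub_zero] at this
    have h2 := norm_le_norm_add_norm_sub' (σ z) (σ 0)
    linarith
  refine ⟨C + M * (‖σ 0‖ + C * 2), fun k z => ?_⟩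
  have hk : (0 : ℝ) < (k : ℝ) + 1 := by positivity
  rw [fderiv_fun_smul ((chi_contDiff n k).differentiable (by norm_num) z) (hd z)]
  refine (norm_add_le _ _).trans (add_le_add ?_ ?_)
  · rw [norm_smul, Real.norm_eq_abs, abs_of_nonneg (chi_nonneg n k z)]
    have := chi_le_one n k z
    have := chi_nonneg n k z
    have := hC z
    nlinarith [norm_nonneg (fderiv ℝ σ z)]
  · rw [ContinuousLinearMap.norm_smulRight_apply]
    have e : fderiv ℝ (chi n k) z = ((k : ℝ) + 1)⁻¹ • fderiv ℝ (bmp n) (((k : ℝ) + 1)⁻¹ • z) :=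
      fderiv_comp_smul (f := bmp n) (((k : ℝ) + 1)⁻¹)
    rw [e]
    by_cases hz : ‖z‖ ≤ 2 * ((k : ℝ) + 1)
    · rw [norm_smul, norm_inv, Real.norm_eq_abs, abs_of_pos hk]
      have h1 : ‖σ z‖ ≤ ((k : ℝ) + 1) * (‖σ 0‖ + C * 2) := by
        have := hg z
        have hk0 : (0 : ℝ) ≤ k := by positivity
        nlinarith [norm_nonneg (σ 0), mul_le_mul_of_nonneg_left hz hC0, mul_nonneg hk0 (norm_nonneg (σ 0))]
      calc _ ≤ ((k : ℝ) + 1)⁻¹ * M * (((k : ℝ) + 1) * (‖σ 0‖ + C * 2)) := by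
            gcongr; exact hM _
        _ = _ := by field_simp
    · have : ((k : ℝ) + 1)⁻¹ • z ∉ tsupport (bmp n) := by
        rw [ContDiffBump.tsupport_eq, mem_closedBall, dist_zero_right, norm_smul, norm_inv, Real.norm_eq_abs,
          abs_of_pos hk, ← div_eq_inv_mul, div_le_iff₀ hk]
        exact hz
      rw [fderiv_of_notMem_tsupport ℝ this, smul_zero, norm_zero, zero_mul]
      positivity

lemma bV_repr_inl {n : ℕ} (v : VV n) (i : Fin n) : (bV n).repr v (Sum.inl i) = v.1 i := by
  simp [bV]
lemma bV_repr_inr {n : ℕ} (v : VV n) (i : Fin n) : (bV n).repr v (Sum.inr i) = v.2 i := by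
  simp [bV]
lemma bV_inl {n : ℕ} (i : Fin n) : bV n (Sum.inl i) = (EuclideanSpace.single i 1, 0) := by
  simp [bV]
lemma bV_inr {n : ℕ} (i : Fin n) : bV n (Sum.inr i) = (0, EuclideanSpace.single i 1) := by
  simp [bV]

lemma Jm_entry {n : ℕ} (σ : VV n → VV n) (z : VV n) (i j) : ‖Jm σ z i j‖ ≤ ‖fderiv ℝ σ z‖ := by
  rw [Jm, Matrix.map_apply, LinearMap.toMatrix_apply, Complex.norm_real]
  have h1 : ‖(bV n) j‖ ≤ 1 := by
    rcases j with j | j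
    · rw [bV_inl, Prod.norm_def]; simp
    · rw [bV_inr, Prod.norm_def]; simp
  have h2 : ∀ v : VV n, ‖(bV n).repr v i‖ ≤ ‖v‖ := by
    intro v
    rcases i with i | i
    · rw [bV_repr_inl]; exact (PiLp.norm_apply_le v.1 i).trans (norm_fst_le v)
    · rw [bV_repr_inr]; exact (PiLp.norm_apply_le v.2 i).trans (norm_snd_le v)
  refine (h2 _).trans ?_
  exact ((fderiv ℝ σ z).le_opNorm _).trans (mul_le_of_le_one_right (norm_nonneg _) h1)

lemma det_bound {n : ℕ} {σ₁ σ₂ : VV n → VV n} {z : VV n} {C : ℝ} (h1 : ‖fderiv ℝ σ₁ z‖ ≤ C)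
    (h2 : ‖fderiv ℝ σ₂ z‖ ≤ C) :
    ‖(1 + (1 : ℂ) • Jm σ₁ z + Complex.I • Jm σ₂ z).det‖ ≤
      (Fintype.card (Fin n ⊕ Fin n)).factorial • (1 + C + C) ^ Fintype.card (Fin n ⊕ Fin n) := by
  refine Matrix.det_le (abv := NormedField.toAbsoluteValue ℂ) fun i j => ?_
  show ‖(1 + (1 : ℂ) • Jm σ₁ z + Complex.I • Jm σ₂ z) i j‖ ≤ _
  rw [Matrix.add_apply, Matrix.add_apply, Matrix.smul_apply, Matrix.smul_apply, one_smul]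
  refine norm_add₃_le.trans (add_le_add (add_le_add ?_ ((Jm_entry _ _ _ _).trans h1)) ?_)
  · rw [Matrix.one_apply]; split_ifs <;> simp
  · rw [norm_smul, Complex.norm_I, one_mul]; exact (Jm_entry _ _ _ _).trans h2

lemma integrable_exp_neg_norm {n : ℕ} {c : ℝ} (hc : 0 < c) : Integrable fun x : Euc n => Real.exp (-(c * ‖x‖)) := by
  have h := integrable_one_add_norm (E := Euc n) (μ := volume) (r := ((n + 1 : ℕ) : ℝ))
    (by simp)
  refine (h.const_mul (Real.exp c * (n + 1).factorial / c ^ (n + 1))).mono' (by fun_prop)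
    (Filter.Eventually.of_forall fun x => ?_)
  have hx : 0 < 1 + ‖x‖ := by positivity
  have := Real.pow_div_factorial_le_exp (c * (1 + ‖x‖)) (by positivity) (n + 1)
  rw [Real.rpow_neg hx.le, Real.rpow_natCast, Real.norm_eq_abs, abs_of_pos (Real.exp_pos _)]
  have e : Real.exp (-(c * ‖x‖)) = Real.exp c * (Real.exp (c * (1 + ‖x‖)))⁻¹ := by
    rw [← Real.exp_neg, ← Real.exp_add]; congr 1; ring
  rw [e]
  calc Real.exp c * (Real.exp (c * (1 + ‖x‖)))⁻¹ ≤ Real.exp c * ((c * (1 + ‖x‖)) ^ (n + 1) / (n + 1).factorial)⁻¹ := by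
        gcongr
    _ = _ := by rw [mul_pow]; field_simp

end

noncomputable section

variable {n : ℕ}

/-- first deformation field -/
def s1 (y : Euc n → Euc n) (z : VV n) : VV n := (1 / 2 : ℝ) • (y z.1 - z.1, y z.2 - z.2)
/-- second deformation field -/
def s2 (y : Euc n → Euc n) (z : VV n) : VV n := (1 / 2 : ℝ) • (z.2 - y z.2, y z.1 - z.1)
/-- the transport map -/
def PhiM (y : Euc n → Euc n) (z : VV n) : VV n := (z.1 + z.2, y z.1 - y z.2)

section der
variable (A B : Euc n →L[ℝ] Euc n)
/-- derivative of `s1` -/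
def D1 : VV n →L[ℝ] VV n := (1 / 2 : ℝ) •
  ((A - .id ℝ _).comp (.fst ℝ (Euc n) (Euc n))).prod ((B - .id ℝ _).comp (.snd ℝ (Euc n) (Euc n)))
/-- derivative of `s2` -/
def D2 : VV n →L[ℝ] VV n := (1 / 2 : ℝ) •
  ((.id ℝ _ - B).comp (.snd ℝ (Euc n) (Euc n))).prod ((A - .id ℝ _).comp (.fst ℝ (Euc n) (Euc n)))
/-- derivative of `PhiM` -/
def D3 : VV n →L[ℝ] VV n :=
  (ContinuousLinearMap.fst ℝ (Euc n) (Euc n) + .snd ℝ (Euc n) (Euc n)).prod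
    (A.comp (.fst ℝ (Euc n) (Euc n)) - B.comp (.snd ℝ (Euc n) (Euc n)))

lemma D1_apply (w : VV n) : D1 A B w = (1 / 2 : ℝ) • (A w.1 - w.1, B w.2 - w.2) := by
  simp [D1]
lemma D2_apply (w : VV n) : D2 A B w = (1 / 2 : ℝ) • (w.2 - B w.2, A w.1 - w.1) := by
  simp [D2]
lemma D3_apply (w : VV n) : D3 A B w = (w.1 + w.2, A w.1 - B w.2) := by
  simp [D3]

variable {A B}
lemma half_bound {C : ℝ} (hA : ‖A‖ ≤ C) (x : Euc n) : ‖A x - x‖ ≤ (C + 1) * ‖x‖ := by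
  refine (norm_sub_le _ _).trans ?_
  have := (A.le_opNorm x).trans (mul_le_mul_of_nonneg_right hA (norm_nonneg _))
  linarith

lemma D1_norm {C : ℝ} (hA : ‖A‖ ≤ C) (hB : ‖B‖ ≤ C) : ‖D1 A B‖ ≤ C + 1 := by
  have hC : 0 ≤ C := (norm_nonneg _).trans hA
  refine ContinuousLinearMap.opNorm_le_bound _ (by linarith) fun w => ?_
  rw [D1_apply, norm_smul, Prod.norm_def]
  have h1 : max ‖A w.1 - w.1‖ ‖B w.2 - w.2‖ ≤ (C + 1) * ‖w‖ := max_le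
    ((half_bound hA _).trans (mul_le_mul_of_nonneg_left (norm_fst_le w) (by linarith)))
    ((half_bound hB _).trans (mul_le_mul_of_nonneg_left (norm_snd_le w) (by linarith)))
  have h0 : 0 ≤ (C + 1) * ‖w‖ := by positivity
  rw [Real.norm_eq_abs, abs_of_pos (by norm_num : (0 : ℝ) < 1 / 2)]
  try dsimp only at h1 ⊢
  linarith

lemma D2_norm {C : ℝ} (hA : ‖A‖ ≤ C) (hB : ‖B‖ ≤ C) : ‖D2 A B‖ ≤ C + 1 := by
  have hC : 0 ≤ C := (norm_nonneg _).trans hA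
  refine ContinuousLinearMap.opNorm_le_bound _ (by linarith) fun w => ?_
  rw [D2_apply, norm_smul, Prod.norm_def]
  simp only [norm_sub_rev w.2 (B w.2)]
  have h1 : max ‖B w.2 - w.2‖ ‖A w.1 - w.1‖ ≤ (C + 1) * ‖w‖ := max_le
    ((half_bound hB _).trans (mul_le_mul_of_nonneg_left (norm_snd_le w) (by linarith)))
    ((half_bound hA _).trans (mul_le_mul_of_nonneg_left (norm_fst_le w) (by linarith)))
  have h0 : 0 ≤ (C + 1) * ‖w‖ := by positivity
  rw [Real.norm_eq_abs, abs_of_pos (by norm_num : (0 : ℝ) < 1 / 2)]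
  try dsimp only at h1 ⊢
  linarith
end der

section maps
variable {y : Euc n → Euc n}

lemma y_fst (h : ContDiff ℝ 1 y) (z : VV n) : HasFDerivAt (fun z : VV n => y z.1) ((fderiv ℝ y z.1).comp (.fst ℝ (Euc n) (Euc n))) z :=
  ((h.differentiable (by norm_num) z.1).hasFDerivAt).comp z hasFDerivAt_fst
lemma y_snd (h : ContDiff ℝ 1 y) (z : VV n) : HasFDerivAt (fun z : VV n => y z.2) ((fderiv ℝ y z.2).comp (.snd ℝ (Euc n) (Euc n))) z :=
  ((h.differentiable (by norm_num) z.2).hasFDerivAt).comp z hasFDerivAt_snd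

lemma s1_deriv (h : ContDiff ℝ 1 y) (z : VV n) : HasFDerivAt (s1 y) (D1 (fderiv ℝ y z.1) (fderiv ℝ y z.2)) z :=
  ((((y_fst h z).sub hasFDerivAt_fst).prodMk ((y_snd h z).sub hasFDerivAt_snd)).const_smul (1 / 2 : ℝ)).congr_fderiv
    (by ext w <;> simp [D1])
lemma s2_deriv (h : ContDiff ℝ 1 y) (z : VV n) : HasFDerivAt (s2 y) (D2 (fderiv ℝ y z.1) (fderiv ℝ y z.2)) z :=
  (((hasFDerivAt_snd.sub (y_snd h z)).prodMk ((y_fst h z).sub hasFDerivAt_fst)).const_smul (1 / 2 : ℝ)).congr_fderiv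
    (by ext w <;> simp [D2])
lemma PhiM_deriv (h : ContDiff ℝ 1 y) (z : VV n) : HasFDerivAt (PhiM y) (D3 (fderiv ℝ y z.1) (fderiv ℝ y z.2)) z :=
  ((hasFDerivAt_fst.add hasFDerivAt_snd).prodMk ((y_fst h z).sub (y_snd h z))).congr_fderiv
    (by ext w <;> simp [D3])

lemma s1_contDiff (h : ContDiff ℝ 1 y) : ContDiff ℝ 1 (s1 y) := by
  unfold s1; fun_prop
lemma s2_contDiff (h : ContDiff ℝ 1 y) : ContDiff ℝ 1 (s2 y) := by
  unfold s2; fun_prop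
end maps

/-- complexified matrix of a linear map -/
def Ym (A : Euc n →L[ℝ] Euc n) : Matrix (Fin n) (Fin n) ℂ :=
  fun i j => ((A (EuclideanSpace.single j 1) i : ℝ) : ℂ)

/-- complexified matrix on the double space -/
def Zm (D : VV n →L[ℝ] VV n) : Matrix (Fin n ⊕ Fin n) (Fin n ⊕ Fin n) ℂ :=
  (LinearMap.toMatrix (bV n) (bV n) (D : VV n →ₗ[ℝ] VV n)).map Complex.ofReal

lemma Zm_D1 (A B : Euc n →L[ℝ] Euc n) :
    Zm (D1 A B) = Matrix.fromBlocks ((1 / 2 : ℂ) • (Ym A - 1)) 0 0 ((1 / 2 : ℂ) • (Ym B - 1)) := by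
  ext i j
  rw [Zm, Matrix.map_apply, LinearMap.toMatrix_apply]
  rcases i with i | i <;> rcases j with j | j <;>
  · simp only [ContinuousLinearMap.coe_coe, D1_apply, bV_repr_inl, bV_repr_inr, bV_inl, bV_inr]
    simp [Ym, Matrix.one_apply, apply_ite Complex.ofReal]

lemma Zm_D2 (A B : Euc n →L[ℝ] Euc n) :
    Zm (D2 A B) = Matrix.fromBlocks 0 ((1 / 2 : ℂ) • (1 - Ym B)) ((1 / 2 : ℂ) • (Ym A - 1)) 0 := by
  ext i j
  rw [Zm, Matrix.map_apply, LinearMap.toMatrix_apply]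
  rcases i with i | i <;> rcases j with j | j <;>
  · simp only [ContinuousLinearMap.coe_coe, D2_apply, bV_repr_inl, bV_repr_inr, bV_inl, bV_inr]
    simp [Ym, Matrix.one_apply, apply_ite Complex.ofReal]

lemma Zm_D3 (A B : Euc n →L[ℝ] Euc n) :
    Zm (D3 A B) = Matrix.fromBlocks 1 1 (Ym A) (-Ym B) := by
  ext i j
  rw [Zm, Matrix.map_apply, LinearMap.toMatrix_apply]
  rcases i with i | i <;> rcases j with j | j <;>
  · simp only [ContinuousLinearMap.coe_coe, D3_apply, bV_repr_inl, bV_repr_inr, bV_inl, bV_inr]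
    simp [Ym, Matrix.one_apply, apply_ite Complex.ofReal]

lemma Zm_det (D : VV n →L[ℝ] VV n) : (Zm D).det = ((D.det : ℝ) : ℂ) := by
  have h1 : (Zm D).det = (((LinearMap.toMatrix (bV n) (bV n) (D : VV n →ₗ[ℝ] VV n)).det : ℝ) : ℂ) :=
    (RingHom.map_det Complex.ofRealHom _).symm
  rw [h1, LinearMap.det_toMatrix]

lemma mat_fact (Y Y' : Matrix (Fin n) (Fin n) ℂ) :
    (1 : Matrix (Fin n ⊕ Fin n) (Fin n ⊕ Fin n) ℂ)
      + (1 : ℂ) • Matrix.fromBlocks ((1 / 2 : ℂ) • (Y - 1)) 0 0 ((1 / 2 : ℂ) • (Y' - 1))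
      + Complex.I • Matrix.fromBlocks 0 ((1 / 2 : ℂ) • (1 - Y')) ((1 / 2 : ℂ) • (Y - 1)) 0
    = ((1 / 2 : ℂ) • Matrix.fromBlocks 1 1 (-(Complex.I • 1)) (Complex.I • 1)) * Matrix.fromBlocks 1 1 Y (-Y')
        * Matrix.fromBlocks 1 0 0 (Complex.I • 1) := by
  rw [← Matrix.fromBlocks_one, Matrix.fromBlocks_smul, Matrix.fromBlocks_smul, Matrix.fromBlocks_smul,
    Matrix.fromBlocks_add, Matrix.fromBlocks_add, Matrix.fromBlocks_multiply, Matrix.fromBlocks_multiply]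
  have hI := Complex.I_mul_I
  congr 1 <;>
  · ext i j
    simp [Matrix.one_apply]
    ring_nf
    try simp
    try ring_nf
    try (split_ifs <;> ring)

lemma det_fact (A B : Euc n →L[ℝ] Euc n) :
    ‖(1 + (1 : ℂ) • Zm (D1 A B) + Complex.I • Zm (D2 A B)).det‖ = (1 / 2) ^ n * |(D3 A B).det| := by
  rw [Zm_D1, Zm_D2, mat_fact, ← Zm_D3, Matrix.det_mul, Matrix.det_mul, Zm_det, Matrix.det_smul,
    Matrix.det_fromBlocks_one₁₁, Matrix.det_fromBlocks_zero₂₁]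
  have e : (Complex.I • 1 - -(Complex.I • 1) * 1 : Matrix (Fin n) (Fin n) ℂ) = (2 * Complex.I) • 1 := by
    rw [mul_one, sub_neg_eq_add, ← add_smul]; congr 1; ring
  rw [e, Matrix.det_smul, Matrix.det_smul]
  simp only [Matrix.det_one, Fintype.card_sum, Fintype.card_fin, norm_mul, norm_pow, Complex.norm_I, Complex.norm_real,
    Real.norm_eq_abs, mul_one, one_mul, one_pow]
  norm_num
  left
  rw [pow_add, mul_assoc, ← mul_pow]; norm_num

end

noncomputable section

variable {n : ℕ}

lemma Jm_congr {σ τ : VV n → VV n} {z : VV n} (h : σ =ᶠ[nhds z] τ) : Jm σ z = Jm τ z := by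
  rw [Jm, Jm, h.fderiv_eq]

lemma Hf_congr {σ₁ σ₂ τ₁ τ₂ : VV n → VV n} {z : VV n} (h1 : σ₁ =ᶠ[nhds z] τ₁) (h2 : σ₂ =ᶠ[nhds z] τ₂) (a b : ℂ) :
    Hf σ₁ σ₂ a b z = Hf τ₁ τ₂ a b z := by
  rw [Hf, Hf, Jm_congr h1, Jm_congr h2, Qf, Qf, h1.eq_of_nhds, h2.eq_of_nhds]

lemma Hf_meas {σ₁ σ₂ : VV n → VV n} (h1 : ContDiff ℝ 1 σ₁) (h2 : ContDiff ℝ 1 σ₂) (a b : ℂ) :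
    Continuous (Hf σ₁ σ₂ a b) := by
  have j1 := Jm_continuous h1
  have j2 := Jm_continuous h2
  have c1 := h1.continuous
  have c2 := h2.continuous
  have b1 := Complex.continuous_ofReal.comp (bet_cont (continuous_id (X := VV n)) continuous_id)
  have b2 := Complex.continuous_ofReal.comp (bet_cont c1 c1)
  have b3 := Complex.continuous_ofReal.comp (bet_cont c2 c2)
  have b4 := Complex.continuous_ofReal.comp (bet_cont (continuous_id (X := VV n)) c1)
  have b5 := Complex.continuous_ofReal.comp (bet_cont (continuous_id (X := VV n)) c2)
  have b6 := Complex.continuous_ofReal.comp (bet_cont c1 c2)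
  have hQ : Continuous (Qf σ₁ σ₂ a b) :=
    ((((b1.add (continuous_const.mul b2)).add (continuous_const.mul b3)).add (continuous_const.mul b4)).add
      (continuous_const.mul b5)).add (continuous_const.mul b6)
  have hD : Continuous fun z => (1 + a • Jm σ₁ z + b • Jm σ₂ z).det :=
    Continuous.matrix_det ((continuous_const.add (j1.const_smul a)).add (j2.const_smul b))
  exact (Complex.continuous_exp.comp hQ.neg).mul hD

/-- the phase -/
def phs (y : Euc n → Euc n) (z : VV n) : ℝ := ⟪z.1, y z.1⟫ + ⟪z.2, y z.2⟫

lemma Qf_re (y : Euc n → Euc n) (c : ℝ) (z : VV n) {σ₁ σ₂ : VV n → VV n} (h1 : σ₁ z = c • s1 y z)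
    (h2 : σ₂ z = c • s2 y z) :
    (Qf σ₁ σ₂ 1 Complex.I z).re = (1 - c) * bet z z + c * phs y z := by
  have e : bet (σ₁ z) (σ₁ z) = bet (σ₂ z) (σ₂ z) := by
    rw [h1, h2]
    simp only [bet, s1, s2, Prod.smul_fst, Prod.smul_snd, inner_smul_left, inner_smul_right, RCLike.conj_to_real,
      real_inner_self_eq_norm_sq, norm_sub_rev z.2 (y z.2)]
    ring
  have e2 : 2 * bet z (σ₁ z) = c * (phs y z - bet z z) := by
    rw [h1]
    simp only [bet, s1, phs, Prod.smul_fst, Prod.smul_snd, inner_smul_right, inner_sub_right]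
    ring
  rw [Qf]
  simp only [one_pow, one_mul, mul_one, Complex.I_sq, Complex.add_re, Complex.mul_re, Complex.ofReal_re, Complex.ofReal_im,
    Complex.neg_re, Complex.one_re, Complex.re_ofNat, Complex.im_ofNat, Complex.I_re, Complex.I_im, Complex.neg_im,
    Complex.one_im, Complex.mul_im, mul_zero, zero_mul, sub_zero, add_zero]
  linarith

lemma Hf_norm {σ₁ σ₂ : VV n → VV n} (z : VV n) : ‖Hf σ₁ σ₂ 1 Complex.I z‖ =
    Real.exp (-(Qf σ₁ σ₂ 1 Complex.I z).re) * ‖(1 + (1 : ℂ) • Jm σ₁ z + Complex.I • Jm σ₂ z).det‖ := by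
  rw [Hf, norm_mul, Complex.norm_exp, Complex.neg_re]

theorem pi_eq {K : Set (Euc n)} (hK : Bod K) {y : Euc n → Euc n} (hy : MonoMap K y) :
    ∫ z, Hf (s1 y) (s2 y) 1 Complex.I z = ((Real.pi ^ n : ℝ) : ℂ) := by
  have c1 := s1_contDiff hy.smooth
  have c2 := s2_contDiff hy.smooth
  obtain ⟨C, hC⟩ := hy.bdd
  obtain ⟨C1, hC1⟩ := chi_smul_fderiv c1 ⟨_, fun z => by
    rw [(s1_deriv hy.smooth z).fderiv]; exact D1_norm (hC _) (hC _)⟩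
  obtain ⟨C2, hC2⟩ := chi_smul_fderiv c2 ⟨_, fun z => by
    rw [(s2_deriv hy.smooth z).fderiv]; exact D2_norm (hC _) (hC _)⟩
  obtain ⟨c, hc, hcl⟩ := hK.sub.exists_lower
  set M : ℝ := (Fintype.card (Fin n ⊕ Fin n)).factorial • (1 + max C1 C2 + max C1 C2) ^ Fintype.card (Fin n ⊕ Fin n)
    with hM
  have hlin : ∀ x : Euc n, c / 2 * ‖x‖ - (1 + (c / 2) ^ 2) ≤ ⟪x, y x⟫ := by
    intro x
    have := hy.coer x
    have := hcl x
    nlinarith [sq_nonneg c]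
  have hsq : ∀ x : Euc n, c / 2 * ‖x‖ - (1 + (c / 2) ^ 2) ≤ ⟪x, x⟫ := by
    intro x
    rw [real_inner_self_eq_norm_sq]
    nlinarith [sq_nonneg (‖x‖ - c / 2), norm_nonneg x, sq_nonneg ‖x‖, sq_nonneg (c/2)]
  have hbd : ∀ (k : ℕ) (z : VV n), ‖Hf (fun z => chi n k z • s1 y z) (fun z => chi n k z • s2 y z) 1 Complex.I z‖ ≤
      (Real.exp (2 * (1 + (c / 2) ^ 2)) * M) * (Real.exp (-(c / 2 * ‖z.1‖)) * Real.exp (-(c / 2 * ‖z.2‖))) := by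
    intro k z
    rw [Hf_norm]
    have d := det_bound ((hC1 k z).trans (le_max_left C1 C2)) ((hC2 k z).trans (le_max_right C1 C2))
    have q := Qf_re y (chi n k z) z (σ₁ := fun z => chi n k z • s1 y z) (σ₂ := fun z => chi n k z • s2 y z) rfl rfl
    have t0 := chi_nonneg n k z
    have t1 := chi_le_one n k z
    have a1 : c / 2 * ‖z.1‖ + c / 2 * ‖z.2‖ - 2 * (1 + (c / 2) ^ 2) ≤ bet z z := by
      have := hsq z.1; have := hsq z.2; rw [bet]; linarith
    have a2 : c / 2 * ‖z.1‖ + c / 2 * ‖z.2‖ - 2 * (1 + (c / 2) ^ 2) ≤ phs y z := by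
      have := hlin z.1; have := hlin z.2; rw [phs]; linarith
    have a3 : c / 2 * ‖z.1‖ + c / 2 * ‖z.2‖ - 2 * (1 + (c / 2) ^ 2) ≤ (1 - chi n k z) * bet z z + chi n k z * phs y z := by
      have := mul_le_mul_of_nonneg_left a1 (sub_nonneg.2 t1)
      have := mul_le_mul_of_nonneg_left a2 t0
      linarith
    rw [q]
    calc _ ≤ Real.exp (2 * (1 + (c / 2) ^ 2) + (-(c / 2 * ‖z.1‖) + -(c / 2 * ‖z.2‖))) * M := by
          gcongr
          linarith
      _ = _ := by rw [Real.exp_add, Real.exp_add]; ring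
  have hint : Integrable fun z : VV n =>
      (Real.exp (2 * (1 + (c / 2) ^ 2)) * M) * (Real.exp (-(c / 2 * ‖z.1‖)) * Real.exp (-(c / 2 * ‖z.2‖))) := by
    rw [Measure.volume_eq_prod]
    exact ((integrable_exp_neg_norm (half_pos hc)).mul_prod (integrable_exp_neg_norm (half_pos hc))).const_mul _
  have hlim := tendsto_integral_of_dominated_convergence
    (F := fun k => Hf (fun z => chi n k z • s1 y z) (fun z => chi n k z • s2 y z) 1 Complex.I)
    (f := Hf (s1 y) (s2 y) 1 Complex.I) (μ := volume) _
    (fun k => (Hf_meas (chi_smul_contDiff k c1) (chi_smul_contDiff k c2) _ _).aestronglyMeasurable) hint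
    (fun k => Filter.Eventually.of_forall (hbd k))
    (Filter.Eventually.of_forall fun z => by
      refine tendsto_const_nhds.congr' ?_
      filter_upwards [chi_smul_eventually (s1 y) z, chi_smul_eventually (s2 y) z] with k h1 h2
      exact (Hf_congr h1 h2 1 Complex.I).symm)
  have hcst : ∀ k : ℕ, ∫ z, Hf (fun z => chi n k z • s1 y z) (fun z => chi n k z • s2 y z) 1 Complex.I z
      = ((Real.pi ^ n : ℝ) : ℂ) := by
    intro k
    rw [Hf_main (chi_smul_contDiff k c1) (chi_smul_contDiff k c2) (chi_smul_compact k _) (chi_smul_compact k _),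
      gauss_integral]
  simp only [hcst] at hlim
  exact (tendsto_nhds_unique hlim tendsto_const_nhds)

theorem pi_le {K : Set (Euc n)} (hK : Bod K) {y : Euc n → Euc n} (hy : MonoMap K y) :
    ENNReal.ofReal ((2 * Real.pi) ^ n) ≤ ∫⁻ z : VV n, ENNReal.ofReal |(D3 (fderiv ℝ y z.1) (fderiv ℝ y z.2)).det| *
      ENNReal.ofReal (Real.exp (-(phs y z))) := by
  have h := pi_eq hK hy
  have h2 := enorm_integral_le_lintegral_enorm (μ := volume) (Hf (s1 y) (s2 y) 1 Complex.I)
  rw [h] at h2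
  have e : ∀ z, ‖Hf (s1 y) (s2 y) 1 Complex.I z‖ₑ = ENNReal.ofReal ((1 / 2) ^ n) *
     (ENNReal.ofReal |(D3 (fderiv ℝ y z.1) (fderiv ℝ y z.2)).det| * ENNReal.ofReal (Real.exp (-(phs y z)))) := by
    intro z
    rw [← ofReal_norm_eq_enorm, Hf_norm, Qf_re y 1 z (one_smul _ _).symm (one_smul _ _).symm]
    have j1 : Jm (s1 y) z = Zm (D1 (fderiv ℝ y z.1) (fderiv ℝ y z.2)) := by
      rw [Jm, (s1_deriv hy.smooth z).fderiv]; rfl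
    have j2 : Jm (s2 y) z = Zm (D2 (fderiv ℝ y z.1) (fderiv ℝ y z.2)) := by
      rw [Jm, (s2_deriv hy.smooth z).fderiv]; rfl
    rw [j1, j2, det_fact, ← ENNReal.ofReal_mul (by positivity), ← ENNReal.ofReal_mul (by positivity)]
    congr 1
    rw [sub_self, zero_mul, zero_add, one_mul]; ring
  simp only [e] at h2
  rw [lintegral_const_mul' _ _ ENNReal.ofReal_ne_top, ← ofReal_norm_eq_enorm, Complex.norm_real, Real.norm_eq_abs,
    abs_of_pos (by positivity)] at h2
  rw [mul_pow, ENNReal.ofReal_mul (by positivity)]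
  refine (mul_le_mul' le_rfl h2).trans ?_
  rw [← mul_assoc, ← ENNReal.ofReal_mul (by positivity), ← mul_pow]
  norm_num

end

noncomputable section

variable {n : ℕ}

lemma PhiM_inj {K : Set (Euc n)} {y : Euc n → Euc n} (hy : MonoMap K y) : Function.Injective (PhiM y) := by
  rintro ⟨a, b⟩ ⟨a', b'⟩ h
  simp only [PhiM, Prod.mk.injEq] at h
  obtain ⟨h1, h2⟩ := h
  have h3 : a - a' = -(b - b') := by
    rw [eq_neg_iff_add_eq_zero, sub_add_sub_comm, h1, sub_self]
  have h4 : y a - y a' = y b - y b' := by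
    rw [sub_eq_sub_iff_sub_eq_sub]; exact h2
  by_contra hne
  by_cases hab : a = a'
  · subst hab
    have : b = b' := by
      rw [sub_self, eq_comm, neg_eq_zero, sub_eq_zero] at h3; exact h3
    exact hne (by rw [this])
  · by_cases hbb : b = b'
    · rw [hbb, sub_self, neg_zero, sub_eq_zero] at h3; exact hab h3
    · have p1 := hy.mono a a' hab
      have p2 := hy.mono b b' hbb
      rw [h3, h4, inner_neg_left] at p1
      linarith

lemma lintegral_gauge {K : Set (Euc n)} (hK : Bod K) (hs : ∀ v ∈ K, -v ∈ K) :
    ∫⁻ u : Euc n, ENNReal.ofReal (Real.exp (-(gauge K u / 2))) ≤ n.factorial * (2 ^ n * volume K) := by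
  have hS := hK.sub
  obtain ⟨c, hc, hcl⟩ := hS.exists_lower
  have g0 : gauge K 0 / 2 = 0 := by rw [gauge_zero, zero_div]
  have gn : ∀ x, gauge K (-x) / 2 = gauge K x / 2 := fun x => by rw [gauge_neg hs]
  have gz : ∀ {x}, gauge K x / 2 = 0 → x = 0 := by
    intro x hx
    by_contra h
    have := hS.pos x h
    linarith
  have h := measure_lt_one_eq_integral_div_gamma (volume : Measure (Euc n)) (g := fun x => gauge K x / 2) g0 gn
    (fun x y => by have := hS.add x y; linarith) gz
    (fun r x => by
      rcases le_total 0 r with hr | hr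
      · rw [hS.smul r hr, abs_of_nonneg hr]; exact le_of_eq (by ring)
      · have : r • x = (-r) • (-x) := by simp
        rw [this, hS.smul (-r) (by linarith), gauge_neg hs, abs_of_nonpos hr]; exact le_of_eq (by ring)) one_pos
  simp only [Real.rpow_one, div_one, finrank_euclideanSpace, Fintype.card_fin, Real.Gamma_nat_eq_factorial] at h
  have hint : Integrable fun x : Euc n => Real.exp (-(gauge K x / 2)) := by
    refine (integrable_exp_neg_norm (n := n) (half_pos hc)).mono' ?_ (Filter.Eventually.of_forall fun x => ?_)
    · have := hS.continuous
      exact Continuous.aestronglyMeasurable (by fun_prop)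
    · rw [Real.norm_eq_abs, abs_of_pos (Real.exp_pos _), Real.exp_le_exp]
      have := hcl x
      linarith
  rw [← ofReal_integral_eq_lintegral_ofReal hint (Filter.Eventually.of_forall fun x => (Real.exp_pos _).le)]
  have hf : (0 : ℝ) < n.factorial := by exact_mod_cast n.factorial_pos
  have e : (∫ x : Euc n, Real.exp (-(gauge K x / 2))) =
      n.factorial * ((∫ x : Euc n, Real.exp (-(gauge K x / 2))) / n.factorial) := by field_simp
  rw [e, ENNReal.ofReal_mul hf.le, ENNReal.ofReal_natCast, ← h]
  refine mul_le_mul' le_rfl ?_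
  have h2 : (2 : ℝ≥0∞) ^ n * volume K = volume ((2 : ℝ) • K) := by
    rw [vol_smul (by norm_num)]; norm_num
  rw [h2]
  refine measure_mono fun x hx => ?_
  rw [mem_ofPred_eq] at hx
  refine ⟨(1 / 2 : ℝ) • x, ?_, by simp⟩
  rw [← hK.gauge_le_one, hS.smul _ (by norm_num)]
  linarith

theorem bm {K : Set (Euc n)} (hn : 0 < n) (hK : Bod K) (hs : ∀ v ∈ K, -v ∈ K) :
    ((n : ℝ≥0∞) ^ n)⁻¹ ≤ (ENNReal.ofReal (Real.exp 2)) ^ n * (volume K * volume (polarSet K)) := by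
  obtain ⟨y, hy⟩ := exists_monoMap hK
  have hL := hK.polar
  have hLs : ∀ v ∈ polarSet K, -v ∈ polarSet K := by
    intro v hv x hx
    have := hv (-x) (hs x hx)
    simpa using this
  set G : VV n → ℝ≥0∞ := fun w => ENNReal.ofReal (Real.exp (2 - gauge K w.1 / 2)) *
    ((2 : ℝ) • polarSet K).indicator 1 w.2 with hG
  have hle : ∀ z, ENNReal.ofReal (Real.exp (-(phs y z))) ≤ G (PhiM y z) := by
    intro z
    have hmem : (PhiM y z).2 ∈ (2 : ℝ) • polarSet K := by
      refine ⟨(1 / 2 : ℝ) • y z.1 + (1 / 2 : ℝ) • (-y z.2),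
        hL.convex (hy.mem _) (hLs _ (hy.mem _)) (by norm_num) (by norm_num) (by norm_num), ?_⟩
      simp only [PhiM, smul_add, smul_smul, smul_neg]
      norm_num
      rw [sub_eq_add_neg]
    rw [hG]
    simp only
    rw [indicator_of_mem hmem, Pi.one_apply, mul_one]
    refine ENNReal.ofReal_le_ofReal (Real.exp_le_exp.2 ?_)
    have h1 := hy.coer z.1
    have h2 := hy.coer z.2
    have h3 := hK.sub.add z.1 z.2
    simp only [phs, PhiM]
    linarith
  have hcv := lintegral_image_eq_lintegral_abs_det_fderiv_mul (volume : Measure (VV n)) MeasurableSet.univ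
    (fun z _ => (PhiM_deriv hy.smooth z).hasFDerivWithinAt) (PhiM_inj hy).injOn G
  have hGi : ∫⁻ w, G w = (∫⁻ u : Euc n, ENNReal.ofReal (Real.exp (2 - gauge K u / 2))) * volume ((2 : ℝ) • polarSet K) := by
    have hms : MeasurableSet ((2 : ℝ) • polarSet K) := (hL.compact.smul (2 : ℝ)).measurableSet
    rw [Measure.volume_eq_prod, hG, lintegral_prod_mul
      (f := fun u : Euc n => ENNReal.ofReal (Real.exp (2 - gauge K u / 2)))
      (g := ((2 : ℝ) • polarSet K).indicator 1), lintegral_indicator_one hms]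
    · have := hK.sub.continuous
      exact Measurable.aemeasurable (by fun_prop)
    · exact (measurable_one.indicator hms).aemeasurable
  have hE : ∫⁻ u : Euc n, ENNReal.ofReal (Real.exp (2 - gauge K u / 2)) =
      ENNReal.ofReal (Real.exp 2) * ∫⁻ u : Euc n, ENNReal.ofReal (Real.exp (-(gauge K u / 2))) := by
    rw [← lintegral_const_mul' _ _ ENNReal.ofReal_ne_top]
    refine lintegral_congr fun u => ?_
    rw [← ENNReal.ofReal_mul (Real.exp_pos _).le, ← Real.exp_add, sub_eq_add_neg]
  have h1 : ENNReal.ofReal ((2 * Real.pi) ^ n) ≤ (ENNReal.ofReal (Real.exp 2) * (n.factorial * (2 ^ n * volume K))) *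
      (2 ^ n * volume (polarSet K)) := by
    calc _ ≤ _ := pi_le hK hy
      _ ≤ ∫⁻ z : VV n, ENNReal.ofReal |(D3 (fderiv ℝ y z.1) (fderiv ℝ y z.2)).det| * G (PhiM y z) :=
        lintegral_mono fun z => mul_le_mul' le_rfl (hle z)
      _ = ∫⁻ w in PhiM y '' univ, G w := by rw [hcv, Measure.restrict_univ]
      _ ≤ ∫⁻ w, G w := setLIntegral_le_lintegral _ _
      _ ≤ _ := by
        rw [hGi, hE, vol_smul (by norm_num)]
        refine mul_le_mul' (mul_le_mul' le_rfl (lintegral_gauge hK hs)) ?_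
        norm_num
  have h4 : (4 : ℝ≥0∞) ^ n ≤ ENNReal.ofReal ((2 * Real.pi) ^ n) := by
    rw [ENNReal.ofReal_pow (by positivity)]
    refine pow_le_pow_left' ?_ n
    rw [show (4 : ℝ≥0∞) = ENNReal.ofReal 4 by norm_num]
    exact ENNReal.ofReal_le_ofReal (by linarith [Real.pi_gt_three])
  have hfac : (n.factorial : ℝ≥0∞) ≤ (n : ℝ≥0∞) ^ n := by exact_mod_cast n.factorial_le_pow
  have he1 : ENNReal.ofReal (Real.exp 2) ≤ ENNReal.ofReal (Real.exp 2) ^ n := by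
    refine le_self_pow₀ ?_ hn.ne'
    rw [← ENNReal.ofReal_one]
    exact ENNReal.ofReal_le_ofReal (Real.one_le_exp (by norm_num))
  have h5 : (4 : ℝ≥0∞) ^ n * 1 ≤ 4 ^ n *
      ((n : ℝ≥0∞) ^ n * (ENNReal.ofReal (Real.exp 2) ^ n * (volume K * volume (polarSet K)))) := by
    rw [mul_one]
    refine (h4.trans h1).trans ?_
    calc _ ≤ (ENNReal.ofReal (Real.exp 2) ^ n * ((n : ℝ≥0∞) ^ n * (2 ^ n * volume K))) * (2 ^ n * volume (polarSet K)) := by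
          gcongr
      _ = (2 ^ n * 2 ^ n) * ((n : ℝ≥0∞) ^ n * (ENNReal.ofReal (Real.exp 2) ^ n * (volume K * volume (polarSet K)))) := by ring
      _ = _ := by rw [← mul_pow]; norm_num
  have h6 := (ENNReal.mul_le_mul_iff_right (pow_ne_zero n (by norm_num)) (ENNReal.pow_ne_top (by norm_num))).1 h5
  rw [ENNReal.inv_le_iff_le_mul] 
  · exact h6
  · intro _; exact pow_ne_zero _ (by exact_mod_cast hn.ne')
  · intro h; exact absurd h (ENNReal.pow_ne_top (ENNReal.natCast_ne_top n))

end

noncomputable section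

theorem VR_exists (d : ℕ) (hd : 0 < d) :
    ∃ Ω, VR d (ENNReal.ofReal (Real.exp 2) * 4) (ENNReal.ofReal (16 * Real.pi * Real.exp 2)) Ω := by
  refine ⟨((d : ℝ≥0∞) ^ d)⁻¹, ?_, ?_, fun p hp => ?_, fun p hp => ?_⟩
  · exact ENNReal.inv_ne_zero.2 (ENNReal.pow_ne_top (ENNReal.natCast_ne_top d))
  · exact ENNReal.inv_ne_top.2 (pow_ne_zero _ (by exact_mod_cast hd.ne'))
  · refine (bm hd hp.macA_bod fun v hv => Subl.macA_symm hv).trans ?_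
    calc _ ≤ ENNReal.ofReal (Real.exp 2) ^ d * (volume (macA p) * (4 ^ d * volume (uset p))) :=
          mul_le_mul' le_rfl (mul_le_mul' le_rfl hp.vol_polar_macA)
      _ = _ := by rw [mul_pow]; ring
  · exact (mul_le_mul' le_rfl (measure_mono Subl.uset_subset_polar_macA)).trans
      (santalo hd hp.macA_bod fun v hv => Subl.macA_symm hv)

end

/-- Duality for boundary Hilbert-ball coverings. -/
theorem hilbert_boundary_cover_duality :
    ∃ c : ℝ, 1 ≤ c ∧ ∀ d : ℕ, 2 ≤ d →
      ∀ G K : Set (Euc d), IsConvexBody G → IsConvexBody K →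
        (0 : Euc d) ∈ interior G → G ⊆ interior K →
        ∀ α : ℝ, 0 < α → α ≤ 1 →
          (c ^ d)⁻¹ * (hilbertCov (polarSet G) (frontier (polarSet K)) α : ℝ) ≤
              (hilbertCov K (frontier G) α : ℝ) ∧
          (hilbertCov K (frontier G) α : ℝ) ≤
              c ^ d * (hilbertCov (polarSet G) (frontier (polarSet K)) α : ℝ) := 
  main_of_VR (c := ENNReal.ofReal (Real.exp 2) * 4) (C := ENNReal.ofReal (16 * Real.pi * Real.exp 2))
    (ENNReal.mul_ne_top (ENNReal.mul_ne_top ENNReal.ofReal_ne_top (by norm_num)) ENNReal.ofReal_ne_top) VR_exists
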